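/- arXiv:math/0311266 — 5 statements merged into one kernel-verified Lean document; each statement's English description precedes it below -/
import Mathlib

section
/- Let m ≥ 1 and let k be any field. Then the invariant ring k[x_1,…,x_{2m}]^{S_2≀S_m} (the fixed-point subalgebra of MvPolynomial (Fin (2*m)) k under the variable-permuting action of the wreath product subgroup W(2,m) ≤ Equiv.Perm (Fin (2*m))) is a free module over the subalgebra E generated over k by the elementary symmetric polynomials e_1,…,e_{2m}; equivalently, k[x_1,…,x_{2m}]^{S_2≀S_m} is Cohen-Macaulay over every field k. -/
set_option synthInstance.maxHeartbeats 1000000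
set_option maxHeartbeats 1000000

open Finset

/-- The `i`-th consecutive block `{i*l, …, (i+1)*l - 1}` (0-indexed) of `Fin (l*m)`. -/
def wreathBlock (l m : ℕ) (i : Fin m) : Finset (Fin (l * m)) :=
  Finset.univ.filter (fun x => i.val * l ≤ x.val ∧ x.val < (i.val + 1) * l)

lemma wreathBlock_nonempty (l m : ℕ) (hl : 0 < l) (i : Fin m) :
    (wreathBlock l m i).Nonempty := by
  refine ⟨⟨i.val * l, ?_⟩, ?_⟩
  · have h := i.isLt
    calc i.val * l < (i.val + 1) * l := by
          rw [Nat.succ_mul]; omega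
      _ ≤ m * l := Nat.mul_le_mul_right l h
      _ = l * m := Nat.mul_comm m l
  · simp only [wreathBlock, Finset.mem_filter, Finset.mem_univ, true_and]
    constructor
    · exact le_refl _
    · rw [Nat.succ_mul]; omega

lemma wreathBlock_injective (l m : ℕ) (hl : 0 < l) :
    Function.Injective (wreathBlock l m) := by
  intro i j hij
  obtain ⟨x, hx⟩ := wreathBlock_nonempty l m hl i
  have hx' : x ∈ wreathBlock l m j := hij ▸ hx
  simp only [wreathBlock, Finset.mem_filter] at hx hx'
  have h1 : i.val * l ≤ x.val := hx.2.1
  have h2 : x.val < (i.val + 1) * l := hx.2.2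
  have h3 : j.val * l ≤ x.val := hx'.2.1
  have h4 : x.val < (j.val + 1) * l := hx'.2.2
  have hij1 : i.val < j.val + 1 :=
    Nat.lt_of_mul_lt_mul_right (lt_of_le_of_lt h1 h4)
  have hij2 : j.val < i.val + 1 :=
    Nat.lt_of_mul_lt_mul_right (lt_of_le_of_lt h3 h2)
  exact Fin.ext (by omega)

/-- The wreath product `S_l ≀ S_m` as the subgroup of permutations of `Fin (l*m)`
preserving the partition into `m` consecutive blocks of size `l`. -/
def wreathProduct (l m : ℕ) : Subgroup (Equiv.Perm (Fin (l * m))) where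
  carrier := { g | ∀ i : Fin m, ∃ j : Fin m,
    (wreathBlock l m i).image g = wreathBlock l m j }
  one_mem' := fun i => ⟨i, by simp⟩
  mul_mem' := by
    intro a b ha hb i
    obtain ⟨j, hj⟩ := hb i
    obtain ⟨r, hr⟩ := ha j
    refine ⟨r, ?_⟩
    have : ⇑(a * b) = ⇑a ∘ ⇑b := rfl
    rw [this, ← Finset.image_image, hj, hr]
  inv_mem' := by
    intro g hg
    rcases Nat.eq_zero_or_pos l with hl | hl
    · intro i
      refine ⟨i, ?_⟩
      subst hl
      have : (Finset.univ : Finset (Fin (0 * m))) = ∅ := by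
        apply Finset.eq_empty_of_forall_notMem
        intro x
        exact absurd x.isLt (by omega)
      simp [wreathBlock, this]
    · have hsurj : Function.Surjective
          (fun i : Fin m => Classical.choose (hg i)) := by
        apply Finite.injective_iff_surjective.mp
        intro i j hij
        have hi := Classical.choose_spec (hg i)
        have hj := Classical.choose_spec (hg j)
        simp only at hij
        rw [hij] at hi
        have himg : (wreathBlock l m i).image g = (wreathBlock l m j).image g :=
          hi.trans hj.symm
        have := Finset.image_injective (Equiv.injective g) himg
        exact wreathBlock_injective l m hl this
      intro i
      obtain ⟨j, hj⟩ := hsurj i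
      refine ⟨j, ?_⟩
      have hspec := Classical.choose_spec (hg j)
      simp only at hj
      rw [hj] at hspec
      rw [← hspec, Finset.image_image]
      have : ⇑g⁻¹ ∘ ⇑g = id := by
        funext x; simp
      rw [this, Finset.image_id]

/-- The invariant ring `k[x_1,…,x_n]^W`: the fixed-point subalgebra of the
polynomial ring under the variable-permuting action of `W ≤ S_n`. -/
noncomputable def invariantRing (k : Type) [CommRing k] (n : ℕ)
    (W : Subgroup (Equiv.Perm (Fin n))) : Subalgebra k (MvPolynomial (Fin n) k) where
  carrier := { p | ∀ g ∈ W, MvPolynomial.rename (⇑g) p = p }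
  add_mem' := by
    intro p q hp hq g hg
    rw [map_add, hp g hg, hq g hg]
  mul_mem' := by
    intro p q hp hq g hg
    rw [map_mul, hp g hg, hq g hg]
  algebraMap_mem' := by
    intro r g hg
    simp [MvPolynomial.algebraMap_eq, MvPolynomial.rename_C]

/-- The subalgebra of the invariant ring generated over `k` by the elementary
symmetric polynomials `e_1, …, e_n`. -/
noncomputable def esymmSubalgebra (k : Type) [CommRing k] (n : ℕ)
    (W : Subgroup (Equiv.Perm (Fin n))) : Subalgebra k (invariantRing k n W) :=
  Algebra.adjoin k { a : invariantRing k n W | ∃ i : ℕ, 1 ≤ i ∧ i ≤ n ∧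
    (a : MvPolynomial (Fin n) k) = MvPolynomial.esymm (Fin n) k i }


namespace WreathFree

variable {n : ℕ}

/-- `d` is a descent of the matching `M`. -/
def IsDes (M : Equiv.Perm (Fin n)) (d : Fin n) : Prop :=
  ∃ h : d.val + 1 < n, M ⟨d.val + 1, h⟩ < M d ∧ (M d).val ≠ d.val + 1

lemma lex_lt_iff {α : Type} [LT α] {a b : Fin n → α} :
    toLex a < toLex b ↔ ∃ i, (∀ j < i, a j = b j) ∧ a i < b i := Iff.rfl

lemma antitone_perm_le {δ : Fin n → ℕ} (hδ : Antitone δ) (u : Equiv.Perm (Fin n)) :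
    toLex (δ ∘ u) ≤ toLex δ := by
  by_contra hlt
  rw [not_le] at hlt
  obtain ⟨i, hi, hlt⟩ := lex_lt_iff.mp hlt
  simp only [Function.comp] at hi hlt
  have hcard : (univ.filter fun j => δ (u j) ≥ δ (u i)).card
      = (univ.filter fun j => δ j ≥ δ (u i)).card := by
    apply Finset.card_bij (fun j _ => u j)
    · intro j hj; simpa using hj
    · intro a _ b _ h; exact u.injective h
    · intro b hb
      refine ⟨u.symm b, ?_, ?_⟩ <;> simpa using hb
  have hlt2 : (univ.filter fun j => δ j ≥ δ (u i)) ⊂ (univ.filter fun j => δ (u j) ≥ δ (u i)) := by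
    rw [Finset.ssubset_iff_of_subset]
    · refine ⟨i, by simp, ?_⟩
      simpa using hlt
    · intro j hj
      simp only [mem_filter, mem_univ, true_and] at hj ⊢
      have hji : j < i := by
        by_contra hc
        have := hδ (not_lt.mp hc)
        omega
      rw [← hi j hji]; exact hj
  have := Finset.card_lt_card hlt2
  omega

/-- Lemma D -/
lemma swap_lt {M : Equiv.Perm (Fin n)} (hinv : ∀ x, M (M x) = x) (hfix : ∀ x, M x ≠ x)
    {i : Fin n} (hd : i.val + 1 < n) (hlt : M ⟨i.val + 1, hd⟩ < M i)
    (hne : (M i).val ≠ i.val + 1) :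
    toLex (⇑((Equiv.swap i ⟨i.val + 1, hd⟩)⁻¹ * M * Equiv.swap i ⟨i.val + 1, hd⟩))
      < toLex (⇑M : Fin n → Fin n) := by
  set i' : Fin n := ⟨i.val + 1, hd⟩ with hi'
  have hi'v : i'.val = i.val + 1 := rfl
  have hai' : M i ≠ i' := fun h => hne (by rw [h])
  have hbi : M i' ≠ i := fun h => hai' (by rw [← h, hinv])
  have hii' : i ≠ i' := fun h => by
    have := congrArg Fin.val h; omega
  have key : ∀ x, ((Equiv.swap i i')⁻¹ * M * Equiv.swap i i') x
      = Equiv.swap i i' (M (Equiv.swap i i' x)) := by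
    intro x; simp [Equiv.Perm.mul_apply]
  by_cases hb : M i' < i
  · refine lex_lt_iff.mpr ⟨M i', ?_, ?_⟩
    · intro j hj
      rw [key]
      have h1 : j ≠ i := by rintro rfl; exact absurd hj (not_lt.mpr hb.le)
      have h2 : j ≠ i' := by
        rintro rfl
        have : i.val < i'.val := by omega
        exact absurd (hj.trans hb) (not_lt.mpr (Fin.le_def.mpr this.le))
      rw [Equiv.swap_apply_of_ne_of_ne h1 h2]
      apply Equiv.swap_apply_of_ne_of_ne
      · rintro h; rw [← h, hinv] at hlt; exact absurd (hj.trans hlt) (lt_irrefl _)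
      · rintro h; rw [← h, hinv] at hj; exact absurd hj (lt_irrefl _)
    · rw [key, Equiv.swap_apply_of_ne_of_ne hbi (hfix i'), hinv, Equiv.swap_apply_right]
      exact Fin.lt_def.mpr (by omega)
  · refine lex_lt_iff.mpr ⟨i, ?_, ?_⟩
    · intro j hj
      rw [key]
      have hj' : j.val < i.val := hj
      have h1 : j ≠ i := hj.ne
      have h2 : j ≠ i' := by
        intro h; have := congrArg Fin.val h; omega
      rw [Equiv.swap_apply_of_ne_of_ne h1 h2]
      apply Equiv.swap_apply_of_ne_of_ne
      · rintro h; rw [← h, hinv] at hlt; exact hb (hlt.trans hj)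
      · rintro h; rw [← h, hinv] at hb; exact hb hj
    · rw [key, Equiv.swap_apply_left, Equiv.swap_apply_of_ne_of_ne hbi (hfix i')]
      exact hlt

/-- Lemma C -/
lemma le_conj {M : Equiv.Perm (Fin n)} (hinv : ∀ x, M (M x) = x) (hfix : ∀ x, M x ≠ x)
    {μ : Fin n → ℕ} (hμ : Antitone μ)
    (hdes : ∀ d : Fin n, ∀ h : d.val + 1 < n, IsDes M d → μ ⟨d.val + 1, h⟩ < μ d)
    (u : Equiv.Perm (Fin n)) (hu : μ ∘ u = μ) :
    toLex (⇑M : Fin n → Fin n) ≤ toLex ⇑(u⁻¹ * M * u) := by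
  by_contra hlt
  rw [not_le] at hlt
  obtain ⟨i, hi, hlt⟩ := lex_lt_iff.mp hlt
  set M' := u⁻¹ * M * u with hM'
  have hM'inv : ∀ x, M' (M' x) = x := by intro x; simp [hM', hinv]
  have hM'fix : ∀ x, M' x ≠ x := by
    intro x h
    apply hfix (u x)
    have := congrArg u h
    simpa [hM'] using this
  have hμu : ∀ x, μ (u x) = μ x := fun x => congrFun hu x
  have hμM' : ∀ x, μ (M' x) = μ (M (u x)) := by
    intro x; rw [← hμu (M' x)]; simp [hM']
  -- step rule inside blocks
  have step : ∀ d : Fin n, ∀ h : d.val + 1 < n, μ ⟨d.val + 1, h⟩ = μ d →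
      M d < M ⟨d.val + 1, h⟩ ∨ (M d).val = d.val + 1 := by
    intro d h hEq
    by_contra hc
    push Not at hc
    have hne : M ⟨d.val + 1, h⟩ ≠ M d := fun e => by
      have := congrArg Fin.val (M.injective e); simp at this
    have := hdes d h ⟨h, lt_of_le_of_ne hc.1 hne, hc.2⟩
    omega
  have hbi : i < M' i := by
    rcases lt_trichotomy (M' i) i with h | h | h
    · have h1 := hi _ h
      rw [hM'inv] at h1
      have h2 : M i = M' i := by
        conv_lhs => rw [h1]
        rw [hinv]
      rw [h2] at hlt; exact absurd hlt (lt_irrefl _)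
    · exact absurd h (hM'fix i)
    · exact h
  set a := M i with ha
  set b := M' i with hb
  have hMb : i < M b := by
    rcases lt_trichotomy (M b) i with h | h | h
    · have h1 := hi _ h
      rw [hinv] at h1
      have h2 : M' b = M b := by
        have h3 := congrArg M' h1
        rw [hM'inv] at h3; exact h3.symm
      rw [hb, hM'inv] at h2
      rw [← hb] at h2
      rw [← h2] at h; exact absurd h (lt_irrefl _)
    · have : b = a := by rw [ha, ← h, hinv]
      rw [this] at hlt; exact absurd hlt (lt_irrefl _)
    · exact h
  -- generic induction: from i, while in the block of i and before a, values stay ≥ a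
  have up : ∀ j : ℕ, ∀ hj : j < n, i.val ≤ j → j < a.val → μ ⟨j, hj⟩ = μ i → a ≤ M ⟨j, hj⟩ := by
    intro j hj hij
    induction j, hij using Nat.le_induction with
    | base => intro _ _; exact le_of_eq ha
    | succ j hij ih =>
      intro hja hμj
      have hj' : j < n := by omega
      have e1 : μ ⟨j + 1, hj⟩ ≤ μ ⟨j, hj'⟩ := hμ (Fin.le_def.mpr (by simp))
      have e2 : μ ⟨j, hj'⟩ ≤ μ i := hμ (Fin.le_def.mpr hij)
      have := ih hj' (by omega) (by omega)
      rcases step ⟨j, hj'⟩ hj (by simp only; omega) with h | h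
      · exact this.trans h.le
      · have h3 : a.val ≤ (M ⟨j, hj'⟩).val := this
        simp only at h
        omega
  have hiv : i.val < b.val := hbi
  have hbv : b.val < a.val := hlt
  have hμab : μ a ≤ μ b := hμ hlt.le
  have hμbi : μ b ≤ μ i := hμ hbi.le
  rcases hμab.lt_or_eq with hB | hB
  · -- a in a later block than b : counting
    have hcard : (univ.filter fun j => μ j = μ i ∧ μ b ≤ μ (M' j)).card
        = (univ.filter fun j => μ j = μ i ∧ μ b ≤ μ (M j)).card := by
      apply Finset.card_bij (fun j _ => u j)
      · intro j hj
        simp only [mem_filter, mem_univ, true_and] at hj ⊢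
        rw [hμu, ← hμM']; exact hj
      · intro a _ b _ h; exact u.injective h
      · intro c hc
        refine ⟨u.symm c, ?_, by simp⟩
        simp only [mem_filter, mem_univ, true_and] at hc ⊢
        have e := hμM' (u.symm c)
        have e' := hμu (u.symm c)
        rw [Equiv.apply_symm_apply] at e e'
        rw [e, ← e']; exact hc
    have hlt2 : (univ.filter fun j => μ j = μ i ∧ μ b ≤ μ (M j)) ⊂
        (univ.filter fun j => μ j = μ i ∧ μ b ≤ μ (M' j)) := by
      rw [Finset.ssubset_iff_of_subset]
      · refine ⟨i, by simp [← hb], ?_⟩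
        simp [← ha, hB]
      · intro j hj
        simp only [mem_filter, mem_univ, true_and] at hj ⊢
        have hji : j < i := by
          by_contra hc
          have hja : j.val < a.val := by
            by_contra hc2
            have : μ j ≤ μ a := hμ (Fin.le_def.mpr (not_lt.mp hc2))
            omega
          have := hμ (up j.val j.isLt (Fin.le_def.mp (not_lt.mp hc)) hja hj.1)
          simp only [Fin.eta] at this
          omega
        rw [hi j hji]; exact hj
    have := Finset.card_lt_card hlt2
    omega
  · rcases hμbi.lt_or_eq with hA | hA
    · -- a, b in the same block, later than i
      have all : ∀ j : ℕ, ∀ hj : j < n, b.val ≤ j → j ≤ a.val → M b ≤ M ⟨j, hj⟩ ∨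
          μ (M ⟨j, hj⟩) ≤ μ b := by
        intro j hj hbj
        induction j, hbj using Nat.le_induction with
        | base => intro _; left; exact le_rfl
        | succ j hbj ih =>
          intro hja
          have hj' : j < n := by omega
          have e1 : μ ⟨j + 1, hj⟩ ≤ μ ⟨j, hj'⟩ := hμ (Fin.le_def.mpr (by simp))
          have e2 : μ ⟨j, hj'⟩ ≤ μ b := hμ (Fin.le_def.mpr hbj)
          have e3 : μ a ≤ μ ⟨j + 1, hj⟩ := hμ (Fin.le_def.mpr hja)
          rcases step ⟨j, hj'⟩ hj (by simp only; omega) with h | h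
          · rcases ih hj' (by omega) with h2 | h2
            · left; exact h2.trans h.le
            · right; exact (hμ h.le).trans h2
          · right
            have : M ⟨j, hj'⟩ = ⟨j + 1, hj⟩ := Fin.ext h
            rw [← this, hinv]; exact e2
      have hMa : M a = i := by rw [ha, hinv]
      rcases all a.val a.isLt hbv.le le_rfl with h | h
      · simp only [Fin.eta, hMa] at h
        exact absurd hMb (not_lt.mpr h)
      · simp only [Fin.eta, hMa] at h
        omega
    · -- all in the same block
      have hj : a.val - 1 < n := by omega
      have e1 : μ a ≤ μ ⟨a.val - 1, hj⟩ := hμ (Fin.le_def.mpr (by simp))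
      have e2 : μ ⟨a.val - 1, hj⟩ ≤ μ i := hμ (Fin.le_def.mpr (by simp; omega))
      have h1 := up (a.val - 1) hj (by omega) (by omega) (by omega)
      have hMa : M a = i := by rw [ha, hinv]
      have hEq : (⟨a.val - 1 + 1, by omega⟩ : Fin n) = a := Fin.ext (by simp; omega)
      rcases step ⟨a.val - 1, hj⟩ (by simp only; omega) (by simp only [hEq]; omega) with h | h
      · simp only [hEq, hMa] at h
        have h4 : (M ⟨a.val - 1, hj⟩).val < i.val := h
        have h5 : a.val ≤ (M ⟨a.val - 1, hj⟩).val := h1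
        omega
      · have h2 : M ⟨a.val - 1, hj⟩ = a := Fin.ext (by rw [h]; simp; omega)
        have h3 : (⟨a.val - 1, hj⟩ : Fin n) = i := by
          rw [← hMa]; conv_rhs => rw [← h2]
          rw [hinv]
        have := congrArg Fin.val h3
        simp only at this
        omega

/-! ### sorting and keys -/

/-- the matching attached to an ordering `w` -/
def mt (τ w : Equiv.Perm (Fin n)) : Lex (Fin n → Fin n) := toLex ⇑(w⁻¹ * τ * w)

lemma mt_inj {τ w w' : Equiv.Perm (Fin n)} (h : mt τ w = mt τ w') :
    w⁻¹ * τ * w = w'⁻¹ * τ * w' := DFunLike.coe_injective (toLex.injective h)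

lemma antitone_unique {a : Fin n → ℕ} {w w' : Equiv.Perm (Fin n)} (h : Antitone (a ∘ w))
    (h' : Antitone (a ∘ w')) : a ∘ w = a ∘ w' := by
  have := Tuple.unique_monotone (f := OrderDual.toDual ∘ a) (σ := w) (τ := w') h.dual_right
    h'.dual_right
  exact this

lemma exists_antitone (a : Fin n → ℕ) : ∃ w : Equiv.Perm (Fin n), Antitone (a ∘ w) :=
  ⟨Tuple.sort (OrderDual.toDual ∘ a), fun _ _ h =>
    Tuple.monotone_sort (OrderDual.toDual ∘ a) h⟩

lemma exists_sort (τ : Equiv.Perm (Fin n)) (a : Fin n → ℕ) : ∃ w : Equiv.Perm (Fin n),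
    Antitone (a ∘ w) ∧ ∀ w' : Equiv.Perm (Fin n), Antitone (a ∘ w') → mt τ w ≤ mt τ w' := by
  classical
  obtain ⟨w0, h0⟩ := exists_antitone a
  obtain ⟨w, hw, hmin⟩ := Finset.exists_min_image
    (univ.filter fun w : Equiv.Perm (Fin n) => Antitone (a ∘ w)) (mt τ) ⟨w0, by simpa using h0⟩
  refine ⟨w, by simpa using hw, fun w' h' => hmin w' (by simpa using h')⟩

/-- an optimal sorting permutation -/
noncomputable def sw (τ : Equiv.Perm (Fin n)) (a : Fin n → ℕ) : Equiv.Perm (Fin n) :=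
  Classical.choose (exists_sort τ a)

lemma sw_antitone (τ : Equiv.Perm (Fin n)) (a : Fin n → ℕ) : Antitone (a ∘ sw τ a) :=
  (Classical.choose_spec (exists_sort τ a)).1

lemma sw_min (τ : Equiv.Perm (Fin n)) (a : Fin n → ℕ) (w' : Equiv.Perm (Fin n))
    (h : Antitone (a ∘ w')) : mt τ (sw τ a) ≤ mt τ w' :=
  (Classical.choose_spec (exists_sort τ a)).2 w' h

/-- The type of keys. -/
abbrev Key (n : ℕ) := Lex (Lex (Fin n → ℕ) × (Lex (Fin n → Fin n))ᵒᵈ)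

/-- building a key -/
def mkKey (μ : Fin n → ℕ) (M : Lex (Fin n → Fin n)) : Key n :=
  toLex (toLex μ, OrderDual.toDual M)

lemma mkKey_le {μ ν : Fin n → ℕ} {M N : Lex (Fin n → Fin n)} :
    mkKey μ M ≤ mkKey ν N ↔ toLex μ < toLex ν ∨ μ = ν ∧ N ≤ M := by
  simp [mkKey, Prod.Lex.toLex_le_toLex]

lemma mkKey_inj {μ ν : Fin n → ℕ} {M N : Lex (Fin n → Fin n)} (h : mkKey μ M = mkKey ν N) :
    μ = ν ∧ M = N := by
  have := toLex.injective h
  rw [Prod.mk.injEq] at this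
  exact ⟨toLex.injective this.1, OrderDual.toDual.injective this.2⟩

instance : WellFoundedLT (Key n) := by
  infer_instance

/-- key of an exponent vector -/
noncomputable def key (τ : Equiv.Perm (Fin n)) (a : Fin n → ℕ) : Key n :=
  mkKey (a ∘ sw τ a) (mt τ (sw τ a))

lemma commute_of_conj_eq {τ w w' : Equiv.Perm (Fin n)} (h : w⁻¹ * τ * w = w'⁻¹ * τ * w') :
    (w' * w⁻¹) * τ = τ * (w' * w⁻¹) := by
  have : w' * (w⁻¹ * τ * w) * w⁻¹ = w' * (w'⁻¹ * τ * w') * w⁻¹ := by rw [h]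
  calc (w' * w⁻¹) * τ = w' * (w⁻¹ * τ * w) * w⁻¹ := by group
    _ = w' * (w'⁻¹ * τ * w') * w⁻¹ := this
    _ = _ := by group

lemma key_eq_orbit {τ : Equiv.Perm (Fin n)} {a b : Fin n → ℕ} (h : key τ a = key τ b) :
    ∃ g : Equiv.Perm (Fin n), g * τ = τ * g ∧ a = b ∘ g := by
  obtain ⟨h1, h2⟩ := mkKey_inj h
  refine ⟨sw τ b * (sw τ a)⁻¹, commute_of_conj_eq (mt_inj h2), ?_⟩
  funext x
  have := congrFun h1 ((sw τ a)⁻¹ x)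
  simpa using this

/-- matchings conjugate to `τ` -/
abbrev Idx (τ : Equiv.Perm (Fin n)) := {M : Equiv.Perm (Fin n) // ∃ w, w⁻¹ * τ * w = M}

/-- chosen conjugator -/
noncomputable def cw {τ : Equiv.Perm (Fin n)} (M : Idx τ) : Equiv.Perm (Fin n) :=
  Classical.choose M.2

lemma cw_spec {τ : Equiv.Perm (Fin n)} (M : Idx τ) : (cw M)⁻¹ * τ * cw M = M.1 :=
  Classical.choose_spec M.2

open Classical in
/-- the descent partition -/
noncomputable def del (M : Equiv.Perm (Fin n)) (i : Fin n) : ℕ :=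
  (univ.filter fun d => i ≤ d ∧ IsDes M d).card

lemma del_antitone (M : Equiv.Perm (Fin n)) : Antitone (del M) := by
  intro i j hij
  apply Finset.card_le_card
  intro d hd
  simp only [mem_filter, mem_univ, true_and] at hd ⊢
  exact ⟨hij.trans hd.1, hd.2⟩

lemma del_des (M : Equiv.Perm (Fin n)) (d : Fin n) (h : d.val + 1 < n) (hd : IsDes M d) :
    del M ⟨d.val + 1, h⟩ < del M d := by
  apply Finset.card_lt_card
  rw [Finset.ssubset_iff_of_subset]
  · refine ⟨d, by simpa using hd, ?_⟩
    simp [Fin.le_def]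
  · intro e he
    simp only [mem_filter, mem_univ, true_and] at he ⊢
    refine ⟨?_, he.2⟩
    have := Fin.le_def.mp he.1
    simp only at this
    exact Fin.le_def.mpr (by omega)

lemma del_step (M : Equiv.Perm (Fin n)) (d : Fin n) (h : d.val + 1 < n) :
    del M d ≤ del M ⟨d.val + 1, h⟩ + 1 ∧ (¬ IsDes M d → del M d ≤ del M ⟨d.val + 1, h⟩) := by
  classical
  constructor
  · refine le_trans (Finset.card_le_card ?_) (Finset.card_insert_le d _)
    intro e he
    simp only [mem_filter, mem_univ, true_and, mem_insert] at he ⊢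
    rcases he.1.lt_or_eq with h1 | h1
    · right
      exact ⟨Fin.le_def.mpr (Fin.lt_def.mp h1), he.2⟩
    · left; exact h1.symm
  · intro hd
    apply Finset.card_le_card
    intro e he
    simp only [mem_filter, mem_univ, true_and] at he ⊢
    refine ⟨?_, he.2⟩
    rcases he.1.lt_or_eq with h1 | h1
    · exact Fin.le_def.mpr (Fin.lt_def.mp h1)
    · rw [h1] at hd; exact absurd he.2 hd

lemma exists_sub_del {M : Equiv.Perm (Fin n)} {μ : Fin n → ℕ} (hμ : Antitone μ)
    (hdes : ∀ d : Fin n, ∀ h : d.val + 1 < n, IsDes M d → μ ⟨d.val + 1, h⟩ < μ d) :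
    ∃ ν : Fin n → ℕ, Antitone ν ∧ μ = ν + del M := by
  have key : ∀ i : Fin n, ∀ j : ℕ, ∀ hj : j < n, i.val ≤ j →
      μ ⟨j, hj⟩ + del M i ≤ μ i + del M ⟨j, hj⟩ := by
    intro i j hj hij
    induction j, hij using Nat.le_induction with
    | base => exact le_rfl
    | succ j hij ih =>
      have hj' : j < n := by omega
      have h1 := ih hj'
      have h2 := del_step M ⟨j, hj'⟩ hj
      have h3 : μ ⟨j + 1, hj⟩ ≤ μ ⟨j, hj'⟩ := hμ (Fin.le_def.mpr (by simp))
      by_cases hd : IsDes M ⟨j, hj'⟩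
      · have h4 := hdes ⟨j, hj'⟩ hj hd
        have h5 := h2.1
        simp only at h4 h5
        omega
      · have h5 := h2.2 hd
        simp only at h5
        omega
  have hle : ∀ i, del M i ≤ μ i := by
    intro i
    have hn : n - 1 < n := by have := i.isLt; omega
    have h1 := key i (n - 1) hn (by have := i.isLt; omega)
    have h2 : del M ⟨n - 1, hn⟩ = 0 := by
      classical
      unfold del
      rw [Finset.card_eq_zero, Finset.filter_eq_empty_iff]
      rintro d - ⟨h3, h4, -⟩
      have := Fin.le_def.mp h3
      simp only at this
      omega
    omega
  refine ⟨fun i => μ i - del M i, ?_, ?_⟩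
  · intro i j hij
    have h1 := key i j.val j.isLt hij
    have h2 := hle i
    have h3 := hle j
    simp only [Fin.eta] at h1
    simp only
    omega
  · funext i
    have h2 := hle i
    simp only [Pi.add_apply]
    omega

lemma conj_inv {τ : Equiv.Perm (Fin n)} (hinv : ∀ x, τ (τ x) = x)
    (w : Equiv.Perm (Fin n)) (x : Fin n) :
    (w⁻¹ * τ * w) ((w⁻¹ * τ * w) x) = x := by
  simp [hinv]

lemma conj_fix {τ : Equiv.Perm (Fin n)} (hfix : ∀ x, τ x ≠ x)
    (w : Equiv.Perm (Fin n)) (x : Fin n) : (w⁻¹ * τ * w) x ≠ x := by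
  intro h
  apply hfix (w x)
  have := congrArg w h
  simpa using this

lemma key_of_sorted {τ : Equiv.Perm (Fin n)} (hinv : ∀ x, τ (τ x) = x) (hfix : ∀ x, τ x ≠ x)
    (w : Equiv.Perm (Fin n)) {μ : Fin n → ℕ} (hμ : Antitone μ)
    (hdes : ∀ d : Fin n, ∀ h : d.val + 1 < n, IsDes (w⁻¹ * τ * w) d → μ ⟨d.val + 1, h⟩ < μ d) :
    key τ (μ ∘ ⇑w⁻¹) = mkKey μ (mt τ w) := by
  set a := μ ∘ ⇑w⁻¹ with ha
  have haw : a ∘ w = μ := by funext x; simp [ha]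
  have h1 : a ∘ sw τ a = μ := by
    rw [← haw]
    exact antitone_unique (sw_antitone τ a) (by rw [haw]; exact hμ)
  have h2 : mt τ (sw τ a) = mt τ w := by
    apply le_antisymm
    · exact sw_min τ a w (by rw [haw]; exact hμ)
    · have hu : μ ∘ ⇑(w⁻¹ * sw τ a) = μ := by
        conv_rhs => rw [← h1]
        funext x; simp [ha]
      have := le_conj (conj_inv hinv w) (conj_fix hfix w) hμ hdes _ hu
      unfold mt
      convert this using 3
      group
  unfold key
  rw [h1, h2]

lemma sw_des {τ : Equiv.Perm (Fin n)} (hinv : ∀ x, τ (τ x) = x) (hfix : ∀ x, τ x ≠ x)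
    (a : Fin n → ℕ) (d : Fin n) (h : d.val + 1 < n)
    (hd : IsDes ((sw τ a)⁻¹ * τ * sw τ a) d) :
    (a ∘ sw τ a) ⟨d.val + 1, h⟩ < (a ∘ sw τ a) d := by
  by_contra hc
  have hle : (a ∘ sw τ a) ⟨d.val + 1, h⟩ ≤ (a ∘ sw τ a) d :=
    sw_antitone τ a (Fin.le_def.mpr (by simp))
  have heq : (a ∘ sw τ a) ⟨d.val + 1, h⟩ = (a ∘ sw τ a) d := by omega
  obtain ⟨h', h1, h2⟩ := hd
  have hlt := swap_lt (conj_inv hinv (sw τ a)) (conj_fix hfix (sw τ a)) h' h1 h2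
  have hsame : a ∘ ⇑(sw τ a * Equiv.swap d ⟨d.val + 1, h⟩) = a ∘ sw τ a := by
    funext x
    simp only [Function.comp, Equiv.Perm.mul_apply]
    by_cases hx : x = d
    · rw [hx, Equiv.swap_apply_left]; exact heq
    · by_cases hx' : x = ⟨d.val + 1, h⟩
      · rw [hx', Equiv.swap_apply_right]; exact heq.symm
      · rw [Equiv.swap_apply_of_ne_of_ne hx hx']
  have hmin := sw_min τ a (sw τ a * Equiv.swap d ⟨d.val + 1, h⟩)
    (by rw [hsame]; exact sw_antitone τ a)
  unfold mt at hmin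
  refine absurd hlt (not_lt.mpr ?_)
  convert hmin using 3
  group


/-! ### polynomials -/

variable {k : Type} [Field k]

/-- coefficient, indexed by functions -/
noncomputable def co (p : MvPolynomial (Fin n) k) (a : Fin n → ℕ) : k :=
  p.coeff (Finsupp.equivFunOnFinite.symm a)

lemma co_ext {p q : MvPolynomial (Fin n) k} (h : ∀ a, co p a = co q a) : p = q := by
  ext s
  have := h s
  simpa [co] using this

lemma co_zero (a : Fin n → ℕ) : co (0 : MvPolynomial (Fin n) k) a = 0 := by simp [co]

lemma co_sub (p q : MvPolynomial (Fin n) k) (a : Fin n → ℕ) :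
    co (p - q) a = co p a - co q a := by simp [co]

lemma co_sum {ι : Type} (s : Finset ι) (f : ι → MvPolynomial (Fin n) k) (a : Fin n → ℕ) :
    co (∑ i ∈ s, f i) a = ∑ i ∈ s, co (f i) a := by
  simp [co, MvPolynomial.coeff_sum]

lemma co_C_mul (c : k) (q : MvPolynomial (Fin n) k) (a : Fin n → ℕ) :
    co (MvPolynomial.C c * q) a = c * co q a := by simp [co]

lemma co_rename (g : Equiv.Perm (Fin n)) (p : MvPolynomial (Fin n) k) (a : Fin n → ℕ) :
    co (MvPolynomial.rename g p) a = co p (a ∘ g) := by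
  unfold co
  rw [← MvPolynomial.coeff_rename_mapDomain g g.injective p]
  congr 1
  ext x
  obtain ⟨y, rfl⟩ := g.surjective x
  rw [Finsupp.mapDomain_apply g.injective]
  simp

lemma rename_eq_iff (g : Equiv.Perm (Fin n)) (p : MvPolynomial (Fin n) k) :
    MvPolynomial.rename g p = p ↔ ∀ a, co p (a ∘ g) = co p a := by
  constructor
  · intro h a
    rw [← co_rename, h]
  · intro h
    apply co_ext
    intro a
    rw [co_rename, h]

lemma co_finite (p : MvPolynomial (Fin n) k) : {a | co p a ≠ 0}.Finite := by
  have : {a : Fin n → ℕ | co p a ≠ 0} ⊆ (fun s : Fin n →₀ ℕ => (s : Fin n → ℕ)) '' p.support := by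
    intro a ha
    exact ⟨Finsupp.equivFunOnFinite.symm a, by simpa [co] using ha, by simp⟩
  exact (p.support.finite_toSet.image _).subset this

lemma co_mul (p q : MvPolynomial (Fin n) k) (a : Fin n → ℕ) :
    co (p * q) a = ∑ x ∈ antidiagonal (Finsupp.equivFunOnFinite.symm a),
      co p x.1 * co q x.2 := by
  classical
  unfold co
  rw [MvPolynomial.coeff_mul]
  simp

lemma co_mul_ne {p q : MvPolynomial (Fin n) k} {a : Fin n → ℕ} (h : co (p * q) a ≠ 0) :
    ∃ α β : Fin n → ℕ, α + β = a ∧ co p α ≠ 0 ∧ co q β ≠ 0 := by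
  rw [co_mul] at h
  obtain ⟨x, hx, hne⟩ := Finset.exists_ne_zero_of_sum_ne_zero h
  refine ⟨x.1, x.2, ?_, left_ne_zero_of_mul hne, right_ne_zero_of_mul hne⟩
  rw [HasAntidiagonal.mem_antidiagonal] at hx
  rw [← Finsupp.coe_add, hx]; simp

lemma co_mul_unique {p q : MvPolynomial (Fin n) k} {a α β : Fin n → ℕ} (hab : α + β = a)
    (h : ∀ α' β' : Fin n → ℕ, α' + β' = a → co p α' ≠ 0 → co q β' ≠ 0 → α' = α ∧ β' = β) :
    co (p * q) a = co p α * co q β := by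
  rw [co_mul]
  rw [Finset.sum_eq_single
    (Finsupp.equivFunOnFinite.symm α, Finsupp.equivFunOnFinite.symm β)]
  · simp
  · intro x hx hne
    by_contra hc
    rw [HasAntidiagonal.mem_antidiagonal] at hx
    obtain ⟨h1, h2⟩ := h x.1 x.2 (by rw [← Finsupp.coe_add, hx]; simp)
      (left_ne_zero_of_mul hc) (right_ne_zero_of_mul hc)
    apply hne
    refine Prod.ext ?_ ?_
    · simp [← h1]
    · simp [← h2]
  · intro hx
    exfalso
    apply hx
    rw [HasAntidiagonal.mem_antidiagonal, ← hab]
    ext; simp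

/-- sum of monomials over a finite set -/
noncomputable def ind (k : Type) [Field k] (S : Finset (Fin n → ℕ)) : MvPolynomial (Fin n) k :=
  ∑ a ∈ S, MvPolynomial.monomial (Finsupp.equivFunOnFinite.symm a) 1

open Classical in
lemma co_ind (S : Finset (Fin n → ℕ)) (a : Fin n → ℕ) :
    co (ind k S) a = if a ∈ S then 1 else 0 := by
  unfold ind
  rw [co_sum]
  simp [co, MvPolynomial.coeff_monomial]

open Classical in
/-- basis elements -/
noncomputable def bas (k : Type) [Field k] {τ : Equiv.Perm (Fin n)} (M : Idx τ) :
    MvPolynomial (Fin n) k :=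
  ind k ((univ.filter fun g : Equiv.Perm (Fin n) => g * τ = τ * g).image
    fun g : Equiv.Perm (Fin n) => (del M.1 ∘ ⇑(cw M)⁻¹) ∘ ⇑g)

open Classical in
lemma co_bas {τ : Equiv.Perm (Fin n)} (M : Idx τ) (b : Fin n → ℕ) :
    co (bas k M) b = if ∃ g : Equiv.Perm (Fin n), g * τ = τ * g ∧
      (del M.1 ∘ ⇑(cw M)⁻¹) ∘ ⇑g = b then 1 else 0 := by
  unfold bas
  rw [co_ind]
  simp

open Classical in
/-- monomial symmetric polynomials -/
noncomputable def msym (k : Type) [Field k] (ν : Fin n → ℕ) : MvPolynomial (Fin n) k :=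
  ind k ((univ : Finset (Equiv.Perm (Fin n))).image fun g : Equiv.Perm (Fin n) => ν ∘ ⇑g)

open Classical in
lemma co_msym (ν : Fin n → ℕ) (b : Fin n → ℕ) :
    co (msym k ν) b = if ∃ g : Equiv.Perm (Fin n), ν ∘ ⇑g = b then 1 else 0 := by
  unfold msym
  rw [co_ind]
  simp

/-- symmetric -/
def Sy (p : MvPolynomial (Fin n) k) : Prop :=
  ∀ (g : Equiv.Perm (Fin n)) a, co p (a ∘ g) = co p a

/-- invariant -/
def In (τ : Equiv.Perm (Fin n)) (p : MvPolynomial (Fin n) k) : Prop :=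
  ∀ g : Equiv.Perm (Fin n), g * τ = τ * g → ∀ a, co p (a ∘ g) = co p a

lemma sy_msym (ν : Fin n → ℕ) : Sy (msym k ν) := by
  classical
  intro g a
  rw [co_msym, co_msym]
  congr 1
  apply propext
  constructor
  · rintro ⟨h, hh⟩
    refine ⟨h * g⁻¹, ?_⟩
    funext x
    have := congrFun hh (g⁻¹ x)
    simpa using this
  · rintro ⟨h, hh⟩
    refine ⟨h * g, ?_⟩
    rw [← hh]; rfl

lemma in_bas {τ : Equiv.Perm (Fin n)} (M : Idx τ) : In τ (bas k M) := by
  classical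
  intro g hg a
  rw [co_bas, co_bas]
  congr 1
  apply propext
  constructor
  · rintro ⟨h, hc, hh⟩
    refine ⟨h * g⁻¹, ?_, ?_⟩
    · have hc' : Commute h τ := hc
      have hg' : Commute g τ := hg
      exact hc'.mul_left hg'.inv_left
    · funext x
      have := congrFun hh (g⁻¹ x)
      simpa using this
  · rintro ⟨h, hc, hh⟩
    refine ⟨h * g, ?_, ?_⟩
    · have hc' : Commute h τ := hc
      have hg' : Commute g τ := hg
      exact hc'.mul_left hg'
    · rw [← hh]; rfl

/-- the analysis of a pair contributing to a product -/
lemma pair_analysis {τ : Equiv.Perm (Fin n)} (hinv : ∀ x, τ (τ x) = x) (hfix : ∀ x, τ x ≠ x)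
    {f : MvPolynomial (Fin n) k} (hf : Sy f) {ν : Fin n → ℕ}
    (hν : ∀ α, co f α ≠ 0 → toLex α ≤ toLex ν) (M : Idx τ) {α β : Fin n → ℕ}
    (hα : co f α ≠ 0) (hβ : co (bas k M) β ≠ 0) (w : Equiv.Perm (Fin n)) :
    toLex ((α + β) ∘ w) < toLex (ν + del M.1) ∨
      (α ∘ w = ν ∧ β ∘ w = del M.1 ∧ toLex (⇑M.1 : Fin n → Fin n) ≤ mt τ w) := by
  classical
  have h1 : toLex (α ∘ w) ≤ toLex ν := hν _ (by rw [hf]; exact hα)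
  rw [co_bas] at hβ
  obtain ⟨g, hg, hgb⟩ : ∃ g : Equiv.Perm (Fin n), g * τ = τ * g ∧
      (del M.1 ∘ ⇑(cw M)⁻¹) ∘ ⇑g = β := by
    by_contra hc
    rw [if_neg hc] at hβ
    exact hβ rfl
  have hbw : β ∘ w = del M.1 ∘ ⇑((cw M)⁻¹ * g * w) := by rw [← hgb]; rfl
  have h2 : toLex (β ∘ w) ≤ toLex (del M.1) := by
    rw [hbw]; exact antitone_perm_le (del_antitone _) _
  have hsum : toLex ((α + β) ∘ w) = toLex (α ∘ w) + toLex (β ∘ w) := rfl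
  have hsum2 : toLex (ν + del M.1) = toLex ν + toLex (del M.1) := rfl
  rw [hsum, hsum2]
  rcases h1.lt_or_eq with h1' | h1'
  · left; exact add_lt_add_of_lt_of_le h1' h2
  · rcases h2.lt_or_eq with h2' | h2'
    · left; exact add_lt_add_of_le_of_lt h1 h2'
    · right
      have e2 : β ∘ w = del M.1 := toLex.injective h2'
      refine ⟨toLex.injective h1', e2, ?_⟩
      have hM1 : ∀ x, M.1 (M.1 x) = x := by
        rw [← cw_spec M]; exact conj_inv hinv _
      have hM2 : ∀ x, M.1 x ≠ x := by
        rw [← cw_spec M]; exact conj_fix hfix _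
      have := le_conj hM1 hM2 (del_antitone M.1) (del_des M.1) ((cw M)⁻¹ * g * w)
        (by rw [← hbw]; exact e2)
      refine this.trans (le_of_eq ?_)
      unfold mt
      congr 2
      conv_lhs => rw [← cw_spec M]
      have hg' : g⁻¹ * τ * g = τ := by rw [mul_assoc, ← hg]; group
      calc ((cw M)⁻¹ * g * w)⁻¹ * ((cw M)⁻¹ * τ * cw M) * ((cw M)⁻¹ * g * w)
          = w⁻¹ * (g⁻¹ * τ * g) * w := by group
        _ = w⁻¹ * τ * w := by rw [hg']

/-- the leading key of `f * bas M` -/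
noncomputable def lk {τ : Equiv.Perm (Fin n)} (ν : Fin n → ℕ) (M : Idx τ) : Key n :=
  mkKey (ν + del M.1) (toLex (⇑M.1 : Fin n → Fin n))

lemma lemA1 {τ : Equiv.Perm (Fin n)} (hinv : ∀ x, τ (τ x) = x) (hfix : ∀ x, τ x ≠ x)
    {f : MvPolynomial (Fin n) k} (hf : Sy f) {ν : Fin n → ℕ}
    (hν : ∀ α, co f α ≠ 0 → toLex α ≤ toLex ν) (M : Idx τ) {a : Fin n → ℕ}
    (ha : co (f * bas k M) a ≠ 0) : key τ a ≤ lk ν M := by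
  obtain ⟨α, β, rfl, hα, hβ⟩ := co_mul_ne ha
  unfold key lk
  rw [mkKey_le]
  rcases pair_analysis hinv hfix hf hν M hα hβ (sw τ (α + β)) with h | ⟨h1, h2, h3⟩
  · left; exact h
  · right
    refine ⟨?_, h3⟩
    rw [← h1, ← h2]; rfl

lemma lemA2 {τ : Equiv.Perm (Fin n)} (hinv : ∀ x, τ (τ x) = x) (hfix : ∀ x, τ x ≠ x)
    {f : MvPolynomial (Fin n) k} (hf : Sy f) {ν : Fin n → ℕ}
    (hν : ∀ α, co f α ≠ 0 → toLex α ≤ toLex ν) (M : Idx τ) {a : Fin n → ℕ}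
    (ha : key τ a = lk ν M) : co (f * bas k M) a = co f ν := by
  classical
  obtain ⟨h1, h2⟩ := mkKey_inj ha
  set w := sw τ a with hw
  have h2' : w⁻¹ * τ * w = M.1 := DFunLike.coe_injective (toLex.injective h2)
  have hxx : ∀ {c d : Fin n → ℕ}, c ∘ w = d → c = d ∘ ⇑w⁻¹ := by
    rintro c d rfl
    funext x; simp
  rw [co_mul_unique (α := ν ∘ ⇑w⁻¹) (β := del M.1 ∘ ⇑w⁻¹)]
  · rw [hf, co_bas, if_pos, mul_one]
    refine ⟨cw M * w⁻¹, commute_of_conj_eq (h2'.trans (cw_spec M).symm), ?_⟩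
    funext x; simp
  · rw [hxx h1]; rfl
  · intro α' β' hab hα hβ
    rcases pair_analysis hinv hfix hf hν M hα hβ w with h | ⟨h3, h4, -⟩
    · rw [hab, h1] at h
      exact absurd h (lt_irrefl _)
    · exact ⟨hxx h3, hxx h4⟩

lemma exists_key {τ : Equiv.Perm (Fin n)} (hinv : ∀ x, τ (τ x) = x) (hfix : ∀ x, τ x ≠ x)
    {ν : Fin n → ℕ} (hν : Antitone ν) (M : Idx τ) : ∃ a, key τ a = lk ν M := by
  refine ⟨(ν + del M.1) ∘ ⇑(cw M)⁻¹, ?_⟩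
  rw [key_of_sorted hinv hfix (cw M) (μ := ν + del M.1) (hν.add (del_antitone _))]
  · unfold lk mt
    rw [cw_spec]
  · intro d h hd
    rw [cw_spec] at hd
    have h1 := del_des M.1 d h hd
    have h2 : ν ⟨d.val + 1, h⟩ ≤ ν d := hν (Fin.le_def.mpr (by simp))
    simp only [Pi.add_apply]
    omega

lemma exists_lead {f : MvPolynomial (Fin n) k} (hf : Sy f) (h0 : f ≠ 0) :
    ∃ ν : Fin n → ℕ, Antitone ν ∧ co f ν ≠ 0 ∧ ∀ α, co f α ≠ 0 → toLex α ≤ toLex ν := by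
  have hne : {a | co f a ≠ 0}.Nonempty := by
    by_contra hc
    apply h0
    apply co_ext
    intro a
    by_contra h
    rw [co_zero] at h
    exact hc ⟨a, h⟩
  obtain ⟨ν, hν, hmax⟩ := Set.exists_max_image _ (fun a => toLex a) (co_finite f) hne
  refine ⟨ν, ?_, hν, hmax⟩
  obtain ⟨w, hw⟩ := exists_antitone ν
  have h1 : toLex (ν ∘ w) ≤ toLex ν := hmax _ (by show co f (ν ∘ w) ≠ 0; rw [hf]; exact hν)
  have h2 := antitone_perm_le hw w⁻¹
  have h3 : (ν ∘ w) ∘ ⇑w⁻¹ = ν := by funext x; simp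
  rw [h3] at h2
  have : ν ∘ w = ν := toLex.injective (le_antisymm h1 h2)
  rw [← this]; exact hw

lemma lin_indep {τ : Equiv.Perm (Fin n)} (hinv : ∀ x, τ (τ x) = x) (hfix : ∀ x, τ x ≠ x)
    (f : Idx τ → MvPolynomial (Fin n) k) (hf : ∀ M, Sy (f M))
    (h : ∑ M, f M * bas k M = 0) : ∀ M, f M = 0 := by
  classical
  by_contra hc
  push Not at hc
  obtain ⟨M0, hM0⟩ := hc
  have hex : ∀ M, ∃ ν : Fin n → ℕ, f M ≠ 0 → (Antitone ν ∧ co (f M) ν ≠ 0 ∧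
      ∀ α, co (f M) α ≠ 0 → toLex α ≤ toLex ν) := by
    intro M
    by_cases h0 : f M = 0
    · exact ⟨0, fun h => absurd h0 h⟩
    · obtain ⟨ν, hν⟩ := exists_lead (hf M) h0
      exact ⟨ν, fun _ => hν⟩
  choose ν hν using hex
  obtain ⟨M, hM, hmax⟩ := Finset.exists_max_image (univ.filter fun M => f M ≠ 0)
    (fun M => lk (ν M) M) ⟨M0, by simpa using hM0⟩
  rw [mem_filter] at hM
  obtain ⟨h1, h2, h3⟩ := hν M hM.2
  obtain ⟨a, ha⟩ := exists_key hinv hfix h1 M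
  have hz : co (∑ M, f M * bas k M) a = 0 := by rw [h, co_zero]
  rw [co_sum, Finset.sum_eq_single M, lemA2 hinv hfix (hf M) h3 M ha] at hz
  · exact h2 hz
  · intro N _ hNM
    by_contra hne
    have hfN : f N ≠ 0 := by
      intro h0; rw [h0, zero_mul, co_zero] at hne; exact hne rfl
    have h4 := lemA1 hinv hfix (hf N) (hν N hfN).2.2 N hne
    have h5 := hmax N (by simpa using hfN)
    have h6 : lk (ν N) N = lk (ν M) M := le_antisymm h5 (ha ▸ h4)
    have h7 := (mkKey_inj h6).2
    exact hNM (Subtype.ext (DFunLike.coe_injective (toLex.injective h7)))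
  · intro hh; exact absurd (mem_univ _) hh

lemma spanning {τ : Equiv.Perm (Fin n)} (hinv : ∀ x, τ (τ x) = x) (hfix : ∀ x, τ x ≠ x)
    (f : MvPolynomial (Fin n) k) (hf : In τ f) :
    ∃ c : Idx τ → MvPolynomial (Fin n) k, (∀ M, Sy (c M)) ∧ f = ∑ M, c M * bas k M := by
  classical
  have hsy0 : Sy (0 : MvPolynomial (Fin n) k) := fun g a => by rw [co_zero, co_zero]
  by_cases h0 : f = 0
  · exact ⟨fun _ => 0, fun _ => hsy0, by simp [h0]⟩
  have hlead : ∀ f : MvPolynomial (Fin n) k, f ≠ 0 → ∃ a, co f a ≠ 0 ∧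
      ∀ b, co f b ≠ 0 → key τ b ≤ key τ a := by
    intro f h0
    have hne : {a | co f a ≠ 0}.Nonempty := by
      by_contra hc
      apply h0
      apply co_ext
      intro a
      by_contra h
      rw [co_zero] at h
      exact hc ⟨a, h⟩
    obtain ⟨a, ha, hmax⟩ := Set.exists_max_image _ (key τ) (co_finite f) hne
    exact ⟨a, ha, hmax⟩
  obtain ⟨a, ha, hmax⟩ := hlead f h0
  generalize hK : key τ a = K
  induction K using WellFoundedLT.induction generalizing f a with
  | ind K ih =>
  subst hK
  set w := sw τ a with hw
  set M : Idx τ := ⟨w⁻¹ * τ * w, w, rfl⟩ with hM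
  obtain ⟨ν, hν, hμ⟩ := exists_sub_del (M := M.1) (sw_antitone τ a) (sw_des hinv hfix a)
  have hka : key τ a = lk ν M := by
    unfold key lk
    rw [hμ]; rfl
  have hlex : ∀ α, co (msym k ν) α ≠ 0 → toLex α ≤ toLex ν := by
    intro α hα
    rw [co_msym] at hα
    obtain ⟨g, rfl⟩ : ∃ g : Equiv.Perm (Fin n), ν ∘ ⇑g = α := by
      by_contra hc
      rw [if_neg hc] at hα
      exact hα rfl
    exact antitone_perm_le hν g
  have hone : co (msym k ν) ν = 1 := by
    rw [co_msym, if_pos ⟨1, rfl⟩]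
  set t : MvPolynomial (Fin n) k := MvPolynomial.C (co f a) * msym k ν with ht
  have htsy : Sy t := fun g b => by rw [ht, co_C_mul, co_C_mul, sy_msym]
  set f' := f - t * bas k M with hf'
  have hf'in : In τ f' := by
    intro g hg
    have hA := (rename_eq_iff g f).mpr (hf g hg)
    have hB := (rename_eq_iff g t).mpr (htsy g)
    have hC := (rename_eq_iff g (bas k M)).mpr (in_bas M g hg)
    apply (rename_eq_iff g f').mp
    rw [hf', map_sub, map_mul, hA, hB, hC]
  have hco' : ∀ b, co f' b = co f b - co f a * co (msym k ν * bas k M) b := by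
    intro b
    rw [hf', co_sub, ht, mul_assoc, co_C_mul]
  have hlt : ∀ b, co f' b ≠ 0 → key τ b < key τ a := by
    intro b hb
    rw [hco'] at hb
    have hle : key τ b ≤ key τ a := by
      by_cases h1 : co f b = 0
      · have h2 : co (msym k ν * bas k M) b ≠ 0 := by
          intro h2; rw [h1, h2] at hb; simp at hb
        rw [hka]
        exact lemA1 hinv hfix (sy_msym ν) hlex M h2
      · exact hmax b h1
    refine lt_of_le_of_ne hle fun heq => hb ?_
    rw [lemA2 hinv hfix (sy_msym ν) hlex M (heq.trans hka), hone]
    obtain ⟨g, hg, rfl⟩ := key_eq_orbit heq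
    rw [hf g hg]; simp
  have hrec : ∃ c : Idx τ → MvPolynomial (Fin n) k, (∀ M, Sy (c M)) ∧
      f' = ∑ M, c M * bas k M := by
    by_cases h0' : f' = 0
    · exact ⟨fun _ => 0, fun _ => hsy0, by simp [h0']⟩
    · obtain ⟨a', ha', hmax'⟩ := hlead f' h0'
      exact ih _ (hlt a' ha') f' hf'in h0' a' ha' hmax' rfl
  obtain ⟨c, hc, hsum⟩ := hrec
  refine ⟨fun N => c N + if N = M then t else 0, ?_, ?_⟩
  · intro N g b
    have hadd : ∀ (p q : MvPolynomial (Fin n) k) (a : Fin n → ℕ),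
      co (p + q) a = co p a + co q a := fun p q a => by simp [co]
    simp only
    rw [hadd, hadd, hc]
    split_ifs
    · rw [htsy]
    · rw [hsy0]
  · simp only [add_mul, Finset.sum_add_distrib, ite_mul, zero_mul]
    rw [← hsum, Finset.sum_ite_eq' univ M (fun N => t * bas k N)]
    simp [hf']

/-! ### the wreath product -/

/-- the involution swapping `2i` and `2i+1` -/
def tau (m : ℕ) : Equiv.Perm (Fin (2 * m)) :=
  Function.Involutive.toPerm
    (fun x => if h : x.val % 2 = 0 then ⟨x.val + 1, by have := x.isLt; omega⟩
      else ⟨x.val - 1, by have := x.isLt; omega⟩) (by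
    intro x
    apply Fin.ext
    have := x.isLt
    by_cases h : x.val % 2 = 0
    · have h2 : ¬ (x.val + 1) % 2 = 0 := by omega
      simp [h, h2]
    · have h2 : (x.val - 1) % 2 = 0 := by omega
      simp only [h, h2, dite_true, dite_false]
      omega)

lemma tau_val (m : ℕ) (x : Fin (2 * m)) :
    (tau m x).val = if x.val % 2 = 0 then x.val + 1 else x.val - 1 := by
  have h0 : tau m x = if h : x.val % 2 = 0 then ⟨x.val + 1, by have := x.isLt; omega⟩
      else ⟨x.val - 1, by have := x.isLt; omega⟩ := rfl
  rw [h0]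
  by_cases h : x.val % 2 = 0 <;> simp [h]

lemma tau_inv (m : ℕ) (x : Fin (2 * m)) : tau m (tau m x) = x := by
  apply Fin.ext
  rw [tau_val, tau_val]
  split_ifs <;> omega

lemma tau_fix (m : ℕ) (x : Fin (2 * m)) : tau m x ≠ x := by
  intro h
  have := congrArg Fin.val h
  rw [tau_val] at this
  split_ifs at this <;> omega

lemma mem_block (m : ℕ) (i : Fin m) (x : Fin (2 * m)) :
    x ∈ wreathBlock 2 m i ↔ x.val / 2 = i.val := by
  simp only [wreathBlock, mem_filter, mem_univ, true_and]
  omega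

lemma div_tau (m : ℕ) (x : Fin (2 * m)) : (tau m x).val / 2 = x.val / 2 := by
  rw [tau_val]; split_ifs <;> omega

lemma eq_or_tau (m : ℕ) {x y : Fin (2 * m)} (h : x.val / 2 = y.val / 2) :
    y = x ∨ y = tau m x := by
  by_cases hxy : y.val = x.val
  · left; exact Fin.ext hxy
  · right
    apply Fin.ext
    rw [tau_val]; split_ifs <;> omega

lemma mem_wreath (m : ℕ) (g : Equiv.Perm (Fin (2 * m))) :
    g ∈ wreathProduct 2 m ↔ g * tau m = tau m * g := by
  constructor
  · intro hg
    ext1 x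
    simp only [Equiv.Perm.mul_apply]
    obtain ⟨j, hj⟩ := hg ⟨x.val / 2, by have := x.isLt; omega⟩
    have h1 : g x ∈ wreathBlock 2 m j := by
      rw [← hj]; exact mem_image_of_mem _ ((mem_block _ _ _).mpr rfl)
    have h2 : g (tau m x) ∈ wreathBlock 2 m j := by
      rw [← hj]; exact mem_image_of_mem _ ((mem_block _ _ _).mpr (div_tau m x))
    rw [mem_block] at h1 h2
    rcases eq_or_tau m (h1.trans h2.symm) with h | h
    · exact absurd (g.injective h) (tau_fix m x)
    · exact h
  · intro hg i
    have hc : ∀ x, g (tau m x) = tau m (g x) := fun x => by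
      have := congrArg (fun f : Equiv.Perm (Fin (2 * m)) => f x) hg
      simpa using this
    have hi := i.isLt
    set x : Fin (2 * m) := ⟨2 * i.val, by omega⟩ with hx
    refine ⟨⟨(g x).val / 2, by have := (g x).isLt; omega⟩, ?_⟩
    ext y
    rw [mem_image, mem_block]
    constructor
    · rintro ⟨z, hz, rfl⟩
      rw [mem_block] at hz
      have : x.val / 2 = z.val / 2 := by rw [hz, hx]; simp
      rcases eq_or_tau m this with h | h
      · rw [h]
      · rw [h, hc, div_tau]
    · intro hy
      have hxi : x.val / 2 = i.val := by rw [hx]; simp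
      rcases eq_or_tau m hy.symm with h | h
      · exact ⟨x, (mem_block _ _ _).mpr hxi, h.symm⟩
      · exact ⟨tau m x, (mem_block _ _ _).mpr (by rw [div_tau, hxi]), by rw [hc, h]⟩

lemma mem_inv_iff (m : ℕ) (p : MvPolynomial (Fin (2 * m)) k) :
    p ∈ invariantRing k (2 * m) (wreathProduct 2 m) ↔ In (tau m) p := by
  constructor
  · intro h g hg
    exact (rename_eq_iff g p).mp (h g ((mem_wreath m g).mpr hg))
  · intro h g hg
    exact (rename_eq_iff g p).mpr (h g ((mem_wreath m g).mp hg))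

lemma sy_iff (p : MvPolynomial (Fin n) k) : Sy p ↔ p.IsSymmetric := by
  constructor
  · intro h g
    exact (rename_eq_iff g p).mpr (h g)
  · intro h g
    exact (rename_eq_iff g p).mp (h g)

lemma mem_esymm_iff (W : Subgroup (Equiv.Perm (Fin n))) (a : invariantRing k n W) :
    a ∈ esymmSubalgebra k n W ↔ Sy (a : MvPolynomial (Fin n) k) := by
  rw [sy_iff]
  constructor
  · intro h
    have : esymmSubalgebra k n W ≤
        (MvPolynomial.symmetricSubalgebra (Fin n) k).comap (invariantRing k n W).val := by
      unfold esymmSubalgebra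
      rw [Algebra.adjoin_le_iff]
      rintro b ⟨i, -, -, hb⟩
      show (b : MvPolynomial (Fin n) k) ∈ MvPolynomial.symmetricSubalgebra (Fin n) k
      rw [hb]
      exact MvPolynomial.esymm_isSymmetric (Fin n) k i
    exact this h
  · intro h
    obtain ⟨p, hp⟩ := MvPolynomial.esymmAlgHom_surjective (σ := Fin n) k (n := n) (by simp)
      ⟨a, h⟩
    have hp' := congrArg Subtype.val hp
    rw [MvPolynomial.esymmAlgHom_apply] at hp'
    have hmem : ∀ i : Fin n, MvPolynomial.esymm (Fin n) k (i.val + 1) ∈ invariantRing k n W :=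
      fun i g _ => MvPolynomial.esymm_isSymmetric (Fin n) k _ g
    let e : Fin n → esymmSubalgebra k n W := fun i =>
      ⟨⟨MvPolynomial.esymm (Fin n) k (i.val + 1), hmem i⟩,
        Algebra.subset_adjoin ⟨i.val + 1, by omega, i.isLt, rfl⟩⟩
    have hψ := MvPolynomial.comp_aeval_apply e
      ((invariantRing k n W).val.comp (esymmSubalgebra k n W).val) p
    have heq : ((MvPolynomial.aeval e p : esymmSubalgebra k n W) : invariantRing k n W) = a := by
      apply Subtype.ext
      refine Eq.trans ?_ hp'
      exact hψ
    rw [← heq]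
    exact Subtype.property _

/-- basis elements in the invariant ring -/
noncomputable def basR (k : Type) [Field k] (m : ℕ) (M : Idx (tau m)) :
    invariantRing k (2 * m) (wreathProduct 2 m) :=
  ⟨bas k M, (mem_inv_iff m _).mpr (in_bas M)⟩

lemma free_main (m : ℕ) :
    Module.Free (esymmSubalgebra k (2 * m) (wreathProduct 2 m))
      (invariantRing k (2 * m) (wreathProduct 2 m)) := by
  classical
  have hcoe : ∀ c : Idx (tau m) → esymmSubalgebra k (2 * m) (wreathProduct 2 m),
      ((∑ M, c M • basR k m M : invariantRing k (2 * m) (wreathProduct 2 m)) :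
        MvPolynomial (Fin (2 * m)) k) =
      ∑ M, ((c M : invariantRing k (2 * m) (wreathProduct 2 m)) : MvPolynomial (Fin (2 * m)) k)
        * bas k M := by
    intro c
    rw [AddSubmonoidClass.coe_finsetSum]
    rfl
  refine Module.Free.of_basis (Module.Basis.mk (v := basR k m) ?_ ?_)
  · refine (Fintype.linearIndependent_iff
      (R := esymmSubalgebra k (2 * m) (wreathProduct 2 m)) (v := basR k m)).mpr ?_
    intro c hc M
    have h1 := hcoe c
    rw [hc] at h1
    have h2 := lin_indep (tau_inv m) (tau_fix m) _
      (fun M => (mem_esymm_iff _ _).mp (c M).2) h1.symm M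
    exact Subtype.ext (Subtype.ext h2)
  · rintro ⟨f, hf⟩ -
    obtain ⟨c, hc, hsum⟩ := spanning (tau_inv m) (tau_fix m) f ((mem_inv_iff m f).mp hf)
    have hcR : ∀ M, c M ∈ invariantRing k (2 * m) (wreathProduct 2 m) := fun M =>
      (mem_inv_iff m _).mpr fun g _ => hc M g
    let c' : Idx (tau m) → esymmSubalgebra k (2 * m) (wreathProduct 2 m) := fun M =>
      ⟨⟨c M, hcR M⟩, (mem_esymm_iff _ _).mpr (hc M)⟩
    have heq : (⟨f, hf⟩ : invariantRing k (2 * m) (wreathProduct 2 m))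
        = ∑ M, c' M • basR k m M := by
      apply Subtype.ext
      rw [hcoe]
      exact hsum
    rw [heq]
    exact Submodule.sum_mem _ fun M _ =>
      Submodule.smul_mem _ _ (Submodule.subset_span ⟨M, rfl⟩)

end WreathFree

/-- For `m ≥ 1` and any field `k`, the invariant ring `k[x_1,…,x_{2m}]^{S_2≀S_m}`
is a free module over the subalgebra generated by the elementary symmetric
polynomials `e_1,…,e_{2m}`; i.e. it is Cohen-Macaulay over every field. -/
theorem invariantRing_S2_wr_Sm_free (m : ℕ) (hm : 1 ≤ m) (k : Type) [Field k] :
    Module.Free (esymmSubalgebra k (2 * m) (wreathProduct 2 m))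
      (invariantRing k (2 * m) (wreathProduct 2 m)) := by
  exact WreathFree.free_main m
end

section
/- Let l ≥ 1 and m ≥ 1 be integers and let k be a field whose characteristic is either 0 or a prime p with p > m. Then the invariant ring k[x_1,…,x_{lm}]^{S_l≀S_m} (the fixed-point subalgebra of MvPolynomial (Fin (l*m)) k under the variable-permuting action of the wreath product subgroup W(l,m) ≤ Equiv.Perm (Fin (l*m))) is a free module over the subalgebra E generated over k by the elementary symmetric polynomials e_1,…,e_{lm}; equivalently, k[x_1,…,x_{lm}]^{S_l≀S_m} is Cohen-Macaulay over k whenever char k = 0 or char k = p > m (independently of how large l is). -/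
set_option synthInstance.maxHeartbeats 1000000
set_option maxHeartbeats 1000000

open Finset

section GradedFree

lemma hcomp_mul {σ k : Type*} [CommSemiring k] (d : ℕ) (f g : MvPolynomial σ k) :
    MvPolynomial.homogeneousComponent d (f * g) =
      ∑ ij ∈ HasAntidiagonal.antidiagonal d, MvPolynomial.homogeneousComponent ij.1 f *
        MvPolynomial.homogeneousComponent ij.2 g := by
  classical
  ext m
  rw [MvPolynomial.coeff_homogeneousComponent, MvPolynomial.coeff_sum]
  simp only [MvPolynomial.coeff_mul, MvPolynomial.coeff_homogeneousComponent]
  rw [Finset.sum_comm]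
  split_ifs with h
  · apply Finset.sum_congr rfl
    intro ab hab
    rw [HasAntidiagonal.mem_antidiagonal] at hab
    rw [Finset.sum_eq_single (ab.1.degree, ab.2.degree)]
    · simp
    · rintro ⟨i, j⟩ _ hne
      by_cases h1 : ab.1.degree = i
      · by_cases h2 : ab.2.degree = j
        · exact absurd (by rw [h1, h2]) hne
        · simp [h2]
      · simp [h1]
    · intro hn
      exfalso
      apply hn
      rw [HasAntidiagonal.mem_antidiagonal, ← h, ← hab]
      simp
  · symm
    apply Finset.sum_eq_zero
    intro ab hab
    rw [HasAntidiagonal.mem_antidiagonal] at hab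
    apply Finset.sum_eq_zero
    rintro ⟨i, j⟩ hij
    rw [HasAntidiagonal.mem_antidiagonal] at hij
    by_cases h1 : ab.1.degree = i
    · by_cases h2 : ab.2.degree = j
      · exfalso
        apply h
        rw [← hab, ← hij]
        simp [h1, h2]
      · simp [h2]
    · simp [h1]

theorem graded_free_of_projective {σ k E B : Type*} [Field k] [CommRing E] [Algebra k E]
    [AddCommGroup B] [Module k B] [Module E B] [IsScalarTower k E B]
    (ιE : E →ₐ[k] MvPolynomial σ k) (ιB : B →ₗ[k] MvPolynomial σ k)
    (hιE : Function.Injective ιE) (hιB : Function.Injective ιB)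
    (hsmul : ∀ e b, ιB (e • b) = ιE e * ιB b)
    (hB : ∀ b d, ∃ b', ιB b' = MvPolynomial.homogeneousComponent d (ιB b))
    (hE : ∀ e d, ∃ e', ιE e' = MvPolynomial.homogeneousComponent d (ιE e))
    (hproj : Module.Projective E B) : Module.Free E B := by
  classical
  -- homogeneous component on `B`
  choose hc0 hc0_coe using hB
  let hcB : ℕ → B →ₗ[k] B := fun d =>
    { toFun := fun b => hc0 b d
      map_add' := fun x y => hιB (by simp [hc0_coe])
      map_smul' := fun x y => hιB (by simp [hc0_coe]) }
  have hcB_coe : ∀ d (f : B), ιB (hcB d f) =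
      MvPolynomial.homogeneousComponent d (ιB f) := fun d f => hc0_coe f d
  have hcB_sum : ∀ f : B, ∃ n, f = ∑ i ∈ Finset.range n, hcB i f := by
    intro f
    refine ⟨(ιB f).totalDegree + 1, ?_⟩
    apply hιB
    rw [map_sum]
    simp only [hcB_coe]
    exact (MvPolynomial.sum_homogeneousComponent (ιB f)).symm
  -- the irrelevant part
  let N : Submodule k B := Submodule.span k
    {x | ∃ e : E, MvPolynomial.coeff 0 (ιE e) = 0 ∧ ∃ b : B, x = e • b}
  let Hs : Set (B ⧸ N) := N.mkQ '' {b : B | ∃ d, (ιB b).IsHomogeneous d}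
  have hHs : Submodule.span k Hs = ⊤ := by
    rw [Submodule.span_image, eq_top_iff]
    rintro x -
    obtain ⟨f, rfl⟩ := N.mkQ_surjective x
    apply Submodule.mem_map_of_mem
    obtain ⟨n, hn⟩ := hcB_sum f
    rw [hn]
    refine Submodule.sum_mem _ fun i _ => Submodule.subset_span ⟨i, ?_⟩
    rw [hcB_coe]
    exact MvPolynomial.homogeneousComponent_isHomogeneous _ _
  obtain ⟨bs, hbs, hspan, hli⟩ := exists_linearIndependent k Hs
  rw [hHs] at hspan
  have hlift : ∀ y : bs, ∃ b : B, (∃ d, (ιB b).IsHomogeneous d) ∧ N.mkQ b = y :=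
    fun y => hbs y.2
  choose β hβhom hβ using hlift
  let p : (bs →₀ E) →ₗ[E] B := Finsupp.linearCombination E β
  have hβrange : ∀ y, β y ∈ LinearMap.range p := fun y =>
    ⟨Finsupp.single y 1, by simp [p]⟩
  let rg : Submodule k B := (LinearMap.range p).restrictScalars k
  have hmulrg : ∀ e : E, ∀ b ∈ rg, e • b ∈ rg := by
    intro e b hb
    exact Submodule.smul_mem (LinearMap.range p) e hb
  -- generation
  have hgen : ∀ d, ∀ f : B, (ιB f).IsHomogeneous d → f ∈ rg := by
    intro d
    induction d using Nat.strong_induction_on with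
    | _ d ih =>
      intro f hf
      have hN : N ≤ rg.comap (hcB d) := by
        rw [Submodule.span_le]
        rintro x ⟨e, he0, b, rfl⟩
        change hcB d (e • b) ∈ rg
        choose e' hee' using hE e
        have : hcB d (e • b) = ∑ ij ∈ HasAntidiagonal.antidiagonal d, e' ij.1 • hcB ij.2 b := by
          apply hιB
          rw [map_sum, hcB_coe]
          rw [hsmul, hcomp_mul]
          apply Finset.sum_congr rfl
          intro ij _
          rw [hsmul, hee', hcB_coe]
        rw [this]
        refine Submodule.sum_mem _ fun ij hij => ?_
        rw [HasAntidiagonal.mem_antidiagonal] at hij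
        rcases Nat.eq_zero_or_pos ij.1 with h0 | h0
        · have : e' ij.1 = 0 := by
            apply hιE
            rw [hee', h0, MvPolynomial.homogeneousComponent_zero, he0]
            simp
          rw [this, zero_smul]
          exact zero_mem _
        · apply hmulrg
          apply ih ij.2 (by omega)
          rw [hcB_coe]
          exact MvPolynomial.homogeneousComponent_isHomogeneous _ _
      have hS : Submodule.span k (Set.range β) ≤ rg.comap (hcB d) := by
        rw [Submodule.span_le]
        rintro _ ⟨y, rfl⟩
        change hcB d (β y) ∈ rg
        obtain ⟨j, hj⟩ := hβhom y
        have : hcB d (β y) = if d = j then β y else 0 := by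
          apply hιB
          rw [hcB_coe, MvPolynomial.homogeneousComponent_of_mem
            ((MvPolynomial.mem_homogeneousSubmodule _ _).2 hj)]
          split_ifs <;> simp_all
        rw [this]
        split_ifs
        · exact hβrange y
        · exact zero_mem _
      have hfs : N.mkQ f ∈ (Submodule.span k (Set.range β)).map N.mkQ := by
        rw [← Submodule.span_image, ← Set.range_comp]
        have : (N.mkQ ∘ β) = ((↑) : bs → B ⧸ N) := funext hβ
        rw [this, Subtype.range_coe, hspan]
        trivial
      obtain ⟨g, hg, hgf⟩ := hfs
      have hfg : f - g ∈ N := by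
        rw [← Submodule.ker_mkQ N, LinearMap.mem_ker, map_sub, hgf, sub_self]
      have h1 : hcB d f ∈ rg := by
        have := rg.add_mem (hS hg) (hN hfg)
        rwa [← map_add, add_sub_cancel] at this
      have h2 : hcB d f = f := by
        apply hιB
        rw [hcB_coe]
        exact MvPolynomial.homogeneousComponent_eq_self hf
      rwa [h2] at h1
  have hsurj : Function.Surjective p := by
    intro f
    have : f ∈ rg := by
      obtain ⟨n, hn⟩ := hcB_sum f
      rw [hn]
      refine Submodule.sum_mem _ fun i _ => hgen i _ ?_
      rw [hcB_coe]
      exact MvPolynomial.homogeneousComponent_isHomogeneous _ _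
    exact this
  -- independence
  obtain ⟨s, hs⟩ := Module.projective_lifting_property p LinearMap.id hsurj
  have hs' : ∀ b, p (s b) = b := fun b => LinearMap.congr_fun hs b
  have hker0 : ∀ x, p x = 0 → ∀ y, MvPolynomial.coeff 0 (ιE (x y)) = 0 := by
    intro x hx
    let c : bs →₀ k := x.mapRange (fun e : E => MvPolynomial.coeff 0 (ιE e))
      (by simp)
    have hc : Finsupp.linearCombination k ((↑) : bs → B ⧸ N) c = 0 := by
      have h1 : Finsupp.linearCombination k β c ∈ N := by
        have : Finsupp.linearCombination k β c =
            -∑ y ∈ x.support, ((x y) - algebraMap k E (c y)) • β y := by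
          have hx' : ∑ y ∈ x.support, x y • β y = 0 := hx
          simp only [sub_smul, Finset.sum_sub_distrib]
          rw [hx', zero_sub, neg_neg]
          rw [Finsupp.linearCombination_apply, Finsupp.sum_of_support_subset (s := x.support)]
          · simp [algebraMap_smul]
          · exact Finsupp.support_mapRange
          · simp
        rw [this]
        refine N.neg_mem (N.sum_mem fun y _ => Submodule.subset_span ⟨_, ?_, _, rfl⟩)
        rw [map_sub, AlgHom.commutes, MvPolynomial.algebraMap_eq, MvPolynomial.coeff_sub,
          MvPolynomial.coeff_zero_C, Finsupp.mapRange_apply, sub_self]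
      have h2 : N.mkQ (Finsupp.linearCombination k β c) = 0 := by
        rw [← LinearMap.mem_ker, Submodule.ker_mkQ]; exact h1
      rw [← h2, Finsupp.linearCombination_apply, Finsupp.linearCombination_apply, Finsupp.sum,
        Finsupp.sum, map_sum]
      apply Finset.sum_congr rfl
      intro y _
      rw [map_smul, hβ]
    have := (linearIndependent_iff.1 hli) c hc
    intro y
    have h := DFunLike.congr_fun this y
    rwa [Finsupp.mapRange_apply] at h
  have hker : ∀ d, ∀ x, p x = 0 → ∀ y, ∀ j < d,
      MvPolynomial.homogeneousComponent j (ιE (x y)) = 0 := by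
    intro d
    induction d with
    | zero => intro x _ y j hj; omega
    | succ d ih =>
      intro x hx y j hj
      let q : bs → (bs →₀ E) := fun z => Finsupp.single z (1 : E) - s (p (Finsupp.single z 1))
      have hq : ∀ z, p (q z) = 0 := fun z => by simp [q, hs']
      have hxq : x = ∑ z ∈ x.support, x z • q z := by
        simp only [q, smul_sub, Finset.sum_sub_distrib]
        simp only [← map_smul, ← map_sum]
        have : ∑ z ∈ x.support, x z • Finsupp.single z (1 : E) = x := by
          conv_rhs => rw [← Finsupp.sum_single x]
          simp [Finsupp.sum]
        rw [this, hx]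
        simp
      have hxy : x y = ∑ z ∈ x.support, x z * q z y := by
        conv_lhs => rw [hxq]
        rw [Finsupp.finsetSum_apply]
        rfl
      have hxy' : (ιE (x y)) = ∑ z ∈ x.support,
          (ιE (x z)) * (ιE (q z y)) := by
        rw [hxy, map_sum]
        simp only [map_mul]
      rw [hxy', map_sum]
      apply Finset.sum_eq_zero
      intro z _
      rw [hcomp_mul]
      apply Finset.sum_eq_zero
      rintro ⟨a, b⟩ hab
      rw [HasAntidiagonal.mem_antidiagonal] at hab
      simp only at hab ⊢
      rcases Nat.eq_zero_or_pos a with h0 | h0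
      · rw [h0, MvPolynomial.homogeneousComponent_zero, hker0 x hx z]
        simp
      · rw [ih (q z) (hq z) y b (by omega), mul_zero]
  have hinj : Function.Injective p := by
    rw [injective_iff_map_eq_zero]
    intro x hx
    ext y : 1
    apply hιE
    rw [Finsupp.zero_apply, map_zero]
    rw [← MvPolynomial.sum_homogeneousComponent (ιE (x y))]
    exact Finset.sum_eq_zero fun i _ => hker (i + 1) x hx y i (by omega)
  exact Module.Free.of_equiv (LinearEquiv.ofBijective p ⟨hinj, hsurj⟩)

end GradedFree

section Young

/-- Invariants of the Young-type subgroup of permutations preserving the colouring `c` and fixing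
everything outside `t`. -/
noncomputable def youngInv {σ κ : Type} (k : Type) [CommRing k] (c : σ → κ) (t : Finset σ) :
    Subalgebra k (MvPolynomial σ k) where
  carrier := { f | ∀ g : Equiv.Perm σ, (∀ i, c (g i) = c i) → (∀ i, i ∉ t → g i = i) →
    MvPolynomial.rename (⇑g) f = f }
  add_mem' := by
    intro p q hp hq g h1 h2
    rw [map_add, hp g h1 h2, hq g h1 h2]
  mul_mem' := by
    intro p q hp hq g h1 h2
    rw [map_mul, hp g h1 h2, hq g h1 h2]
  algebraMap_mem' := by
    intro r g _ _
    simp [MvPolynomial.algebraMap_eq]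

/-- The polynomial with roots the variables in `t` of colour `a`. -/
noncomputable def blockPoly {σ κ : Type} (k : Type) [CommRing k] [DecidableEq κ]
    (c : σ → κ) (t : Finset σ) (a : κ) : Polynomial (MvPolynomial σ k) :=
  ∏ i ∈ t.filter (fun i => c i = a), (Polynomial.X - Polynomial.C (MvPolynomial.X i))

/-- The subalgebra generated by the elementary symmetric polynomials of the colour classes in `t`
and by the variables outside `t`. -/
noncomputable def youngAdj {σ κ : Type} (k : Type) [CommRing k] [DecidableEq κ]
    (c : σ → κ) (t : Finset σ) : Subalgebra k (MvPolynomial σ k) :=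
  Algebra.adjoin k ({f | ∃ i, i ∉ t ∧ f = MvPolynomial.X i} ∪
    {f | ∃ a n, f = (blockPoly k c t a).coeff n})

/-- The polynomial ring has a basis over `S` containing `1`. -/
def HasUnitalBasis {R k : Type} [CommRing k] [CommRing R] [Algebra k R] (S : Subalgebra k R) :
    Prop :=
  ∃ (ι : Type) (b : Module.Basis ι S R) (i₀ : ι), b i₀ = 1

lemma blockPoly_monic {σ κ : Type} (k : Type) [CommRing k] [DecidableEq κ]
    (c : σ → κ) (t : Finset σ) (a : κ) : (blockPoly k c t a).Monic :=
  Polynomial.monic_prod_of_monic _ _ fun _ _ => Polynomial.monic_X_sub_C _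

lemma blockPoly_coeff_mem {σ κ : Type} (k : Type) [CommRing k] [DecidableEq κ]
    (c : σ → κ) (t : Finset σ) (a : κ) (n : ℕ) :
    (blockPoly k c t a).coeff n ∈ youngAdj k c t :=
  Algebra.subset_adjoin (Or.inr ⟨a, n, rfl⟩)

lemma youngAdj_le_youngInv {σ κ : Type} (k : Type) [CommRing k] [DecidableEq κ]
    (c : σ → κ) (t : Finset σ) : youngAdj k c t ≤ youngInv k c t := by
  apply Algebra.adjoin_le
  rintro f (⟨i, hi, rfl⟩ | ⟨a, n, rfl⟩) g h1 h2
  · rw [MvPolynomial.rename_X, h2 i hi]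
  · have key : (blockPoly k c t a).map (MvPolynomial.rename (R := k) (⇑g)).toRingHom =
        blockPoly k c t a := by
      rw [blockPoly, Polynomial.map_prod]
      refine Finset.prod_equiv g ?_ ?_
      · intro i
        simp only [Finset.mem_filter, h1]
        have : i ∈ t ↔ g i ∈ t := by
          constructor
          · intro hi
            by_contra hn
            have := g.injective (h2 _ hn)
            rw [this] at hn
            exact hn hi
          · intro hi
            by_contra hn
            rw [h2 i hn] at hi
            exact hn hi
        rw [this]
      · intro i _
        simp
    conv_rhs => rw [← key]
    rw [Polynomial.coeff_map]
    rfl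

lemma youngInv_mono {σ κ : Type} (k : Type) [CommRing k]
    (c : σ → κ) {t t' : Finset σ} (h : t ⊆ t') : youngInv k c t' ≤ youngInv k c t :=
  fun _ hf g h1 h2 => hf g h1 fun i hi => h2 i fun hi' => hi (h hi')

lemma young_root {σ κ k : Type} [Field k] [DecidableEq κ] [DecidableEq σ]
    (c : σ → κ) (t : Finset σ) (v : σ) (hv : v ∈ t) (q : Polynomial (MvPolynomial σ k))
    (hdeg : q.natDegree < (t.filter (fun i => c i = c v)).card)
    (hq : ∀ n, q.coeff n ∈ youngInv k c t)
    (h0 : q.eval (MvPolynomial.X v) = 0) : q = 0 := by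
  classical
  refine Polynomial.eq_zero_of_natDegree_lt_card_of_eval_eq_zero' q
    ((t.filter (fun i => c i = c v)).image MvPolynomial.X) ?_ ?_
  · intro r hr
    obtain ⟨w, hw, rfl⟩ := Finset.mem_image.1 hr
    rw [Finset.mem_filter] at hw
    have hinv : q.map (MvPolynomial.rename (R := k) (⇑(Equiv.swap v w))).toRingHom = q := by
      ext1 n
      rw [Polynomial.coeff_map]
      refine hq n (Equiv.swap v w) ?_ ?_
      · intro i
        rcases eq_or_ne i v with rfl | h1
        · rw [Equiv.swap_apply_left, hw.2]
        rcases eq_or_ne i w with rfl | h2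
        · rw [Equiv.swap_apply_right, hw.2]
        rw [Equiv.swap_apply_of_ne_of_ne h1 h2]
      · intro i hi
        apply Equiv.swap_apply_of_ne_of_ne
        · rintro rfl; exact hi hv
        · rintro rfl; exact hi hw.1
    have := congrArg (MvPolynomial.rename (R := k) (⇑(Equiv.swap v w))).toRingHom h0
    rw [← Polynomial.eval_map_apply, hinv] at this
    simpa using this
  · rw [Finset.card_image_of_injective _ (MvPolynomial.X_injective)]
    exact hdeg

lemma hasUnitalBasis_tower {R k : Type} [CommRing k] [CommRing R] [Algebra k R]
    (S S' : Subalgebra k R) (hSS' : S ≤ S') (v : R) (hv : v ∈ S') (n : ℕ) (hn : 0 < n)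
    (hspan : ∀ f ∈ S', ∃ q : Polynomial S, q.natDegree < n ∧ Polynomial.aeval v q = f)
    (hli : ∀ q : Polynomial S, q.natDegree < n → Polynomial.aeval v q = 0 → q = 0)
    (hS' : HasUnitalBasis S') : HasUnitalBasis S := by
  obtain ⟨ι, b, i₀, hb⟩ := hS'
  let _ : Algebra S S' := (Subalgebra.inclusion hSS').toAlgebra
  have hsm : ∀ (s : S) (x : S'), ((s • x : S') : R) = (s : R) * x := fun s x => rfl
  have : IsScalarTower S S' R := ⟨fun x y z => by
    change ((x • y : S') : R) * z = (x : R) * ((y : R) * z)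
    rw [hsm, mul_assoc]⟩
  let w : Fin n → S' := fun i => ⟨v, hv⟩ ^ (i : ℕ)
  have hw : LinearIndependent S w := by
    rw [Fintype.linearIndependent_iff]
    intro g hg
    have h1 := hli (∑ i : Fin n, Polynomial.C (g i) * Polynomial.X ^ (i : ℕ)) ?_ ?_
    · intro i
      have h2 := congrArg (fun q => Polynomial.coeff q (i : ℕ)) h1
      simp only [Polynomial.finsetSum_coeff, Polynomial.coeff_C_mul_X_pow,
        Polynomial.coeff_zero] at h2
      rw [Finset.sum_eq_single i] at h2
      · simpa using h2
      · intro j _ hj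
        rw [if_neg]
        intro h
        exact hj (Fin.ext h.symm)
      · simp
    · refine lt_of_le_of_lt (Polynomial.natDegree_sum_le_of_forall_le _ _ (n := n - 1) ?_)
        (by omega)
      intro i _
      exact (Polynomial.natDegree_C_mul_X_pow_le _ _).trans (by have := i.2; omega)
    · have h3 := congrArg (fun x : S' => (x : R)) hg
      simp only [AddSubmonoidClass.coe_finsetSum, hsm] at h3
      rw [map_sum]
      simp only [map_mul, map_pow, Polynomial.aeval_C, Polynomial.aeval_X]
      exact h3
  have hws : ⊤ ≤ Submodule.span S (Set.range w) := by
    rintro ⟨f, hf⟩ -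
    obtain ⟨q, hq, hqf⟩ := hspan f hf
    have : (⟨f, hf⟩ : S') = ∑ i : Fin n, q.coeff i • w i := by
      apply Subtype.ext
      simp only [AddSubmonoidClass.coe_finsetSum, hsm]
      rw [← hqf, Polynomial.aeval_eq_sum_range' hq, Finset.sum_range]
      rfl
    rw [this]
    exact Submodule.sum_mem _ fun i _ => Submodule.smul_mem _ _ (Submodule.subset_span ⟨i, rfl⟩)
  refine ⟨Fin n × ι, (Module.Basis.mk hw hws).smulTower b, (⟨0, hn⟩, i₀), ?_⟩
  rw [Module.Basis.smulTower_apply, hb, Module.Basis.mk_apply]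
  have hw0 : w ⟨0, hn⟩ = 1 := pow_zero _
  rw [hw0, one_smul]

lemma lift_divByMonic {U R : Type*} [CommRing U] [CommRing R] (φ : U →+* R) (Q : Polynomial U)
    (u : U) (p : Polynomial R)
    (h : Q.map φ = (Polynomial.X - Polynomial.C (φ u)) * p) :
    p = (Q /ₘ (Polynomial.X - Polynomial.C u)).map φ := by
  rw [Polynomial.map_divByMonic _ (Polynomial.monic_X_sub_C _), Polynomial.map_sub,
    Polynomial.map_X, Polynomial.map_C, h,
    Polynomial.mul_divByMonic_cancel_left _ (Polynomial.monic_X_sub_C _)]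

theorem young_main {σ κ k : Type} [Field k] [DecidableEq κ] [DecidableEq σ]
    (c : σ → κ) (t : Finset σ) :
    youngInv k c t ≤ youngAdj k c t ∧ HasUnitalBasis (youngAdj k c t) := by
  induction t using Finset.induction_on with
  | empty =>
    have htop : youngAdj k c ∅ = ⊤ := by
      rw [eq_top_iff, ← MvPolynomial.adjoin_range_X]
      apply Algebra.adjoin_mono
      rintro _ ⟨i, rfl⟩
      exact Or.inl ⟨i, by simp, rfl⟩
    rw [htop]
    refine ⟨le_top, Unit, (Module.Basis.singleton Unit (MvPolynomial σ k)).mapCoeffs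
      (Subalgebra.topEquiv (R := k) (A := MvPolynomial σ k)).symm.toRingEquiv
      (fun _ _ => rfl), (), ?_⟩
    simp
  | insert v t hvt ih =>
    obtain ⟨ih1, ih2⟩ := ih
    set S := youngAdj k c (insert v t) with hS
    have hSI : S ≤ youngInv k c (insert v t) := youngAdj_le_youngInv k c _
    have hSS' : S ≤ youngAdj k c t :=
      hSI.trans ((youngInv_mono k c (Finset.subset_insert v t)).trans ih1)
    have hvS' : (MvPolynomial.X v : MvPolynomial σ k) ∈ youngAdj k c t :=
      Algebra.subset_adjoin (Or.inl ⟨v, hvt, rfl⟩)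
    set n := ((insert v t).filter (fun i => c i = c v)).card with hn
    have hn0 : 0 < n := Finset.card_pos.2 ⟨v, by simp⟩
    have hinj : Function.Injective (algebraMap S (MvPolynomial σ k)) := Subtype.val_injective
    -- lift of the block polynomial
    obtain ⟨P, hP⟩ : ∃ P : Polynomial S, P.map (algebraMap S (MvPolynomial σ k)) =
        blockPoly k c (insert v t) (c v) := by
      have : blockPoly k c (insert v t) (c v) ∈
          Polynomial.lifts (algebraMap S (MvPolynomial σ k)) := by
        rw [Polynomial.lifts_iff_coeff_lifts]
        intro j
        exact ⟨⟨_, blockPoly_coeff_mem k c _ _ j⟩, rfl⟩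
      exact (Polynomial.mem_lifts _).1 this
    have hPm : P.Monic := by
      apply Polynomial.monic_of_injective hinj
      rw [hP]; exact blockPoly_monic k c _ _
    have hPd : P.natDegree = n := by
      rw [← Polynomial.natDegree_map_eq_of_injective hinj, hP, blockPoly,
        Polynomial.natDegree_prod_of_monic _ _ fun i _ => Polynomial.monic_X_sub_C _]
      simp [hn]
    have hProot : Polynomial.aeval (MvPolynomial.X v : MvPolynomial σ k) P = 0 := by
      rw [Polynomial.aeval_def, ← Polynomial.eval_map, hP, blockPoly, Polynomial.eval_prod]
      exact Finset.prod_eq_zero (i := v) (by simp) (by simp)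
    have hgen : ∀ f ∈ youngAdj k c t, ∃ q : Polynomial S,
        Polynomial.aeval (MvPolynomial.X v : MvPolynomial σ k) q = f := by
      let U : Subalgebra S (MvPolynomial σ k) :=
        (Polynomial.aeval (R := S) (MvPolynomial.X v : MvPolynomial σ k)).range
      have hSU : ∀ s ∈ S, s ∈ U := fun s hs => U.algebraMap_mem ⟨s, hs⟩
      have hvU : MvPolynomial.X v ∈ U := ⟨Polynomial.X, by simp⟩
      suffices h : youngAdj k c t ≤ U.restrictScalars k from fun f hf => h hf
      apply Algebra.adjoin_le
      rintro f (⟨i, hi, rfl⟩ | ⟨a, j, rfl⟩)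
      · by_cases hiv : i = v
        · rw [hiv]; exact hvU
        · refine hSU _ (Algebra.subset_adjoin (Or.inl ⟨i, ?_, rfl⟩))
          simp [hiv, hi]
      · by_cases ha : c v = a
        · subst ha
          have hfac : blockPoly k c (insert v t) (c v) =
              (Polynomial.X - Polynomial.C (MvPolynomial.X v)) * blockPoly k c t (c v) := by
            rw [blockPoly, Finset.filter_insert, if_pos rfl, Finset.prod_insert (by simp [hvt])]
            rfl
          obtain ⟨Q, hQ⟩ : ∃ Q : Polynomial U, Q.map (algebraMap U (MvPolynomial σ k)) =
              blockPoly k c (insert v t) (c v) := by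
            refine ⟨P.map (algebraMap S U), ?_⟩
            rw [Polynomial.map_map, ← hP]
            rfl
          have hdiv := lift_divByMonic (U := U) (R := MvPolynomial σ k) (algebraMap U (MvPolynomial σ k)) Q
            (Subtype.mk (MvPolynomial.X v) hvU) (blockPoly k c t (c v)) (hQ.trans hfac)
          rw [hdiv, Polynomial.coeff_map]
          exact Subtype.property _
        · have : blockPoly k c t a = blockPoly k c (insert v t) a := by
            rw [blockPoly, blockPoly, Finset.filter_insert, if_neg ha]
          rw [this]
          exact hSU _ (blockPoly_coeff_mem k c _ _ _)
    have hspan : ∀ f ∈ youngAdj k c t, ∃ q : Polynomial S, q.natDegree < n ∧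
        Polynomial.aeval (MvPolynomial.X v : MvPolynomial σ k) q = f := by
      intro f hf
      obtain ⟨q, hq⟩ := hgen f hf
      refine ⟨q %ₘ P, ?_, ?_⟩
      · rw [← hPd]
        apply Polynomial.natDegree_modByMonic_lt _ hPm
        intro h
        rw [h, Polynomial.natDegree_one] at hPd
        omega
      · rw [Polynomial.aeval_modByMonic_eq_self_of_root hProot, hq]
    have hcoef : ∀ (q : Polynomial S) j,
        (q.map (algebraMap S (MvPolynomial σ k))).coeff j ∈ youngInv k c (insert v t) := by
      intro q j
      rw [Polynomial.coeff_map]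
      exact hSI (q.coeff j).2
    constructor
    · intro f hf
      obtain ⟨q, hq, hqf⟩ := hspan f (ih1 (youngInv_mono k c (Finset.subset_insert v t) hf))
      have h0 := young_root c (insert v t) v (by simp)
        (q.map (algebraMap S (MvPolynomial σ k)) - Polynomial.C f) ?_ ?_ ?_
      · have h1 := congrArg (fun q => Polynomial.coeff q 0) h0
        simp only [Polynomial.coeff_sub, Polynomial.coeff_map, Polynomial.coeff_C_zero,
          Polynomial.coeff_zero] at h1
        rw [← sub_eq_zero.1 h1]
        exact (q.coeff 0).2
      · refine lt_of_le_of_lt (Polynomial.natDegree_sub_le _ _) ?_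
        rw [Polynomial.natDegree_C, Nat.max_zero]
        exact lt_of_le_of_lt Polynomial.natDegree_map_le hq
      · intro j
        rw [Polynomial.coeff_sub]
        refine Subalgebra.sub_mem _ (hcoef q j) ?_
        rw [Polynomial.coeff_C]
        split_ifs
        · exact hf
        · exact zero_mem _
      · rw [Polynomial.eval_sub, Polynomial.eval_map, Polynomial.eval_C]
        rw [Polynomial.aeval_def] at hqf
        rw [hqf, sub_self]
    · refine hasUnitalBasis_tower S (youngAdj k c t) hSS' (MvPolynomial.X v) hvS' n hn0 hspan ?_ ih2
      intro q hq hq0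
      apply Polynomial.map_injective _ hinj
      rw [Polynomial.map_zero]
      refine young_root c (insert v t) v (by simp) _ (lt_of_le_of_lt Polynomial.natDegree_map_le hq)
        (hcoef q) ?_
      rw [Polynomial.eval_map, ← Polynomial.aeval_def, hq0]

end Young

section Assembly

/-- The identification of `Fin (l * m)` with (block, position) pairs. -/
def wrE (l m : ℕ) : Fin (l * m) ≃ Fin m × Fin l :=
  (finCongr (Nat.mul_comm l m)).trans finProdFinEquiv.symm

/-- The index of the block containing `x`. -/
def wrC (l m : ℕ) (x : Fin (l * m)) : Fin m := (wrE l m x).1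

/-- The permutation of `Fin (l * m)` moving blocks by `τ`. -/
def wrHat (l m : ℕ) (τ : Equiv.Perm (Fin m)) : Equiv.Perm (Fin (l * m)) :=
  ((wrE l m).trans (Equiv.prodCongr τ (Equiv.refl _))).trans (wrE l m).symm

lemma wrC_val (l m : ℕ) (x : Fin (l * m)) : (wrC l m x).val = x.val / l := by
  simp [wrC, wrE, finProdFinEquiv, Fin.divNat]

lemma wrC_hat (l m : ℕ) (τ : Equiv.Perm (Fin m)) (x : Fin (l * m)) :
    wrC l m (wrHat l m τ x) = τ (wrC l m x) := by
  simp [wrC, wrHat]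

lemma wrC_surj (l m : ℕ) (hl : 1 ≤ l) (i : Fin m) : ∃ x, wrC l m x = i :=
  ⟨(wrE l m).symm (i, ⟨0, hl⟩), by simp [wrC]⟩

lemma mem_wreathBlock_iff (l m : ℕ) (hl : 1 ≤ l) (i : Fin m) (x : Fin (l * m)) :
    x ∈ wreathBlock l m i ↔ wrC l m x = i := by
  rw [Fin.ext_iff, wrC_val]
  simp only [wreathBlock, Finset.mem_filter, Finset.mem_univ, true_and]
  constructor
  · rintro ⟨h1, h2⟩
    exact Nat.div_eq_of_lt_le h1 h2
  · intro h
    rw [← h]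
    refine ⟨Nat.div_mul_le_self _ _, ?_⟩
    exact (Nat.lt_mul_div_succ _ hl).trans_eq (Nat.mul_comm _ _)

lemma mem_wreath_of (l m : ℕ) (hl : 1 ≤ l) (g : Equiv.Perm (Fin (l * m)))
    (τ : Equiv.Perm (Fin m)) (h : ∀ x, wrC l m (g x) = τ (wrC l m x)) :
    g ∈ wreathProduct l m := by
  intro i
  refine ⟨τ i, ?_⟩
  ext y
  rw [Finset.mem_image, mem_wreathBlock_iff l m hl]
  constructor
  · rintro ⟨x, hx, rfl⟩
    rw [mem_wreathBlock_iff l m hl] at hx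
    rw [h, hx]
  · intro hy
    refine ⟨g.symm y, ?_, by simp⟩
    rw [mem_wreathBlock_iff l m hl]
    apply τ.injective
    rw [← h, Equiv.apply_symm_apply, hy]

lemma exists_of_mem_wreath (l m : ℕ) (hl : 1 ≤ l) (g : Equiv.Perm (Fin (l * m)))
    (hg : g ∈ wreathProduct l m) :
    ∃ τ : Equiv.Perm (Fin m), ∀ x, wrC l m (g x) = τ (wrC l m x) := by
  choose f hf using hg
  have h1 : ∀ x, wrC l m (g x) = f (wrC l m x) := by
    intro x
    rw [← mem_wreathBlock_iff l m hl, ← hf]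
    exact Finset.mem_image_of_mem _ ((mem_wreathBlock_iff l m hl _ _).2 rfl)
  have hs : Function.Surjective f := by
    intro j
    obtain ⟨y, hy⟩ := wrC_surj l m hl j
    refine ⟨wrC l m (g.symm y), ?_⟩
    rw [← h1, Equiv.apply_symm_apply, hy]
  exact ⟨Equiv.ofBijective f (Finite.surjective_iff_bijective.1 hs), h1⟩

lemma wreath_retraction (l m : ℕ) (hl : 1 ≤ l) (k : Type) [Field k]
    (hk : ((m.factorial : ℕ) : k) ≠ 0) :
    ∃ ρ : MvPolynomial (Fin (l * m)) k →+ MvPolynomial (Fin (l * m)) k,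
      (∀ f, ρ f ∈ invariantRing k (l * m) (wreathProduct l m)) ∧
      (∀ f ∈ invariantRing k (l * m) (wreathProduct l m), ρ f = f) ∧
      (∀ s ∈ invariantRing k (l * m) (wreathProduct l m), ∀ f, ρ (s * f) = s * ρ f) := by
  obtain ⟨h1, ι, b, i₀, hb⟩ := young_main (k := k) (wrC l m) (Finset.univ)
  have hmemA : ∀ f ∈ youngAdj k (wrC l m) univ, ∀ h : Equiv.Perm (Fin (l * m)),
      (∀ x, wrC l m (h x) = wrC l m x) → MvPolynomial.rename (⇑h) f = f := by
    intro f hf h hh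
    exact youngAdj_le_youngInv k _ _ hf h hh (by simp)
  have hBA : invariantRing k (l * m) (wreathProduct l m) ≤ youngAdj k (wrC l m) univ := by
    intro f hf
    apply h1
    intro g hg _
    exact hf g (mem_wreath_of l m hl g 1 (by simpa using hg))
  have hinv : ∀ f ∈ invariantRing k (l * m) (wreathProduct l m), ∀ τ : Equiv.Perm (Fin m),
      MvPolynomial.rename (⇑(wrHat l m τ)) f = f := fun f hf τ =>
    hf _ (mem_wreath_of l m hl _ τ (wrC_hat l m τ))
  let avg : MvPolynomial (Fin (l * m)) k →+ MvPolynomial (Fin (l * m)) k :=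
    (AddMonoidHom.mulLeft (MvPolynomial.C ((m.factorial : k)⁻¹))).comp
      (∑ τ : Equiv.Perm (Fin m),
        (MvPolynomial.rename (R := k) (⇑(wrHat l m τ))).toRingHom.toAddMonoidHom)
  have havg : ∀ f, avg f = MvPolynomial.C ((m.factorial : k)⁻¹) *
      ∑ τ : Equiv.Perm (Fin m), MvPolynomial.rename (⇑(wrHat l m τ)) f := by
    intro f
    simp [avg, AddMonoidHom.finsetSum_apply]
  have h_avg_mem : ∀ f ∈ youngAdj k (wrC l m) univ,
      avg f ∈ invariantRing k (l * m) (wreathProduct l m) := by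
    intro f hf w hw
    obtain ⟨σ, hσ⟩ := exists_of_mem_wreath l m hl w hw
    rw [havg, map_mul, MvPolynomial.rename_C, map_sum]
    congr 1
    refine Fintype.sum_equiv (Equiv.mulLeft σ) _ _ ?_
    intro τ
    have := hmemA f hf ((wrHat l m (σ * τ))⁻¹ * (w * wrHat l m τ)) ?_
    · conv_rhs => rw [← this]
      rw [MvPolynomial.rename_rename, MvPolynomial.rename_rename]
      congr 1
      congr 1
      funext x
      simp
    · intro x
      apply (σ * τ).injective
      rw [← wrC_hat]
      simp [hσ, wrC_hat]
  have h_avg_mul : ∀ s ∈ invariantRing k (l * m) (wreathProduct l m), ∀ f,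
      avg (s * f) = s * avg f := by
    intro s hs f
    rw [havg, havg]
    simp only [map_mul, hinv s hs, ← Finset.mul_sum]
    ring
  have h_avg_id : ∀ f ∈ invariantRing k (l * m) (wreathProduct l m), avg f = f := by
    intro f hf
    rw [havg]
    simp only [hinv f hf, Finset.sum_const, Finset.card_univ, Fintype.card_perm, Fintype.card_fin]
    rw [nsmul_eq_mul, ← mul_assoc, ← map_natCast (MvPolynomial.C (σ := Fin (l * m)) (R := k)),
      ← MvPolynomial.C_mul, inv_mul_cancel₀ hk, MvPolynomial.C_1, one_mul]
  have hcoord : ∀ s (hs : s ∈ youngAdj k (wrC l m) univ) f,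
      ((b.coord i₀ (s * f) : youngAdj k (wrC l m) univ) : MvPolynomial (Fin (l * m)) k) =
      s * (b.coord i₀ f : youngAdj k (wrC l m) univ) := by
    intro s hs f
    have := (b.coord i₀).map_smul (⟨s, hs⟩ : youngAdj k (wrC l m) univ) f
    exact congrArg Subtype.val this
  have hone : b.coord i₀ 1 = 1 := by
    rw [← hb]; simp
  let π : MvPolynomial (Fin (l * m)) k →+ MvPolynomial (Fin (l * m)) k :=
    (youngAdj k (wrC l m) univ).val.toRingHom.toAddMonoidHom.comp (b.coord i₀).toAddMonoidHom
  have hπ : ∀ f, π f = (b.coord i₀ f : youngAdj k (wrC l m) univ) := fun f => rfl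
  refine ⟨avg.comp π, ?_, ?_, ?_⟩
  · intro f
    exact h_avg_mem _ (b.coord i₀ f).2
  · intro f hf
    have : π f = f := by
      rw [hπ]
      have := hcoord f (hBA hf) 1
      rw [mul_one, hone] at this
      rw [this]; simp
    rw [AddMonoidHom.comp_apply, this, h_avg_id f hf]
  · intro s hs f
    have h2 : π (s * f) = s * π f := hcoord s (hBA hs) f
    change avg (π (s * f)) = s * avg (π f)
    rw [h2, h_avg_mul s hs]

lemma mem_esymmSub_iff (k : Type) [Field k] (n : ℕ) (W : Subgroup (Equiv.Perm (Fin n)))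
    (f : MvPolynomial (Fin n) k) :
    (∃ e : esymmSubalgebra k n W, ((e : invariantRing k n W) : MvPolynomial (Fin n) k) = f) ↔
      f.IsSymmetric := by
  constructor
  · rintro ⟨⟨e, he⟩, rfl⟩
    have hle : esymmSubalgebra k n W ≤
        (MvPolynomial.symmetricSubalgebra (Fin n) k).comap (invariantRing k n W).val := by
      apply Algebra.adjoin_le
      rintro a ⟨i, _, _, h⟩
      change (a : MvPolynomial (Fin n) k).IsSymmetric
      rw [h]
      exact MvPolynomial.esymm_isSymmetric _ _ _
    exact hle he
  · intro hf
    obtain ⟨p, hp⟩ := MvPolynomial.esymmAlgHom_surjective (σ := Fin n) (R := k) (n := n)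
      (by simp) ⟨f, hf⟩
    have hp2 := congrArg Subtype.val hp
    rw [MvPolynomial.esymmAlgHom_apply] at hp2
    have hes : ∀ i, MvPolynomial.esymm (Fin n) k i ∈ invariantRing k n W :=
      fun i g _ => MvPolynomial.esymm_isSymmetric _ _ _ g
    let y : Fin n → esymmSubalgebra k n W := fun i =>
      ⟨⟨MvPolynomial.esymm (Fin n) k (i + 1), hes _⟩,
        Algebra.subset_adjoin ⟨i + 1, by omega, by omega, rfl⟩⟩
    refine ⟨MvPolynomial.aeval y p, ?_⟩
    refine Eq.trans ?_ hp2
    change ((invariantRing k n W).val.comp (esymmSubalgebra k n W).val) (MvPolynomial.aeval y p) = _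
    rw [← AlgHom.comp_apply, MvPolynomial.comp_aeval]
    rfl

lemma free_over_esymm (k : Type) [Field k] (n : ℕ) (W : Subgroup (Equiv.Perm (Fin n))) :
    Module.Free (esymmSubalgebra k n W) (MvPolynomial (Fin n) k) := by
  obtain ⟨h1, ι, b, i₀, hb⟩ := young_main (k := k) (fun _ : Fin n => ()) (Finset.univ)
  have hS : ∀ f : MvPolynomial (Fin n) k,
      f ∈ youngAdj k (fun _ : Fin n => ()) univ ↔ f.IsSymmetric := by
    intro f
    constructor
    · intro hf g
      exact youngAdj_le_youngInv k _ _ hf g (by simp) (by simp)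
    · intro hf
      exact h1 fun g _ _ => hf g
  let φ : esymmSubalgebra k n W →ₐ[k] youngAdj k (fun _ : Fin n => ()) univ :=
    ((invariantRing k n W).val.comp (esymmSubalgebra k n W).val).codRestrict _
      (fun e => (hS _).2 ((mem_esymmSub_iff k n W _).1 ⟨e, rfl⟩))
  have hφ : Function.Bijective φ := by
    constructor
    · intro x y h
      have h2 : (x : invariantRing k n W).1 = (y : invariantRing k n W).1 :=
        congrArg (fun z : youngAdj k (fun _ : Fin n => ()) univ => z.1) h
      exact Subtype.ext (Subtype.ext h2)
    · rintro ⟨f, hf⟩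
      obtain ⟨e, he⟩ := (mem_esymmSub_iff k n W f).2 ((hS f).1 hf)
      exact ⟨e, Subtype.ext he⟩
  let Φ := RingEquiv.ofBijective φ hφ
  refine Module.Free.of_basis (b.mapCoeffs Φ.symm ?_)
  intro s x
  obtain ⟨e, rfl⟩ := Φ.surjective s
  rw [RingEquiv.symm_apply_apply]
  rfl

lemma factorial_cast_ne_zero (m : ℕ) (k : Type) [Field k]
    (hchar : ringChar k = 0 ∨ (Nat.Prime (ringChar k) ∧ m < ringChar k)) :
    ((m.factorial : ℕ) : k) ≠ 0 := by
  intro h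
  rw [ringChar.spec] at h
  rcases hchar with h0 | ⟨hp, hlt⟩
  · rw [h0, zero_dvd_iff] at h
    exact m.factorial_ne_zero h
  · rw [hp.dvd_factorial] at h
    omega

end Assembly

/-- For `l, m ≥ 1` and a field `k` of characteristic `0` or a prime `p > m`,
the invariant ring `k[x_1,…,x_{lm}]^{S_l≀S_m}` is a free module over the
subalgebra generated by the elementary symmetric polynomials `e_1,…,e_{lm}`;
i.e. it is Cohen-Macaulay over such fields, independently of `l`. -/
theorem invariantRing_Sl_wr_Sm_free_of_char (l m : ℕ) (hl : 1 ≤ l) (hm : 1 ≤ m)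
    (k : Type) [Field k]
    (hchar : ringChar k = 0 ∨ (Nat.Prime (ringChar k) ∧ m < ringChar k)) :
    Module.Free (esymmSubalgebra k (l * m) (wreathProduct l m))
      (invariantRing k (l * m) (wreathProduct l m)) := by
  obtain ⟨ρ, hρ1, hρ2, hρ3⟩ :=
    wreath_retraction l m hl k (factorial_cast_ne_zero m k hchar)
  have hfree := free_over_esymm k (l * m) (wreathProduct l m)
  have hproj : Module.Projective (esymmSubalgebra k (l * m) (wreathProduct l m))
      (invariantRing k (l * m) (wreathProduct l m)) := by
    let i : invariantRing k (l * m) (wreathProduct l m)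
        →ₗ[esymmSubalgebra k (l * m) (wreathProduct l m)] MvPolynomial (Fin (l * m)) k :=
      { toFun := fun b => b.1
        map_add' := fun _ _ => rfl
        map_smul' := fun _ _ => rfl }
    let s : MvPolynomial (Fin (l * m)) k
        →ₗ[esymmSubalgebra k (l * m) (wreathProduct l m)]
        invariantRing k (l * m) (wreathProduct l m) :=
      { toFun := fun f => ⟨ρ f, hρ1 f⟩
        map_add' := fun f g => Subtype.ext (map_add ρ f g)
        map_smul' := fun e f => Subtype.ext (hρ3 e.1.1 e.1.2 f) }
    exact Module.Projective.of_split i s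
      (LinearMap.ext fun b => Subtype.ext (hρ2 b.1 b.2))
  refine graded_free_of_projective
    (E := esymmSubalgebra k (l * m) (wreathProduct l m))
    (B := invariantRing k (l * m) (wreathProduct l m))
    ((invariantRing k (l * m) (wreathProduct l m)).val.comp
      (esymmSubalgebra k (l * m) (wreathProduct l m)).val)
    (invariantRing k (l * m) (wreathProduct l m)).val.toLinearMap
    (fun x y h => Subtype.ext (Subtype.ext h)) (fun x y h => Subtype.ext h)
    (fun _ _ => rfl) ?_ ?_ hproj
  · intro b d
    refine ⟨⟨MvPolynomial.homogeneousComponent d b.1, ?_⟩, rfl⟩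
    intro g hg
    rw [MvPolynomial.rename_homogeneousComponent, b.2 g hg]
  · intro e d
    refine (mem_esymmSub_iff k (l * m) (wreathProduct l m) _).2 ?_
    intro g
    rw [MvPolynomial.rename_homogeneousComponent]
    congr 1
    exact (mem_esymmSub_iff k (l * m) (wreathProduct l m) _).1 ⟨e, rfl⟩ g
end

section
/- Let l > 2 and m > 1 be integers and let k = ℤ/2ℤ (the field ZMod 2). Then the invariant ring k[x_1,…,x_{lm}]^{S_l≀S_m} (the fixed-point subalgebra of MvPolynomial (Fin (l*m)) (ZMod 2) under the variable-permuting action of the wreath product subgroup W(l,m) ≤ Equiv.Perm (Fin (l*m))) is NOT a free module over the subalgebra E generated over k by the elementary symmetric polynomials e_1,…,e_{lm}; equivalently, (ℤ/2ℤ)[x_1,…,x_{lm}]^{S_l≀S_m} is not Cohen-Macaulay for any such pair (l,m). -/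
set_option synthInstance.maxHeartbeats 1000000
set_option maxHeartbeats 1000000

open Finset

open RingTheory.Sequence in
lemma isWeaklyRegular_concat_iff {R : Type*} [CommRing R] (rs : List R) (a : R) :
    IsWeaklyRegular R (rs ++ [a]) ↔ IsWeaklyRegular R rs ∧
      ∀ u, a * u ∈ Ideal.ofList rs → u ∈ Ideal.ofList rs := by
  rw [isWeaklyRegular_append_iff, isWeaklyRegular_singleton_iff]
  refine and_congr_right fun _ => ?_
  rw [isSMulRegular_iff_right_eq_zero_of_smul]
  constructor
  · intro h u hu
    have := h (Submodule.Quotient.mk u) (by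
      rw [← Submodule.Quotient.mk_smul, Submodule.Quotient.mk_eq_zero]
      simpa using hu)
    rw [Submodule.Quotient.mk_eq_zero] at this
    simpa using this
  · intro h x hx
    obtain ⟨u, rfl⟩ := Submodule.Quotient.mk_surjective _ x
    rw [← Submodule.Quotient.mk_smul, Submodule.Quotient.mk_eq_zero] at hx
    rw [Submodule.Quotient.mk_eq_zero]
    simpa using h u (by simpa using hx)

lemma X_pow_mul_mem {k σ : Type*} [Field k] (L : Set (σ →₀ ℕ)) (i : σ)
    (hi : ∀ t ∈ L, t i = 0) (K : ℕ) (u : MvPolynomial σ k)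
    (h : MvPolynomial.X i ^ K * u ∈ Ideal.span ((fun s => MvPolynomial.monomial s (1 : k)) '' L)) :
    u ∈ Ideal.span ((fun s => MvPolynomial.monomial s (1 : k)) '' L) := by
  classical
  rw [MvPolynomial.mem_ideal_span_monomial_image] at h ⊢
  intro t ht
  obtain ⟨s, hs, hst⟩ := h (Finsupp.single i K + t) (by
    rw [MvPolynomial.mem_support_iff] at ht ⊢
    rw [MvPolynomial.X_pow_eq_monomial, MvPolynomial.coeff_monomial_mul]
    simpa using ht)
  refine ⟨s, hs, fun j => ?_⟩
  by_cases hj : j = i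
  · subst hj; rw [hi s hs]; exact Nat.zero_le _
  · have := hst j
    simpa [Finsupp.single_apply, Ne.symm hj] using this

lemma ofList_eq {k σ : Type*} [Field k] (L : List (σ →₀ ℕ)) :
    Ideal.ofList (L.map (fun s => MvPolynomial.monomial s (1 : k))) =
      Ideal.span ((fun s => MvPolynomial.monomial s (1 : k)) '' {s | s ∈ L}) := by
  unfold Ideal.ofList
  congr 1
  ext x; simp

open RingTheory.Sequence in
lemma isWeaklyRegular_pows {k σ : Type*} [Field k] (L : List (σ × ℕ))
    (hL : (L.map Prod.fst).Nodup) :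
    IsWeaklyRegular (MvPolynomial σ k)
      (L.map (fun p => (MvPolynomial.X p.1 ^ p.2 : MvPolynomial σ k))) := by
  classical
  induction L using List.reverseRecOn with
  | nil => simp
  | append_singleton L p ih =>
    rw [List.map_append, List.map_singleton, isWeaklyRegular_concat_iff]
    rw [List.map_append, List.nodup_append] at hL
    refine ⟨ih hL.1, fun u => ?_⟩
    have e : L.map (fun p => (MvPolynomial.X p.1 ^ p.2 : MvPolynomial σ k)) =
        (L.map (fun p => Finsupp.single p.1 p.2)).map
          (fun s => MvPolynomial.monomial s (1 : k)) := by
      simp [List.map_map, MvPolynomial.X_pow_eq_monomial, Function.comp_def]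
    rw [e, ofList_eq]
    apply X_pow_mul_mem
    intro t ht
    simp only [List.mem_map, Set.mem_setOf_eq] at ht
    obtain ⟨q, hq, rfl⟩ := ht
    have := hL.2.2 q.1 (List.mem_map_of_mem hq) p.1 (by simp)
    simp [Finsupp.single_apply, this]

open RingTheory.Sequence in
/-- replacing by congruent elements -/
lemma isWeaklyRegular_replace {R : Type*} [CommRing R] (zs : List R) (x y z a b c : R)
    (h : IsWeaklyRegular R (zs ++ [x] ++ [y] ++ [z]))
    (ha : a - x ∈ Ideal.ofList zs) (hb : b - y ∈ Ideal.ofList zs) (hc : c - z ∈ Ideal.ofList zs) :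
    IsWeaklyRegular R (zs ++ [a] ++ [b] ++ [c]) := by
  have key : ∀ (I : Ideal R) (p q : R), p - q ∈ I → (∀ u, q * u ∈ I → u ∈ I) →
      ∀ u, p * u ∈ I → u ∈ I := by
    intro I p q hpq hq u hu
    apply hq
    have : q * u = p * u - (p - q) * u := by ring
    rw [this]
    exact I.sub_mem hu (I.mul_mem_right _ hpq)
  have key2 : ∀ (I : Ideal R) (p q : R), p - q ∈ I → I ⊔ Ideal.span {p} = I ⊔ Ideal.span {q} := by
    intro I p q hpq
    apply le_antisymm
    · refine sup_le le_sup_left ((Ideal.span_singleton_le_iff_mem _).2 ?_)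
      have : p = (p - q) + q := by ring
      rw [this]
      exact Ideal.add_mem _ (Ideal.mem_sup_left hpq)
        (Ideal.mem_sup_right (Ideal.mem_span_singleton_self q))
    · refine sup_le le_sup_left ((Ideal.span_singleton_le_iff_mem _).2 ?_)
      have : q = p - (p - q) := by ring
      rw [this]
      exact Ideal.sub_mem _ 
        (Ideal.mem_sup_right (Ideal.mem_span_singleton_self p)) (Ideal.mem_sup_left hpq)
  rw [isWeaklyRegular_concat_iff, isWeaklyRegular_concat_iff, isWeaklyRegular_concat_iff] at h ⊢
  obtain ⟨⟨⟨h0, h1⟩, h2⟩, h3⟩ := h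
  simp only [Ideal.ofList_append, Ideal.ofList_singleton] at h1 h2 h3 ⊢
  rw [key2 _ a x ha, key2 _ b y (Ideal.mem_sup_left hb)]
  exact ⟨⟨⟨h0, key _ _ _ ha h1⟩, key _ _ _ (Ideal.mem_sup_left hb) h2⟩,
    key _ _ _ (Ideal.mem_sup_left (Ideal.mem_sup_left hc)) h3⟩

open RingTheory.Sequence in
lemma local_regular {k σ : Type*} [Field k] [Fintype σ] [DecidableEq σ]
    (i₁ i₂ i₃ : σ) (h12 : i₁ ≠ i₂) (h13 : i₁ ≠ i₃) (h23 : i₂ ≠ i₃)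
    (K₁ K₂ K₃ : ℕ) (hK₁ : K₁ ≠ 0) (hK₂ : K₂ ≠ 0) (hK₃ : K₃ ≠ 0)
    (a₁ a₂ a₃ : MvPolynomial σ k)
    (h₁ : a₁ - MvPolynomial.X i₁ ^ K₁ ∈
      Ideal.span (MvPolynomial.X '' {j | j ≠ i₁ ∧ j ≠ i₂ ∧ j ≠ i₃}))
    (h₂ : a₂ - MvPolynomial.X i₂ ^ K₂ ∈
      Ideal.span (MvPolynomial.X '' {j | j ≠ i₁ ∧ j ≠ i₂ ∧ j ≠ i₃}))
    (h₃ : a₃ - MvPolynomial.X i₃ ^ K₃ ∈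
      Ideal.span (MvPolynomial.X '' {j | j ≠ i₁ ∧ j ≠ i₂ ∧ j ≠ i₃})) :
    (∀ u v w, a₃ * u = a₁ * v + a₂ * w →
      ∃ s, MvPolynomial.constantCoeff s ≠ 0 ∧ ∃ p q, s * u = a₁ * p + a₂ * q) ∧
    (∀ (M : ℕ) (N d₁ d₂ : MvPolynomial σ k), a₁ ^ M = N * d₁ → a₂ ^ M = N * d₂ →
      MvPolynomial.constantCoeff N ≠ 0) := by
  set zl : List σ := (Finset.univ.filter (fun j => j ≠ i₁ ∧ j ≠ i₂ ∧ j ≠ i₃)).toList with hzl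
  let zs : List (MvPolynomial σ k) := zl.map MvPolynomial.X
  have hzs : Ideal.ofList zs =
      Ideal.span (MvPolynomial.X '' {j | j ≠ i₁ ∧ j ≠ i₂ ∧ j ≠ i₃}) := by
    unfold Ideal.ofList
    congr 1
    ext x; simp [zs, hzl]
  have hnd : zl.Nodup := Finset.nodup_toList _
  have reg0 : IsWeaklyRegular (MvPolynomial σ k)
      (zs ++ [MvPolynomial.X i₁ ^ K₁] ++ [MvPolynomial.X i₂ ^ K₂] ++ [MvPolynomial.X i₃ ^ K₃]) := by
    have := isWeaklyRegular_pows (k := k) (zl.map (fun j => (j, 1)) ++ [(i₁, K₁), (i₂, K₂), (i₃, K₃)])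
      (by
        rw [List.map_append, List.map_map, List.nodup_append]
        refine ⟨by simpa [Function.comp_def] using hnd, by simp [h12, h13, h23], ?_⟩
        intro a ha b hb
        simp [hzl] at ha hb
        grind)
    simpa [zs, Function.comp_def] using this
  have reg1 := isWeaklyRegular_replace zs _ _ _ a₁ a₂ a₃ reg0 (hzs ▸ h₁) (hzs ▸ h₂) (hzs ▸ h₃)
  let m : Ideal (MvPolynomial σ k) := RingHom.ker (MvPolynomial.constantCoeff (σ := σ) (R := k))
  have hm : m.IsPrime := RingHom.ker_isPrime _
  let A := Localization.AtPrime m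
  have reg2 : IsWeaklyRegular A ((zs ++ [a₁] ++ [a₂] ++ [a₃]).map (algebraMap _ A)) :=
    IsWeaklyRegular.of_isLocalization (S := A) (T := m.primeCompl) reg1
  have hzm : Ideal.ofList zs ≤ m := by
    rw [hzs, Ideal.span_le]
    rintro _ ⟨j, _, rfl⟩
    simp [m, RingHom.mem_ker]
  have ham : ∀ (a : MvPolynomial σ k) (i : σ) (K : ℕ), K ≠ 0 → a - MvPolynomial.X i ^ K ∈
      Ideal.span (MvPolynomial.X '' {j | j ≠ i₁ ∧ j ≠ i₂ ∧ j ≠ i₃}) → a ∈ m := by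
    intro a i K hK h
    rw [← hzs] at h
    have h := hzm h
    simp only [m, RingHom.mem_ker, map_sub, map_pow, MvPolynomial.constantCoeff_X,
      zero_pow hK, sub_zero] at h ⊢
    exact h
  have hmem : ∀ r ∈ (zs ++ [a₁] ++ [a₂] ++ [a₃]).map (algebraMap _ A),
      r ∈ IsLocalRing.maximalIdeal A := by
    intro r hr
    rw [List.mem_map] at hr
    obtain ⟨x, hx, rfl⟩ := hr
    have hxm : x ∈ m := by
      simp only [List.mem_append, List.mem_singleton] at hx
      rcases hx with ((hx | rfl) | rfl) | rfl
      · exact hzm (Ideal.subset_span hx)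
      · exact ham _ _ _ hK₁ h₁
      · exact ham _ _ _ hK₂ h₂
      · exact ham _ _ _ hK₃ h₃
    exact (IsLocalization.AtPrime.to_map_mem_maximal_iff A m x).2 hxm
  have : IsNoetherianRing A := IsLocalization.isNoetherianRing m.primeCompl A inferInstance
  have reg3 := IsLocalRing.isWeaklyRegular_of_perm_of_subset_maximalIdeal (M := A) reg2
    (rs' := ([a₁] ++ [a₂] ++ [a₃] ++ zs).map (algebraMap _ A))
    (List.Perm.map _ (by
      rw [List.append_assoc, List.append_assoc, ← List.append_assoc [a₁]]
      exact List.perm_append_comm)) hmem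
  rw [List.map_append, isWeaklyRegular_append_iff] at reg3
  have reg4 := reg3.1
  rw [List.map_append, List.map_append, List.map_singleton, List.map_singleton, List.map_singleton,
    isWeaklyRegular_concat_iff, isWeaklyRegular_concat_iff,
    ← List.nil_append [(algebraMap _ A) a₁], isWeaklyRegular_concat_iff] at reg4
  obtain ⟨⟨⟨-, r1⟩, r2⟩, r3⟩ := reg4
  simp only [List.nil_append, Ideal.ofList_append, Ideal.ofList_singleton, Ideal.ofList_nil,
    Ideal.mem_bot, bot_sup_eq, Ideal.mem_span_singleton] at r1 r2 r3
  have : IsDomain A := IsLocalization.isDomain_localization (Ideal.primeCompl_le_nonZeroDivisors m)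
  have inj : Function.Injective (algebraMap (MvPolynomial σ k) A) :=
    IsLocalization.injective A (Ideal.primeCompl_le_nonZeroDivisors m)
  constructor
  · intro u v w huvw
    have := r3 (algebraMap _ A u) (by
      rw [← map_mul, huvw, map_add, map_mul, map_mul]
      exact Ideal.add_mem _ (Ideal.mem_sup_left (Ideal.mul_mem_right _ _ (Ideal.mem_span_singleton_self _)))
        (Ideal.mem_sup_right (Ideal.mul_mem_right _ _ (Ideal.mem_span_singleton_self _))))
    have h : algebraMap _ A u ∈ (Ideal.span {a₁} ⊔ Ideal.span {a₂}).map (algebraMap _ A) := by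
      rw [Ideal.map_sup, Ideal.map_span, Ideal.map_span]
      simpa using this
    rw [IsLocalization.algebraMap_mem_map_algebraMap_iff m.primeCompl] at h
    obtain ⟨s, hs, hsu⟩ := h
    refine ⟨s, hs, ?_⟩
    rw [← Ideal.span_insert, Ideal.mem_span_pair] at hsu
    obtain ⟨p, q, hpq⟩ := hsu
    exact ⟨p, q, by rw [← hpq]; ring⟩
  · intro M N d₁ d₂ e1 e2
    set x := algebraMap _ A a₁
    set y := algebraMap _ A a₂
    have hx0 : x ≠ 0 := by
      intro h
      have := r1 1 (by rw [h, zero_mul])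
      exact one_ne_zero this
    have s1 : ∀ (j : ℕ) v, x ∣ y ^ j * v → x ∣ v := by
      intro j
      induction j with
      | zero => intro v hv; simpa using hv
      | succ j ih =>
        intro v hv
        apply ih
        apply r2
        rwa [← mul_assoc, ← pow_succ']
    have s2 : ∀ (i : ℕ) v, x ^ i ∣ y ^ M * v → x ^ i ∣ v := by
      intro i
      induction i with
      | zero => intro v hv; simp
      | succ i ih =>
        intro v hv
        obtain ⟨v', rfl⟩ := s1 M v ((dvd_pow_self x (Nat.succ_ne_zero i)).trans hv)
        rw [pow_succ'] at hv ⊢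
        rw [mul_left_comm] at hv
        exact mul_dvd_mul_left _ (ih _ ((mul_dvd_mul_iff_left hx0).1 hv))
    have f1 : x ^ M = algebraMap _ A N * algebraMap _ A d₁ := by rw [← map_pow, e1, map_mul]
    have f2 : y ^ M = algebraMap _ A N * algebraMap _ A d₂ := by rw [← map_pow, e2, map_mul]
    obtain ⟨q, hq⟩ := s2 M (algebraMap _ A d₁) ⟨algebraMap _ A d₂, by rw [f1, f2]; ring⟩
    have hu : IsUnit (algebraMap _ A N) := by
      refine IsUnit.of_mul_eq_one q ?_
      have : x ^ M * (algebraMap _ A N * q) = x ^ M * 1 := by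
        rw [mul_one]
        conv_rhs => rw [f1, hq]
        ring
      exact mul_left_cancel₀ (pow_ne_zero _ hx0) this
    intro h0
    have := (IsLocalization.AtPrime.to_map_mem_maximal_iff A m N).2 h0
    exact (IsLocalRing.mem_maximalIdeal _).1 this hu

lemma free_reg {E M : Type*} [CommRing E] [AddCommGroup M] [Module E M] [Module.Free E M]
    (T : Submonoid E) (a₁ a₂ a₃ : E)
    (h : ∀ u v w, a₃ * u = a₁ * v + a₂ * w → ∃ s ∈ T, ∃ p q, s * u = a₁ * p + a₂ * q)
    (u v w : M) (huvw : a₃ • u = a₁ • v + a₂ • w) :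
    ∃ s ∈ T, ∃ p q : M, s • u = a₁ • p + a₂ • q := by
  classical
  let B := Module.Free.chooseBasis E M
  have hc : ∀ i, ∃ s ∈ T, ∃ p q, s * B.repr u i = a₁ * p + a₂ * q := by
    intro i
    apply h _ (B.repr v i) (B.repr w i)
    have := congrArg (fun x => B.repr x i) huvw
    simpa using this
  choose s hs p q hpq using hc
  refine ⟨∏ i ∈ (B.repr u).support, s i, T.prod_mem fun i _ => hs i,
    ∑ i ∈ (B.repr u).support, ((∏ j ∈ (B.repr u).support.erase i, s j) * p i) • B i,
    ∑ i ∈ (B.repr u).support, ((∏ j ∈ (B.repr u).support.erase i, s j) * q i) • B i, ?_⟩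
  have hu : u = ∑ i ∈ (B.repr u).support, B.repr u i • B i := by
    conv_lhs => rw [← B.linearCombination_repr u, Finsupp.linearCombination_apply, Finsupp.sum]
  refine (congrArg (fun x => (∏ i ∈ (B.repr u).support, s i) • x) hu).trans ?_
  rw [Finset.smul_sum, Finset.smul_sum, Finset.smul_sum, ← Finset.sum_add_distrib]
  refine Finset.sum_congr rfl fun i hi => ?_
  rw [smul_smul, smul_smul, smul_smul, ← add_smul, ← Finset.mul_prod_erase _ _ hi]
  congr 1
  linear_combination (∏ j ∈ (B.repr u).support.erase i, s j) * hpq i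

lemma prime_lemma {n : ℕ} (W : Subgroup (Equiv.Perm (Fin n))) (χ : W →* ℤˣ)
    (τ : W) (hτ : χ τ = -1) {D : Type} [CommRing D] [IsDomain D]
    (π : MvPolynomial (Fin n) (ZMod 2) →+* D)
    (hJ : ∀ b : MvPolynomial (Fin n) (ZMod 2),
      (∀ h : W, χ h = 1 → MvPolynomial.rename (h : Equiv.Perm (Fin n)) b = b) →
      π b = π (MvPolynomial.rename (τ : Equiv.Perm (Fin n)) b)) :
    ∃ g : W, χ g = -1 ∧ ∀ i, π (MvPolynomial.X i) = π (MvPolynomial.X ((g : Equiv.Perm (Fin n)) i)) := by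
  classical
  let act : W → (MvPolynomial (Fin n) (ZMod 2)) →+* (MvPolynomial (Fin n) (ZMod 2)) := fun g => (MvPolynomial.rename (g : Equiv.Perm (Fin n))).toRingHom
  have act_mul : ∀ g h : W, act (g * h) = (act g).comp (act h) := by
    intro g h
    ext x
    · simp [act]
    · simp [act]
  let s : Polynomial (MvPolynomial (Fin n) (ZMod 2)) := ∑ i : Fin n, Polynomial.monomial (i : ℕ) (MvPolynomial.X i)
  have hs : ∀ (T : Type) [CommRing T] (f : (MvPolynomial (Fin n) (ZMod 2)) →+* T) (i : Fin n),
      (s.map f).coeff i = f (MvPolynomial.X i) := by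
    intro T _ f i
    simp only [s, Polynomial.map_sum, Polynomial.finsetSum_coeff, Polynomial.map_monomial,
      Polynomial.coeff_monomial]
    rw [Finset.sum_eq_single i]
    · simp
    · intro j _ hj
      rw [if_neg]
      intro h; exact hj (Fin.ext h)
    · simp
  let F : Polynomial (Polynomial (MvPolynomial (Fin n) (ZMod 2))) :=
    ∏ h : χ.ker, (Polynomial.X - Polynomial.C (s.map (act h)))
  have mapF : ∀ (T : Type) [CommRing T] (f : (MvPolynomial (Fin n) (ZMod 2)) →+* T), F.map (Polynomial.mapRingHom f) =
      ∏ h : χ.ker, (Polynomial.X - Polynomial.C (s.map (f.comp (act h)))) := by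
    intro T _ f
    simp only [F, Polynomial.map_prod, Polynomial.map_sub, Polynomial.map_X, Polynomial.map_C,
      Polynomial.coe_mapRingHom, Polynomial.map_map]
  have Finv : ∀ g : W, χ g = 1 → F.map (Polynomial.mapRingHom (act g)) = F := by
    intro g hg
    rw [mapF]
    let g' : χ.ker := ⟨g, hg⟩
    refine Fintype.prod_equiv (Equiv.mulLeft g') _ _ fun h => ?_
    rw [← act_mul]
    rfl
  have coefinv : ∀ i j, ∀ h : W, χ h = 1 →
      MvPolynomial.rename (h : Equiv.Perm (Fin n)) ((F.coeff i).coeff j) = (F.coeff i).coeff j := by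
    intro i j h hh
    conv_rhs => rw [← Finv h hh]
    simp [act]
  have key : F.map (Polynomial.mapRingHom π) = F.map (Polynomial.mapRingHom (π.comp (act τ))) := by
    ext i j
    simp only [Polynomial.coeff_map, Polynomial.coe_mapRingHom, RingHom.comp_apply]
    exact hJ _ (coefinv i j)
  rw [mapF, mapF] at key
  have act_one : act (1 : χ.ker) = RingHom.id _ := by
    ext x
    · simp [act]
    · simp [act]
  have ev := congrArg (Polynomial.eval (s.map π)) key
  rw [Polynomial.eval_prod, Polynomial.eval_prod, Finset.prod_eq_zero (Finset.mem_univ (1 : χ.ker))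
    (by rw [act_one]; simp)] at ev
  obtain ⟨h, -, hh⟩ := Finset.prod_eq_zero_iff.1 ev.symm
  refine ⟨τ * h, by rw [map_mul, hτ, (h.2 : χ h = 1), mul_one], fun i => ?_⟩
  simp only [Polynomial.eval_sub, Polynomial.eval_X, Polynomial.eval_C] at hh
  have := congrArg (fun q => Polynomial.coeff q (i : ℕ)) (sub_eq_zero.1 hh)
  simp only [hs] at this
  rw [RingHom.comp_assoc, ← act_mul] at this
  refine this.trans ?_
  simp [act]

lemma esymm_vanish {D : Type*} [CommRing D] [IsDomain D] [CharP D 2] (n : ℕ) (y : Fin n → D)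
    (p q : Fin 3 → Fin n) (hp : Function.Injective p) (hq : Function.Injective q)
    (hpq : ∀ r r', p r ≠ q r') (hy : ∀ r, y (p r) = y (q r))
    (hz : ∀ j, Odd j → j + 5 < n → (Finset.univ.val.map y).esymm j = 0) :
    ∀ j, Odd j → j ≤ n → (Finset.univ.val.map y).esymm j = 0 := by
  classical
  let f : Polynomial D := ((Finset.univ.val.map y).map (fun r => Polynomial.X + Polynomial.C r)).prod
  have hcard : Multiset.card (Finset.univ.val.map y) = n := by simp
  have hcoef : ∀ j ≤ n, f.coeff j = (Finset.univ.val.map y).esymm (n - j) := by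
    intro j hj
    have := Multiset.prod_X_add_C_coeff (Finset.univ.val.map y) (k := j) (by rw [hcard]; exact hj)
    rw [hcard] at this
    exact this
  have hf : f = ∏ i, (Polynomial.X + Polynomial.C (y i)) := by
    simp only [f, Multiset.map_map]; rfl
  have hdeg : f.natDegree ≤ n := by
    rw [hf]
    refine (Polynomial.natDegree_prod_le _ _).trans ?_
    simp
  let Q : Polynomial D := ∏ r : Fin 3, (Polynomial.X + Polynomial.C (y (p r)))
  have hQm : Q.Monic := Polynomial.monic_prod_of_monic _ _ fun r _ => Polynomial.monic_X_add_C _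
  have hQd : Q.natDegree = 3 := by
    rw [Polynomial.natDegree_prod_of_monic _ _ fun r _ => Polynomial.monic_X_add_C _]
    simp
  obtain ⟨h, hh⟩ : ∃ h, f = Q ^ 2 * h := by
    let U : Finset (Fin n) := Finset.univ.image p ∪ Finset.univ.image q
    refine ⟨∏ i ∈ Uᶜ, (Polynomial.X + Polynomial.C (y i)), ?_⟩
    rw [hf, ← Finset.prod_mul_prod_compl U]
    congr 1
    rw [Finset.prod_union, Finset.prod_image (fun a _ b _ e => hp e),
      Finset.prod_image (fun a _ b _ e => hq e), pow_two]
    · congr 1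
      exact Finset.prod_congr rfl fun r _ => by rw [hy]
    · rw [Finset.disjoint_left]
      intro x hx hx'
      simp only [Finset.mem_image, Finset.mem_univ, true_and] at hx hx'
      obtain ⟨r, rfl⟩ := hx
      obtain ⟨r', hr'⟩ := hx'
      exact hpq _ _ hr'.symm
  let G : Polynomial D := Polynomial.X * Polynomial.derivative f + Polynomial.C (n : D) * f
  have h2 : (2 : Polynomial D) = 0 := CharTwo.two_eq_zero
  have hG : G = Q ^ 2 * (Polynomial.X * Polynomial.derivative h + Polynomial.C (n : D) * h) := by
    simp only [G, hh, Polynomial.derivative_mul, pow_two]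
    linear_combination (Polynomial.X * Q * Polynomial.derivative Q * h) * h2
  have hGc : ∀ j, G.coeff j = ((j + n : ℕ) : D) * f.coeff j := by
    intro j
    cases j with
    | zero => simp [G]
    | succ j =>
      simp only [G, Polynomial.coeff_add, Polynomial.coeff_X_mul, Polynomial.coeff_derivative,
        Polynomial.coeff_C_mul]
      push_cast
      ring
  have hG0 : G = 0 := by
    refine Polynomial.eq_zero_of_dvd_of_natDegree_lt (p := Q ^ 2) ⟨_, hG⟩ ?_
    rw [hQm.natDegree_pow, hQd]
    refine lt_of_le_of_lt (show G.natDegree ≤ 5 from Polynomial.natDegree_le_iff_coeff_eq_zero.2 ?_) (by norm_num)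
    intro j hj
    rw [hGc]
    by_cases hjn : j ≤ n
    · rcases Nat.even_or_odd (j + n) with he | ho
      · rw [(CharP.cast_eq_zero_iff D 2 _).2 he.two_dvd, zero_mul]
      · rw [hcoef j hjn, hz, mul_zero]
        · rw [Nat.odd_sub hjn]; rw [Nat.odd_add] at ho
          have := Nat.not_even_iff_odd (n := j); have := Nat.not_even_iff_odd (n := n)
          tauto
        · omega
    · rw [Polynomial.coeff_eq_zero_of_natDegree_lt (by omega), mul_zero]
  intro j hj hjn
  have := hGc (n - j)
  rw [hG0, Polynomial.coeff_zero, hcoef _ (by omega), show n - (n - j) = j by omega] at this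
  have ho : Odd (n - j + n) := by
    obtain ⟨c, rfl⟩ := hj
    exact ⟨n - c - 1, by omega⟩
  have hne : ((n - j + n : ℕ) : D) ≠ 0 := by
    intro h0
    rw [CharP.cast_eq_zero_iff D 2] at h0
    exact (Nat.not_even_iff_odd.2 ho) (even_iff_two_dvd.2 h0)
  exact (mul_eq_zero.1 this.symm).resolve_left hne

lemma exists_block_hom (l m : ℕ) (hl : 2 < l) (hm : 1 < m) :
    ∃ χ : wreathProduct l m →* ℤˣ, (∃ τ, χ τ = -1) ∧ ∀ g, χ g = -1 →
      ∃ p : Fin 3 → Fin (l * m), Function.Injective p ∧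
        ∀ r r', p r ≠ (g : Equiv.Perm (Fin (l * m))) (p r') := by
  classical
  have hl0 : 0 < l := by omega
  let blk : Fin (l * m) → Fin m := fun x => ⟨x.val / l, Nat.div_lt_of_lt_mul x.isLt⟩
  have hblk : ∀ x i, x ∈ wreathBlock l m i ↔ blk x = i := by
    intro x i
    simp only [wreathBlock, Finset.mem_filter, Finset.mem_univ, true_and, blk, Fin.ext_iff]
    rw [Nat.div_eq_iff hl0]
    rw [Nat.succ_mul]
    omega
  let pt : Fin m → Fin l → Fin (l * m) := fun i r => ⟨i.val * l + r.val, by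
    calc i.val * l + r.val < (i.val + 1) * l := by rw [Nat.succ_mul]; omega
      _ ≤ m * l := Nat.mul_le_mul_right l i.isLt
      _ = l * m := Nat.mul_comm m l⟩
  have hpt : ∀ i r, blk (pt i r) = i := by
    intro i r
    simp only [blk, pt, Fin.ext_iff]
    rw [Nat.div_eq_iff hl0]
    omega
  have hptinj : ∀ i r r', pt i r = pt i r' → r = r' := by
    intro i r r' h
    simp only [pt, Fin.ext_iff] at h ⊢
    omega
  have hex : ∀ g : wreathProduct l m, ∃ φ : Fin m → Fin m,
      ∀ x, blk ((g : Equiv.Perm (Fin (l * m))) x) = φ (blk x) := by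
    intro g
    have hg := g.2
    choose φ hφ using (show ∀ i : Fin m, ∃ j : Fin m,
      (wreathBlock l m i).image (g : Equiv.Perm (Fin (l * m))) = wreathBlock l m j from hg)
    refine ⟨φ, fun x => ?_⟩
    rw [← hblk, ← hφ]
    exact Finset.mem_image_of_mem _ ((hblk _ _).2 rfl)
  choose φ hφ using hex
  let r0 : Fin l := ⟨0, hl0⟩
  have huniq : ∀ (g : wreathProduct l m) (f : Fin m → Fin m),
      (∀ x, blk ((g : Equiv.Perm (Fin (l * m))) x) = f (blk x)) → φ g = f := by
    intro g f hf
    funext i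
    have h1 := hφ g (pt i r0)
    rw [hf, hpt] at h1
    exact h1.symm
  let Φ : wreathProduct l m →* Function.End (Fin m) :=
    { toFun := φ
      map_one' := huniq _ _ fun x => rfl
      map_mul' := fun g h => huniq _ _ fun x => by
        change blk ((g : Equiv.Perm (Fin (l * m))) ((h : Equiv.Perm (Fin (l * m))) x)) =
          φ g (φ h (blk x))
        rw [hφ, hφ] }
  let χ : wreathProduct l m →* ℤˣ := Equiv.Perm.sign.comp Φ.toHomPerm
  refine ⟨χ, ?_, ?_⟩
  · let i0 : Fin m := ⟨0, by omega⟩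
    let i1 : Fin m := ⟨1, hm⟩
    have hi : i0 ≠ i1 := by simp [i0, i1, Fin.ext_iff]
    -- swap the blocks
    let off : Fin (l * m) → Fin l := fun x => ⟨x.val % l, Nat.mod_lt _ hl0⟩
    have hoff : ∀ i r, off (pt i r) = r := by
      intro i r
      simp only [off, pt, Fin.ext_iff]
      rw [Nat.mul_comm, Nat.mul_add_mod, Nat.mod_eq_of_lt r.isLt]
    have hpto : ∀ x, pt (blk x) (off x) = x := by
      intro x
      simp only [off, pt, blk, Fin.ext_iff]
      exact Nat.div_add_mod' _ _
    let t : Equiv.Perm (Fin (l * m)) :=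
      { toFun := fun x => pt (Equiv.swap i0 i1 (blk x)) (off x)
        invFun := fun x => pt (Equiv.swap i0 i1 (blk x)) (off x)
        left_inv := fun x => by simp [hpt, hoff, hpto]
        right_inv := fun x => by simp [hpt, hoff, hpto] }
    have ht : ∀ x, blk (t x) = Equiv.swap i0 i1 (blk x) := fun x => hpt _ _
    have htt : ∀ x, t (t x) = x := fun x => t.left_inv x
    have htm : t ∈ wreathProduct l m := by
      intro i
      refine ⟨Equiv.swap i0 i1 i, ?_⟩
      ext x
      rw [Finset.mem_image, hblk]
      constructor
      · rintro ⟨y, hy, rfl⟩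
        rw [hblk] at hy
        rw [ht, hy]
      · intro hx
        exact ⟨t x, by rw [hblk, ht, hx, Equiv.swap_apply_self], htt x⟩
    refine ⟨⟨t, htm⟩, ?_⟩
    have : Φ.toHomPerm ⟨t, htm⟩ = Equiv.swap i0 i1 := by
      ext1 i
      exact congrFun (huniq ⟨t, htm⟩ _ ht) i
    simp only [χ, MonoidHom.comp_apply, this, Equiv.Perm.sign_swap hi]
  · intro g hg
    have hne : Φ.toHomPerm g ≠ 1 := by
      intro h
      simp [χ, h] at hg
    obtain ⟨i, hi⟩ : ∃ i, φ g i ≠ i := by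
      by_contra! hcon
      apply hne
      ext1 i
      exact hcon i
    refine ⟨fun r => pt i (Fin.castLE hl r), ?_, ?_⟩
    · intro r r' h
      simpa using hptinj _ _ _ h
    · intro r r' h
      have := congrArg blk h
      rw [hφ, hpt, hpt] at this
      exact hi this.symm

lemma esymm_mem_invariantRing {n : ℕ} (W : Subgroup (Equiv.Perm (Fin n))) (j : ℕ) :
    MvPolynomial.esymm (Fin n) (ZMod 2) j ∈ invariantRing (ZMod 2) n W :=
  fun g _ => MvPolynomial.esymm_isSymmetric (Fin n) (ZMod 2) j g

lemma exists_theta {n : ℕ} (W : Subgroup (Equiv.Perm (Fin n))) :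
    ∃ θ : MvPolynomial (Fin n) (ZMod 2) ≃+* esymmSubalgebra (ZMod 2) n W,
      (∀ i : Fin n, ((θ (MvPolynomial.X i) : invariantRing (ZMod 2) n W) :
        MvPolynomial (Fin n) (ZMod 2)) = MvPolynomial.esymm (Fin n) (ZMod 2) (i + 1)) ∧
      (∀ p, MvPolynomial.constantCoeff ((θ p : invariantRing (ZMod 2) n W) :
        MvPolynomial (Fin n) (ZMod 2)) = MvPolynomial.constantCoeff p) ∧
      (∀ p (σ : Equiv.Perm (Fin n)), MvPolynomial.rename σ ((θ p : invariantRing (ZMod 2) n W) :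
        MvPolynomial (Fin n) (ZMod 2)) = ((θ p : invariantRing (ZMod 2) n W) :
        MvPolynomial (Fin n) (ZMod 2))) ∧
      (∀ q : MvPolynomial (Fin n) (ZMod 2), q.IsSymmetric → ∃ p,
        ((θ p : invariantRing (ZMod 2) n W) : MvPolynomial (Fin n) (ZMod 2)) = q) := by
  classical
  let e : Fin n → invariantRing (ZMod 2) n W := fun i =>
    ⟨MvPolynomial.esymm (Fin n) (ZMod 2) (i + 1), esymm_mem_invariantRing W _⟩
  let θ0 : MvPolynomial (Fin n) (ZMod 2) →ₐ[ZMod 2] esymmSubalgebra (ZMod 2) n W :=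
    MvPolynomial.aeval fun i => ⟨e i, Algebra.subset_adjoin ⟨i + 1, by omega, by omega, rfl⟩⟩
  have hval : ∀ p, ((θ0 p : invariantRing (ZMod 2) n W) : MvPolynomial (Fin n) (ZMod 2)) =
      (MvPolynomial.esymmAlgHom (Fin n) (ZMod 2) n p).val := by
    intro p
    rw [MvPolynomial.esymmAlgHom_apply]
    have : ((invariantRing (ZMod 2) n W).val.comp (esymmSubalgebra (ZMod 2) n W).val).comp θ0 =
        MvPolynomial.aeval (fun i : Fin n => MvPolynomial.esymm (Fin n) (ZMod 2) (i + 1)) := by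
      apply MvPolynomial.algHom_ext
      intro i
      simp [θ0, e]
    exact congrArg (fun f => f p) this
  have hinj : Function.Injective θ0 := by
    intro p q hpq
    apply MvPolynomial.esymmAlgHom_fin_injective (R := ZMod 2) (n := n) (m := n) le_rfl
    apply Subtype.ext
    rw [← hval, ← hval, hpq]
  have hsurj : Function.Surjective θ0 := by
    have hle : esymmSubalgebra (ZMod 2) n W ≤
        ((esymmSubalgebra (ZMod 2) n W).val.comp θ0).range := by
      unfold esymmSubalgebra
      refine Algebra.adjoin_le ?_
      rintro a ⟨i, h1, h2, ha⟩
      refine ⟨MvPolynomial.X ⟨i - 1, by omega⟩, ?_⟩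
      apply Subtype.ext
      rw [ha]
      have := hval (MvPolynomial.X ⟨i - 1, by omega⟩)
      rw [MvPolynomial.esymmAlgHom_apply] at this
      refine this.trans ?_
      rw [MvPolynomial.aeval_X]
      simp only
      rw [Nat.sub_add_cancel h1]
    intro x
    obtain ⟨p, hp⟩ := hle x.2
    exact ⟨p, Subtype.ext hp⟩
  refine ⟨RingEquiv.ofBijective θ0 ⟨hinj, hsurj⟩, ?_, ?_, ?_, ?_⟩
  · intro i
    change ((θ0 _ : invariantRing (ZMod 2) n W) : MvPolynomial (Fin n) (ZMod 2)) = _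
    rw [hval, MvPolynomial.esymmAlgHom_apply, MvPolynomial.aeval_X]
  · intro p
    change MvPolynomial.constantCoeff
      ((θ0 _ : invariantRing (ZMod 2) n W) : MvPolynomial (Fin n) (ZMod 2)) = _
    rw [hval, MvPolynomial.esymmAlgHom_apply]
    induction p using MvPolynomial.induction_on with
    | C a => simp
    | add p q hp hq => rw [map_add, map_add, hp, hq, map_add]
    | mul_X p i hp =>
      rw [map_mul, map_mul, hp, map_mul, MvPolynomial.aeval_X, MvPolynomial.constantCoeff_X]
      congr 1
      rw [MvPolynomial.esymm, map_sum]
      refine Finset.sum_eq_zero fun t ht => ?_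
      rw [map_prod]
      have hc : t.card = i + 1 := (Finset.mem_powersetCard.1 ht).2
      obtain ⟨x, hx⟩ := Finset.card_pos.1 (by omega : 0 < t.card)
      exact Finset.prod_eq_zero hx (by simp)
  · intro p σ
    change MvPolynomial.rename σ
      ((θ0 _ : invariantRing (ZMod 2) n W) : MvPolynomial (Fin n) (ZMod 2)) =
      ((θ0 _ : invariantRing (ZMod 2) n W) : MvPolynomial (Fin n) (ZMod 2))
    rw [hval]
    exact (MvPolynomial.esymmAlgHom (Fin n) (ZMod 2) n p).2 σ
  · intro q hq
    obtain ⟨p, hp⟩ := MvPolynomial.esymmAlgHom_surjective (σ := Fin n) (ZMod 2) (n := n) (by simp) ⟨q, hq⟩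
    refine ⟨p, ?_⟩
    change ((θ0 _ : invariantRing (ZMod 2) n W) : MvPolynomial (Fin n) (ZMod 2)) = _
    rw [hval, hp]

/-- The annihilator of the class `χ`. -/
noncomputable def annIdeal {n : ℕ} (W : Subgroup (Equiv.Perm (Fin n))) (χ : W →* ℤˣ) :
    Ideal (invariantRing (ZMod 2) n W) where
  carrier := { r | ∃ b : MvPolynomial (Fin n) (ZMod 2),
    (∀ h : W, χ h = 1 → MvPolynomial.rename (h : Equiv.Perm (Fin n)) b = b) ∧
    (∀ h : W, χ h = -1 → MvPolynomial.rename (h : Equiv.Perm (Fin n)) b = b + r) }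
  zero_mem' := ⟨0, by simp, by simp⟩
  add_mem' := by
    rintro r s ⟨b, hb, hb'⟩ ⟨c, hc, hc'⟩
    refine ⟨b + c, fun h hh => ?_, fun h hh => ?_⟩
    · rw [map_add, hb h hh, hc h hh]
    · rw [map_add, hb' h hh, hc' h hh]
      push_cast
      ring
  smul_mem' := by
    rintro t r ⟨b, hb, hb'⟩
    refine ⟨t * b, fun h hh => ?_, fun h hh => ?_⟩
    · rw [map_mul, hb h hh, t.2 h h.2]
    · rw [map_mul, hb' h hh, t.2 h h.2, smul_eq_mul]
      push_cast
      ring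

lemma transfer_mem_annIdeal {n : ℕ} (W : Subgroup (Equiv.Perm (Fin n))) (χ : W →* ℤˣ)
    (τ : W) (hτ : χ τ = -1) (b : MvPolynomial (Fin n) (ZMod 2))
    (hb : ∀ h : W, χ h = 1 → MvPolynomial.rename (h : Equiv.Perm (Fin n)) b = b) :
    ∃ r ∈ annIdeal W χ, (r : MvPolynomial (Fin n) (ZMod 2)) =
      b + MvPolynomial.rename (τ : Equiv.Perm (Fin n)) b := by
  have ren : ∀ (g h : W) (p : MvPolynomial (Fin n) (ZMod 2)),
      MvPolynomial.rename (g : Equiv.Perm (Fin n)) (MvPolynomial.rename (h : Equiv.Perm (Fin n)) p)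
        = MvPolynomial.rename ((g * h : W) : Equiv.Perm (Fin n)) p := by
    intro g h p
    rw [MvPolynomial.rename_rename]
    rfl
  have h2 : (2 : MvPolynomial (Fin n) (ZMod 2)) = 0 := CharTwo.two_eq_zero
  have hodd : ∀ g : W, χ g = -1 → MvPolynomial.rename (g : Equiv.Perm (Fin n)) b =
      MvPolynomial.rename (τ : Equiv.Perm (Fin n)) b := by
    intro g hg
    have : g = τ * (τ⁻¹ * g) := by group
    rw [this, ← ren, hb]
    rw [map_mul, map_inv, hτ, hg]
    simp
  have hinv : b + MvPolynomial.rename (τ : Equiv.Perm (Fin n)) b ∈ invariantRing (ZMod 2) n W := by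
    intro g hg
    rw [map_add]
    have e := ren ⟨g, hg⟩ τ b
    simp only at e
    rw [e]
    rcases Int.units_eq_one_or (χ ⟨g, hg⟩) with h1 | h1
    · rw [hodd (⟨g, hg⟩ * τ) (by rw [map_mul, h1, hτ]; simp)]
      rw [show MvPolynomial.rename (g : Equiv.Perm (Fin n)) b = b from hb ⟨g, hg⟩ h1]
    · rw [hb (⟨g, hg⟩ * τ) (by rw [map_mul, h1, hτ]; simp)]
      rw [show MvPolynomial.rename (g : Equiv.Perm (Fin n)) b = _ from hodd ⟨g, hg⟩ h1, add_comm]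
  refine ⟨⟨_, hinv⟩, ⟨b, hb, fun g hg => ?_⟩, rfl⟩
  rw [hodd g hg]
  simp only
  linear_combination -b * h2

lemma isIntegral_big {n : ℕ} (W : Subgroup (Equiv.Perm (Fin n))) :
    Algebra.IsIntegral (esymmSubalgebra (ZMod 2) n W) (MvPolynomial (Fin n) (ZMod 2)) := by
  classical
  have hX : ∀ i : Fin n, IsIntegral (esymmSubalgebra (ZMod 2) n W)
      (MvPolynomial.X i : MvPolynomial (Fin n) (ZMod 2)) := by
    intro i
    let f : Polynomial (MvPolynomial (Fin n) (ZMod 2)) :=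
      ∏ i : Fin n, (Polynomial.X + Polynomial.C (MvPolynomial.X i))
    have hf : f.Monic := Polynomial.monic_prod_of_monic _ _ fun r _ => Polynomial.monic_X_add_C _
    have hd : f.natDegree = n := by
      rw [Polynomial.natDegree_prod_of_monic _ _ fun r _ => Polynomial.monic_X_add_C _]
      simp
    have hl : f ∈ Polynomial.lifts (algebraMap (esymmSubalgebra (ZMod 2) n W)
        (MvPolynomial (Fin n) (ZMod 2))) := by
      rw [Polynomial.lifts_iff_coeff_lifts]
      intro j
      by_cases hj : j ≤ n
      · have hc := MvPolynomial.prod_X_add_C_coeff (σ := Fin n) (ZMod 2) j (by simpa using hj)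
        rw [Fintype.card_fin] at hc
        by_cases h0 : n - j = 0
        · rw [h0, MvPolynomial.esymm_zero] at hc
          exact ⟨1, by rw [map_one]; exact hc.symm⟩
        · exact ⟨⟨⟨_, esymm_mem_invariantRing W (n - j)⟩,
            Algebra.subset_adjoin ⟨n - j, by omega, by omega, rfl⟩⟩, hc.symm⟩
      · rw [Polynomial.coeff_eq_zero_of_natDegree_lt (by omega)]
        exact ⟨0, map_zero _⟩
    obtain ⟨q, hq, -, hqm⟩ := Polynomial.lifts_and_natDegree_eq_and_monic hl hf
    have : IsIntegral (esymmSubalgebra (ZMod 2) n W)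
      (-MvPolynomial.X i : MvPolynomial (Fin n) (ZMod 2)) := by
      refine ⟨q, hqm, ?_⟩
      rw [← Polynomial.eval_map, hq, Polynomial.eval_prod]
      exact Finset.prod_eq_zero (Finset.mem_univ i) (by simp)
    simpa using this.neg
  refine ⟨fun p => ?_⟩
  induction p using MvPolynomial.induction_on with
  | C a =>
    exact isIntegral_algebraMap (R := esymmSubalgebra (ZMod 2) n W)
      (x := algebraMap (ZMod 2) (esymmSubalgebra (ZMod 2) n W) a)
  | add p q hp hq => exact hp.add hq
  | mul_X p i hp => exact hp.mul (hX i)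

lemma isIntegral_small {n : ℕ} (W : Subgroup (Equiv.Perm (Fin n))) :
    Algebra.IsIntegral (esymmSubalgebra (ZMod 2) n W) (invariantRing (ZMod 2) n W) := by
  have := isIntegral_big W
  refine ⟨fun r => ?_⟩
  have h : IsIntegral (esymmSubalgebra (ZMod 2) n W) (r : MvPolynomial (Fin n) (ZMod 2)) :=
    this.isIntegral _
  exact (isIntegral_algebraMap_iff (A := invariantRing (ZMod 2) n W)
    (B := MvPolynomial (Fin n) (ZMod 2)) Subtype.val_injective).1 h

lemma exists_over_prime {R S : Type*} [CommRing R] [CommRing S] (f : R →+* S)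
    (hf : f.IsIntegral) (P : Ideal R) (hP : P.IsPrime) (I : Ideal S)
    (hI : ∀ a, f a ∈ I → a ∈ P) :
    ∃ Q : Ideal S, I ≤ Q ∧ Q.IsPrime ∧ ∀ a, f a ∈ Q ↔ a ∈ P := by
  algebraize [f]
  obtain ⟨Q, h1, h2, h3⟩ := Ideal.exists_ideal_over_prime_of_isIntegral P I (fun a ha => hI a ha)
  refine ⟨Q, h1, h2, fun a => ?_⟩
  rw [← h3]
  rfl

lemma esymm_mem_prime {n : ℕ} (W : Subgroup (Equiv.Perm (Fin n))) (χ : W →* ℤˣ)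
    (τ : W) (hτ : χ τ = -1)
    (hχ : ∀ g, χ g = -1 → ∃ p : Fin 3 → Fin n, Function.Injective p ∧
        ∀ r r', p r ≠ (g : Equiv.Perm (Fin n)) (p r'))
    (P : Ideal (esymmSubalgebra (ZMod 2) n W)) [P.IsPrime]
    (hP : ∀ a : esymmSubalgebra (ZMod 2) n W,
      (a : invariantRing (ZMod 2) n W) ∈ annIdeal W χ → a ∈ P)
    (hz : ∀ a : esymmSubalgebra (ZMod 2) n W, ∀ j, Odd j → j + 5 < n →
      ((a : invariantRing (ZMod 2) n W) : MvPolynomial (Fin n) (ZMod 2)) =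
        MvPolynomial.esymm (Fin n) (ZMod 2) j → a ∈ P)
    (a : esymmSubalgebra (ZMod 2) n W) (j : ℕ) (hj : Odd j) (hjn : j ≤ n)
    (ha : ((a : invariantRing (ZMod 2) n W) : MvPolynomial (Fin n) (ZMod 2)) =
        MvPolynomial.esymm (Fin n) (ZMod 2) j) : a ∈ P := by
  let f1 : esymmSubalgebra (ZMod 2) n W →+* invariantRing (ZMod 2) n W :=
    (esymmSubalgebra (ZMod 2) n W).val.toRingHom
  let f2 : invariantRing (ZMod 2) n W →+* MvPolynomial (Fin n) (ZMod 2) :=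
    (invariantRing (ZMod 2) n W).val.toRingHom
  have i1 : RingHom.IsIntegral (R := esymmSubalgebra (ZMod 2) n W)
      (A := invariantRing (ZMod 2) n W) f1 := fun x => (isIntegral_small W).isIntegral x
  have i2 := isIntegral_big W
  have i3 : RingHom.IsIntegral (R := invariantRing (ZMod 2) n W)
      (A := MvPolynomial (Fin n) (ZMod 2)) f2 := fun x => by
    have h : IsIntegral (esymmSubalgebra (ZMod 2) n W) x := i2.isIntegral x
    have h2 : IsIntegral (invariantRing (ZMod 2) n W) x := h.tower_top
    exact h2
  obtain ⟨Q, hQJ, hQ, hQP⟩ := exists_over_prime (R := esymmSubalgebra (ZMod 2) n W)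
    (S := invariantRing (ZMod 2) n W) f1 i1 P inferInstance (annIdeal W χ) hP
  obtain ⟨Q', -, hQ', hQQ⟩ := exists_over_prime (R := invariantRing (ZMod 2) n W)
    (S := MvPolynomial (Fin n) (ZMod 2)) f2 i3 Q hQ ⊥ (by
      intro x hx
      have : x = 0 := Subtype.ext hx
      rw [this]; exact Q.zero_mem)
  have memP : ∀ a : esymmSubalgebra (ZMod 2) n W,
      a ∈ P ↔ ((a : invariantRing (ZMod 2) n W) : MvPolynomial (Fin n) (ZMod 2)) ∈ Q' :=
    fun a => (hQP a).symm.trans (hQQ _).symm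
  let π := Ideal.Quotient.mk Q'
  obtain ⟨g, hg, hgX⟩ := prime_lemma W χ τ hτ π (by
    intro b hb
    obtain ⟨r, hr, hr'⟩ := transfer_mem_annIdeal W χ τ hτ b hb
    have h1 : (r : MvPolynomial (Fin n) (ZMod 2)) ∈ Q' := by
      exact (hQQ _).2 (hQJ hr)
    rw [Ideal.Quotient.eq, CharTwo.sub_eq_add, ← hr']
    exact h1)
  obtain ⟨p, hp, hpg⟩ := hχ g hg
  have hchar : CharP (MvPolynomial (Fin n) (ZMod 2) ⧸ Q') 2 :=
    charP_of_injective_algebraMap (algebraMap (ZMod 2) _).injective 2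
  have hes : ∀ j, π (MvPolynomial.esymm (Fin n) (ZMod 2) j) =
      (Finset.univ.val.map (fun i => π (MvPolynomial.X i))).esymm j := by
    intro j
    rw [Finset.esymm_map_val, MvPolynomial.esymm, map_sum]
    refine Finset.sum_congr rfl fun t _ => ?_
    rw [map_prod]
  rw [memP, ha, ← Ideal.Quotient.eq_zero_iff_mem]
  refine (hes j).trans ?_
  refine esymm_vanish n _ p (fun r => (g : Equiv.Perm (Fin n)) (p r)) hp
    (g.1.injective.comp hp) hpg (fun r => hgX _) ?_ j hj hjn
  intro i hi hin
  rw [← hes]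
  refine Ideal.Quotient.eq_zero_iff_mem.2 ?_
  exact (memP ⟨⟨_, esymm_mem_invariantRing W i⟩,
    Algebra.subset_adjoin ⟨i, hi.pos, by omega, rfl⟩⟩).1 (hz _ i hi hin rfl)

lemma final_core {n : ℕ} (τ : Equiv.Perm (Fin n))
    (v : MvPolynomial (Fin n) (ZMod 2) →+* MvPolynomial (Fin n) (ZMod 2))
    (hinj : Function.Injective v)
    (hconst : ∀ p, MvPolynomial.constantCoeff (v p) = MvPolynomial.constantCoeff p)
    (hren : ∀ p (σ : Equiv.Perm (Fin n)), MvPolynomial.rename σ (v p) = v p)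
    (hsymm : ∀ q : MvPolynomial (Fin n) (ZMod 2), q.IsSymmetric → ∃ p, v p = q)
    (a₁ a₂ : MvPolynomial (Fin n) (ZMod 2))
    (hreg : ∀ M N d₁ d₂, a₁ ^ M = N * d₁ → a₂ ^ M = N * d₂ →
      MvPolynomial.constantCoeff N ≠ 0)
    (b₁ b₂ : MvPolynomial (Fin n) (ZMod 2))
    (hb₁ : MvPolynomial.rename τ b₁ = b₁ + v a₁)
    (hb₂ : MvPolynomial.rename τ b₂ = b₂ + v a₂)
    (s : MvPolynomial (Fin n) (ZMod 2)) (hs : MvPolynomial.constantCoeff s ≠ 0)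
    (p q : MvPolynomial (Fin n) (ZMod 2))
    (hq : MvPolynomial.rename τ q = q)
    (h : v s * (v a₁ * b₂ + v a₂ * b₁) = v a₁ * p + v a₂ * q) : False := by
  classical
  have hc₂ : MvPolynomial.constantCoeff a₂ = 0 := by
    have := congrArg MvPolynomial.constantCoeff hb₂
    rw [MvPolynomial.constantCoeff_rename, map_add, hconst] at this
    simpa using this
  have ha₁ : a₁ ≠ 0 := by
    intro h0
    exact hreg 1 a₂ 0 1 (by rw [h0]; simp) (by simp) hc₂
  have hv₁ : v a₁ ≠ 0 := fun h0 => ha₁ (hinj (by rw [h0, map_zero]))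
  obtain ⟨x, y, d, hxy, hx, hy⟩ :=
    UniqueFactorizationMonoid.exists_reduced_factors (v a₁) hv₁ (v a₂)
  have hd : d ≠ 0 := by
    rintro rfl
    exact hv₁ (by rw [← hx, zero_mul])
  have hx0 : x ≠ 0 := by
    rintro rfl
    exact hv₁ (by rw [← hx, mul_zero])
  have hxw : x ∣ q - v s * b₁ := by
    refine hxy.dvd_of_dvd_mul_left ⟨v s * b₂ - p, ?_⟩
    apply mul_left_cancel₀ hd
    rw [← mul_assoc, ← mul_assoc, hx, hy]
    linear_combination (-1 : MvPolynomial (Fin n) (ZMod 2)) * h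
  let Nm : MvPolynomial (Fin n) (ZMod 2) → MvPolynomial (Fin n) (ZMod 2) :=
    fun f => ∏ σ : Equiv.Perm (Fin n), MvPolynomial.rename σ f
  have hNm : ∀ f, ∃ g, v g = Nm f := by
    intro f
    apply hsymm
    intro e
    simp only [Nm]
    rw [map_prod]
    refine Fintype.prod_equiv (Equiv.mulLeft e) _ _ fun σ => ?_
    rw [MvPolynomial.rename_rename]
    rfl
  have hNmul : ∀ f g, Nm (f * g) = Nm f * Nm g := by
    intro f g
    simp only [Nm, map_mul, Finset.prod_mul_distrib]
  have hNv : ∀ f, Nm (v f) = v (f ^ Fintype.card (Equiv.Perm (Fin n))) := by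
    intro f
    simp only [Nm, hren]
    rw [Finset.prod_const, map_pow, Finset.card_univ]
  obtain ⟨nd, hnd⟩ := hNm d
  obtain ⟨nx, hnx⟩ := hNm x
  obtain ⟨ny, hny⟩ := hNm y
  have hnd0 : MvPolynomial.constantCoeff nd ≠ 0 := by
    refine hreg (Fintype.card (Equiv.Perm (Fin n))) nd nx ny ?_ ?_
    · apply hinj
      rw [← hNv, map_mul, hnd, hnx, ← hNmul, hx]
    · apply hinj
      rw [← hNv, map_mul, hnd, hny, ← hNmul, hy]
  have hdN : d ∣ Nm d := by
    have := Finset.dvd_prod_of_mem (fun σ : Equiv.Perm (Fin n) => MvPolynomial.rename σ d)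
      (Finset.mem_univ 1)
    simpa using this
  obtain ⟨d', hd'⟩ := hdN
  obtain ⟨w', hw'⟩ := hxw
  have key : v nd * (q - v s * b₁) = v a₁ * (d' * w') := by
    rw [hnd, hd', hw', ← hx]; ring
  have key2 := congrArg (MvPolynomial.rename τ) key
  rw [map_mul, map_mul, map_sub, map_mul, hren, hren, hren, hq, hb₁] at key2
  have key3 : v nd * v s = d' * w' - MvPolynomial.rename τ (d' * w') := by
    apply mul_left_cancel₀ hv₁
    linear_combination key - key2
  have := congrArg MvPolynomial.constantCoeff key3
  rw [map_sub, MvPolynomial.constantCoeff_rename, sub_self, map_mul, hconst, hconst] at this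
  exact mul_ne_zero hnd0 hs this

lemma exists_ann {n : ℕ} (W : Subgroup (Equiv.Perm (Fin n))) (χ : W →* ℤˣ)
    (τ : W) (hτ : χ τ = -1)
    (hχ : ∀ g, χ g = -1 → ∃ p : Fin 3 → Fin n, Function.Injective p ∧
        ∀ r r', p r ≠ (g : Equiv.Perm (Fin n)) (p r'))
    (θ : MvPolynomial (Fin n) (ZMod 2) ≃+* esymmSubalgebra (ZMod 2) n W)
    (hθ : ∀ i : Fin n, ((θ (MvPolynomial.X i) : invariantRing (ZMod 2) n W) :
        MvPolynomial (Fin n) (ZMod 2)) = MvPolynomial.esymm (Fin n) (ZMod 2) (i + 1))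
    (A : Set (Fin n)) (hA : ∀ j : Fin n, Even j.val → j.val + 6 < n → j ∈ A)
    (i : Fin n) (hi : Even i.val) :
    ∃ a : MvPolynomial (Fin n) (ZMod 2), ∃ K : ℕ, K ≠ 0 ∧
      (θ a : invariantRing (ZMod 2) n W) ∈ annIdeal W χ ∧
      a - MvPolynomial.X i ^ K ∈ Ideal.span (MvPolynomial.X '' A) := by
  let f : MvPolynomial (Fin n) (ZMod 2) →+* invariantRing (ZMod 2) n W :=
    (esymmSubalgebra (ZMod 2) n W).val.toRingHom.comp θ.toRingHom
  have hf : ∀ p, f p = (θ p : invariantRing (ZMod 2) n W) := fun p => rfl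
  have hrad : (MvPolynomial.X i : MvPolynomial (Fin n) (ZMod 2)) ∈
      ((annIdeal W χ).comap f ⊔ Ideal.span (MvPolynomial.X '' A)).radical := by
    rw [Ideal.radical_eq_sInf, Ideal.mem_sInf]
    rintro Q ⟨hQ, hQp⟩
    have hmem : ∀ a, a ∈ Q.comap (θ.symm : esymmSubalgebra (ZMod 2) n W →+* _) ↔ θ.symm a ∈ Q :=
      fun a => Iff.rfl
    have hp : (Q.comap (θ.symm : esymmSubalgebra (ZMod 2) n W →+* _)).IsPrime :=
      Ideal.IsPrime.comap _
    have := esymm_mem_prime W χ τ hτ hχ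
      (Q.comap (θ.symm : esymmSubalgebra (ZMod 2) n W →+* _)) ?_ ?_ (θ (MvPolynomial.X i))
      (i + 1) hi.add_one (by omega) (hθ i)
    · rw [hmem, RingEquiv.symm_apply_apply] at this
      exact this
    · intro a ha
      rw [hmem]
      refine hQ (Ideal.mem_sup_left ?_)
      rw [Ideal.mem_comap, hf, RingEquiv.apply_symm_apply]
      exact ha
    · intro a j hj hjn ha
      rw [hmem]
      have h1 : 1 ≤ j := hj.pos
      have : a = θ (MvPolynomial.X ⟨j - 1, by omega⟩) := by
        apply Subtype.ext
        apply Subtype.ext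
        rw [ha, hθ]
        simp only
        rw [Nat.sub_add_cancel h1]
      rw [this, RingEquiv.symm_apply_apply]
      refine hQ (Ideal.mem_sup_right (Ideal.subset_span ⟨_, hA _ ?_ ?_, rfl⟩))
      · obtain ⟨t, rfl⟩ := hj
        simp
      · simp only
        omega
  obtain ⟨K, hK⟩ := hrad
  have hK' : (MvPolynomial.X i : MvPolynomial (Fin n) (ZMod 2)) ^ (K + 1) ∈
      (annIdeal W χ).comap f ⊔ Ideal.span (MvPolynomial.X '' A) := by
    rw [pow_succ]
    exact Ideal.mul_mem_right _ _ hK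
  obtain ⟨y, hy, z, hz, hyz⟩ := Submodule.mem_sup.1 hK'
  refine ⟨y, K + 1, by omega, hy, ?_⟩
  rw [← hyz]
  simpa using hz

lemma not_free_general {n : ℕ} (hn : 6 ≤ n) (W : Subgroup (Equiv.Perm (Fin n))) (χ : W →* ℤˣ)
    (τ : W) (hτ : χ τ = -1)
    (hχ : ∀ g, χ g = -1 → ∃ p : Fin 3 → Fin n, Function.Injective p ∧
        ∀ r r', p r ≠ (g : Equiv.Perm (Fin n)) (p r')) :
    ¬ Module.Free (esymmSubalgebra (ZMod 2) n W) (invariantRing (ZMod 2) n W) := by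
  classical
  intro hfree
  obtain ⟨θ, hθ, hconst, hren, hsymm⟩ := exists_theta W
  obtain ⟨r, hr⟩ : ∃ r, r = (n - 1) / 2 := ⟨_, rfl⟩
  let i₁ : Fin n := ⟨2 * r, by omega⟩
  let i₂ : Fin n := ⟨2 * (r - 1), by omega⟩
  let i₃ : Fin n := ⟨2 * (r - 2), by omega⟩
  have h12 : i₁ ≠ i₂ := by
    intro h; have := congrArg Fin.val h; simp only [i₁, i₂] at this; omega
  have h13 : i₁ ≠ i₃ := by
    intro h; have := congrArg Fin.val h; simp only [i₁, i₃] at this; omega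
  have h23 : i₂ ≠ i₃ := by
    intro h; have := congrArg Fin.val h; simp only [i₂, i₃] at this; omega
  have hA : ∀ j : Fin n, Even j.val → j.val + 6 < n →
      j ∈ {j : Fin n | j ≠ i₁ ∧ j ≠ i₂ ∧ j ≠ i₃} := by
    intro j _ hj
    refine ⟨?_, ?_, ?_⟩ <;> rintro rfl <;> simp only [i₁, i₂, i₃] at hj <;> omega
  obtain ⟨a₁, K₁, hK₁, hJ₁, hs₁⟩ := exists_ann W χ τ hτ hχ θ hθ _ hA i₁ (by simp [i₁])
  obtain ⟨a₂, K₂, hK₂, hJ₂, hs₂⟩ := exists_ann W χ τ hτ hχ θ hθ _ hA i₂ (by simp [i₂])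
  obtain ⟨a₃, K₃, hK₃, hJ₃, hs₃⟩ := exists_ann W χ τ hτ hχ θ hθ _ hA i₃ (by simp [i₃])
  obtain ⟨reg, reg2⟩ := local_regular i₁ i₂ i₃ h12 h13 h23 K₁ K₂ K₃ hK₁ hK₂ hK₃ a₁ a₂ a₃ hs₁ hs₂ hs₃
  obtain ⟨b₁, hb₁, hb₁'⟩ := hJ₁
  obtain ⟨b₂, hb₂, hb₂'⟩ := hJ₂
  obtain ⟨b₃, hb₃, hb₃'⟩ := hJ₃
  let v : MvPolynomial (Fin n) (ZMod 2) →+* MvPolynomial (Fin n) (ZMod 2) :=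
    ((invariantRing (ZMod 2) n W).val.toRingHom.comp
      (esymmSubalgebra (ZMod 2) n W).val.toRingHom).comp θ.toRingHom
  have hv : ∀ p, v p = ((θ p : invariantRing (ZMod 2) n W) : MvPolynomial (Fin n) (ZMod 2)) :=
    fun p => rfl
  simp only [← hv] at hconst hren hsymm hb₁' hb₂' hb₃'
  have hinj : Function.Injective v := by
    intro p q hpq
    apply θ.injective
    apply Subtype.ext
    apply Subtype.ext
    exact hpq
  have two : (2 : MvPolynomial (Fin n) (ZMod 2)) = 0 := CharTwo.two_eq_zero
  have hu : ∀ (a a' b b' : MvPolynomial (Fin n) (ZMod 2)),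
      (∀ h : W, χ h = 1 → MvPolynomial.rename (h : Equiv.Perm (Fin n)) b = b) →
      (∀ h : W, χ h = -1 → MvPolynomial.rename (h : Equiv.Perm (Fin n)) b = b + v a) →
      (∀ h : W, χ h = 1 → MvPolynomial.rename (h : Equiv.Perm (Fin n)) b' = b') →
      (∀ h : W, χ h = -1 → MvPolynomial.rename (h : Equiv.Perm (Fin n)) b' = b' + v a') →
      v a * b' + v a' * b ∈ invariantRing (ZMod 2) n W := by
    intro a a' b b' h1 h2 h3 h4 g hg
    rw [map_add, map_mul, map_mul, hren, hren]
    rcases Int.units_eq_one_or (χ ⟨g, hg⟩) with h | h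
    · rw [show MvPolynomial.rename g b = b from h1 ⟨g, hg⟩ h,
        show MvPolynomial.rename g b' = b' from h3 ⟨g, hg⟩ h]
    · rw [show MvPolynomial.rename g b = b + v a from h2 ⟨g, hg⟩ h,
        show MvPolynomial.rename g b' = b' + v a' from h4 ⟨g, hg⟩ h]
      linear_combination (v a * v a') * two
  let u12 : invariantRing (ZMod 2) n W := ⟨_, hu a₁ a₂ b₁ b₂ hb₁ hb₁' hb₂ hb₂'⟩
  let u13 : invariantRing (ZMod 2) n W := ⟨_, hu a₁ a₃ b₁ b₃ hb₁ hb₁' hb₃ hb₃'⟩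
  let u23 : invariantRing (ZMod 2) n W := ⟨_, hu a₂ a₃ b₂ b₃ hb₂ hb₂' hb₃ hb₃'⟩
  have hsmul : ∀ (a : MvPolynomial (Fin n) (ZMod 2)) (u : invariantRing (ZMod 2) n W),
      ((θ a • u : invariantRing (ZMod 2) n W) : MvPolynomial (Fin n) (ZMod 2)) = v a * u :=
    fun a u => rfl
  have hrel : θ a₃ • u12 = θ a₁ • u23 + θ a₂ • u13 := by
    apply Subtype.ext
    change v a₃ * (v a₁ * b₂ + v a₂ * b₁) =
      v a₁ * (v a₂ * b₃ + v a₃ * b₂) + v a₂ * (v a₁ * b₃ + v a₃ * b₁)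
    linear_combination -(v a₁ * v a₂ * b₃) * two
  let T0 : Submonoid (MvPolynomial (Fin n) (ZMod 2)) :=
    { carrier := { s | MvPolynomial.constantCoeff s ≠ 0 }
      one_mem' := by simp
      mul_mem' := by
        intro a b ha hb
        change MvPolynomial.constantCoeff (a * b) ≠ 0
        rw [map_mul]
        exact mul_ne_zero ha hb }
  let T : Submonoid (esymmSubalgebra (ZMod 2) n W) := T0.map θ.toRingHom
  obtain ⟨s, hs, p, q, hpq⟩ := free_reg (E := esymmSubalgebra (ZMod 2) n W)
    (M := invariantRing (ZMod 2) n W) T (θ a₁) (θ a₂) (θ a₃) (by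
      intro u v w huvw
      obtain ⟨u, rfl⟩ := θ.surjective u
      obtain ⟨v, rfl⟩ := θ.surjective v
      obtain ⟨w, rfl⟩ := θ.surjective w
      obtain ⟨s, hs, p, q, hpq⟩ := reg u v w (θ.injective (by simpa using huvw))
      refine ⟨θ s, ⟨s, hs, rfl⟩, θ p, θ q, ?_⟩
      rw [← map_mul, hpq]
      simp) u12 u23 u13 hrel
  obtain ⟨s, hs, rfl⟩ := hs
  have hfin := congrArg (fun x : invariantRing (ZMod 2) n W =>
    (x : MvPolynomial (Fin n) (ZMod 2))) hpq
  refine final_core (τ : Equiv.Perm (Fin n)) v hinj hconst hren hsymm a₁ a₂ reg2 b₁ b₂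
    (hb₁' τ hτ) (hb₂' τ hτ) s hs p q (q.2 τ τ.2) hfin

/-- For `l > 2` and `m > 1`, the invariant ring `(ℤ/2ℤ)[x_1,…,x_{lm}]^{S_l≀S_m}`
is NOT a free module over the subalgebra generated by the elementary symmetric
polynomials `e_1,…,e_{lm}`; i.e. it is not Cohen-Macaulay over `ℤ/2ℤ`. -/
theorem invariantRing_Sl_wr_Sm_not_free_mod_two (l m : ℕ) (hl : 2 < l) (hm : 1 < m) :
    ¬ Module.Free (esymmSubalgebra (ZMod 2) (l * m) (wreathProduct l m))
      (invariantRing (ZMod 2) (l * m) (wreathProduct l m)) := by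
  obtain ⟨χ, ⟨τ, hτ⟩, hχ⟩ := exists_block_hom l m hl hm
  exact not_free_general (by nlinarith) (wreathProduct l m) χ τ hτ hχ
end

section
/- Let m ≥ 1 and identify each permutation σ ∈ Equiv.Perm (Fin (2m)) with its one-line word (σ(1),…,σ(2m)), ordering words lexicographically. Let W(2,m) ≤ Equiv.Perm (Fin (2m)) be the wreath product subgroup S_2≀S_m. Then σ is the lexicographically smallest element of its left W(2,m)-orbit {g∘σ : g ∈ W(2,m)} if and only if σ⁻¹(2i−1) < σ⁻¹(2i) for all 1 ≤ i ≤ m and σ⁻¹(2i−1) < σ⁻¹(2i+1) for all 1 ≤ i ≤ m−1; that is, if and only if in the word of σ the odd numbers 1,3,…,2m−1 appear in increasing order and each odd number 2i−1 appears earlier than its even successor 2i. -/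
set_option synthInstance.maxHeartbeats 1000000
set_option maxHeartbeats 1000000

open Finset

lemma mem_wreathBlock_two (m : ℕ) (i : Fin m) (x : Fin (2 * m)) :
    x ∈ wreathBlock 2 m i ↔ x.val / 2 = i.val := by
  simp only [wreathBlock, Finset.mem_filter, Finset.mem_univ, true_and]
  omega

lemma wreathProduct_two_block {m : ℕ} {g : Equiv.Perm (Fin (2 * m))}
    (hg : g ∈ wreathProduct 2 m) (x y : Fin (2 * m)) :
    (g x).val / 2 = (g y).val / 2 ↔ x.val / 2 = y.val / 2 := by
  have key : ∀ g ∈ wreathProduct 2 m, ∀ x y : Fin (2 * m), x.val / 2 = y.val / 2 →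
      (g x).val / 2 = (g y).val / 2 := by
    intro g hg x y hxy
    obtain ⟨j, hj⟩ := hg ⟨x.val / 2, by have := x.isLt; omega⟩
    have hx : g x ∈ wreathBlock 2 m j := by
      rw [← hj]
      exact Finset.mem_image_of_mem _ ((mem_wreathBlock_two _ _ _).2 rfl)
    have hy : g y ∈ wreathBlock 2 m j := by
      rw [← hj]
      exact Finset.mem_image_of_mem _ ((mem_wreathBlock_two _ _ _).2 hxy.symm)
    rw [mem_wreathBlock_two] at hx hy
    omega
  refine ⟨fun h => ?_, key g hg x y⟩
  have := key g⁻¹ (inv_mem hg) _ _ h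
  simpa using this

lemma mem_wreathProduct_two {m : ℕ} (g : Equiv.Perm (Fin (2 * m))) (e : Fin m → Fin m)
    (hgg : ∀ x, g (g x) = x) (hee : ∀ i, e (e i) = i)
    (h : ∀ x : Fin (2 * m), (g x).val / 2 =
      (e ⟨x.val / 2, by have := x.isLt; omega⟩).val) :
    g ∈ wreathProduct 2 m := by
  intro i
  refine ⟨e i, ?_⟩
  ext y
  rw [Finset.mem_image, mem_wreathBlock_two]
  constructor
  · rintro ⟨x, hx, rfl⟩
    rw [mem_wreathBlock_two] at hx
    rw [h]
    congr 2
    exact Fin.ext hx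
  · intro hy
    refine ⟨g y, ?_, hgg y⟩
    rw [mem_wreathBlock_two, h]
    have : (⟨y.val / 2, by have := y.isLt; omega⟩ : Fin m) = e i := Fin.ext hy
    rw [this, hee]

/-- If `g` only increases values at `2i`, `2i+1`-type positions and moves an earlier entry,
then `σ` is not minimal: every earlier-placed value is fixed. -/
lemma lex_fixed {n : ℕ} {σ g : Equiv.Perm (Fin n)} {a b : Fin n}
    (h : Pi.Lex (· < ·) (· < ·) ⇑σ ⇑(g * σ)) (hb : g b ≠ b)
    (ha : ∀ x, x < g x → σ⁻¹ a ≤ σ⁻¹ x) : σ⁻¹ a ≤ σ⁻¹ b := by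
  obtain ⟨k, hk1, hk2⟩ := h
  have h1 := ha (σ k) hk2
  rw [Equiv.Perm.inv_def, Equiv.symm_apply_apply] at h1
  by_contra hlt
  have h2 := hk1 (σ⁻¹ b) (lt_of_lt_of_le (not_le.1 hlt) h1)
  rw [Equiv.Perm.mul_apply, Equiv.Perm.inv_def, Equiv.apply_symm_apply] at h2
  exact hb h2.symm

theorem lex_min_orbit_iff_S2_wr_Sm (m : ℕ) (hm : 1 ≤ m)
    (σ : Equiv.Perm (Fin (2 * m))) :
    (∀ g ∈ wreathProduct 2 m, g * σ ≠ σ →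
        Pi.Lex (· < ·) (· < ·) ⇑σ ⇑(g * σ)) ↔
      ((∀ i : ℕ, ∀ hi : i < m,
          σ⁻¹ ⟨2 * i, by omega⟩ < σ⁻¹ ⟨2 * i + 1, by omega⟩) ∧
        (∀ i : ℕ, ∀ hi : i + 1 < m,
          σ⁻¹ ⟨2 * i, by omega⟩ < σ⁻¹ ⟨2 * i + 2, by omega⟩)) := by
  constructor
  · intro H
    have H' : ∀ g ∈ wreathProduct 2 m, ∀ b, g b ≠ b →
        Pi.Lex (· < ·) (· < ·) ⇑σ ⇑(g * σ) := by
      intro g hg b hb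
      refine H g hg fun h => hb ?_
      have : g = 1 := by simpa using h
      simp [this]
    have P1 : ∀ i : ℕ, ∀ hi : i < m,
          σ⁻¹ ⟨2 * i, by omega⟩ < σ⁻¹ ⟨2 * i + 1, by omega⟩ := by
      intro i hi
      set a : Fin (2 * m) := ⟨2 * i, by omega⟩ with ha
      set b : Fin (2 * m) := ⟨2 * i + 1, by omega⟩ with hb
      have hab : a ≠ b := by simp [ha, hb]
      have hgb : Equiv.swap a b b ≠ b := by simpa using hab
      have hmem : Equiv.swap a b ∈ wreathProduct 2 m := by
        refine mem_wreathProduct_two _ id (by simp) (by simp) ?_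
        intro x
        simp only [id]
        rw [Equiv.swap_apply_def]
        split_ifs with h1 h2
        · subst h1; simp [ha, hb]; omega
        · subst h2; simp [ha, hb]; omega
        · rfl
      refine lt_of_le_of_ne (lex_fixed (H' _ hmem b hgb) hgb ?_) (by simpa using hab)
      intro x hx
      rw [Equiv.swap_apply_def] at hx
      split_ifs at hx with h1 h2
      · rw [h1]
      · subst h2; simp [ha, hb, Fin.lt_def] at hx
      · exact absurd hx (lt_irrefl _)
    refine ⟨P1, ?_⟩
    intro i hi
    have Q := P1 i (by omega)
    set a : Fin (2 * m) := ⟨2 * i, by omega⟩ with ha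
    set b : Fin (2 * m) := ⟨2 * i + 1, by omega⟩ with hb
    set c : Fin (2 * m) := ⟨2 * i + 2, by omega⟩ with hc
    set d : Fin (2 * m) := ⟨2 * i + 3, by omega⟩ with hd
    have hac : a ≠ c := by simp [ha, hc]
    set g := Equiv.swap a c * Equiv.swap b d with hg
    have gdef : ∀ x, g x = if x = a then c else if x = c then a else if x = b then d
        else if x = d then b else x := by
      intro x
      simp only [hg, Equiv.Perm.mul_apply, Equiv.swap_apply_def, ha, hb, hc, hd, Fin.ext_iff]
      split_ifs <;> simp_all <;> omega
    have gval : ∀ x, (g x).val = if x.val = 2 * i then 2 * i + 2 else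
        if x.val = 2 * i + 2 then 2 * i else if x.val = 2 * i + 1 then 2 * i + 3
        else if x.val = 2 * i + 3 then 2 * i + 1 else x.val := by
      intro x
      rw [gdef]
      simp only [ha, hb, hc, hd, Fin.ext_iff]
      split_ifs <;> rfl
    have hgc : g c ≠ c := by
      intro h
      have := congrArg Fin.val h
      rw [gval] at this
      simp [hc] at this
    have hmem : g ∈ wreathProduct 2 m := by
      refine mem_wreathProduct_two _ (Equiv.swap ⟨i, by omega⟩ ⟨i + 1, by omega⟩) ?_ (by simp) ?_
      · intro x
        apply Fin.ext
        rw [gval, gval]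
        split_ifs <;> omega
      · intro x
        rw [gval, Equiv.swap_apply_def]
        simp only [Fin.ext_iff]
        split_ifs <;> simp only [] <;> omega
    refine lt_of_le_of_ne (lex_fixed (H' _ hmem c hgc) hgc ?_) (by simpa using hac)
    intro x hx
    rw [Fin.lt_def, gval] at hx
    have : x = a ∨ x = b := by
      simp only [ha, hb, Fin.ext_iff]
      split_ifs at hx <;> omega
    rcases this with rfl | rfl
    · exact le_rfl
    · exact Q.le
  · rintro ⟨P1, P2⟩ g hg hne
    have mono : ∀ j i : ℕ, ∀ hi : i < m, ∀ hji : j ≤ i,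
        σ⁻¹ ⟨2 * j, by omega⟩ ≤ σ⁻¹ ⟨2 * i, by omega⟩ ∧
        (j < i → σ⁻¹ ⟨2 * j, by omega⟩ < σ⁻¹ ⟨2 * i, by omega⟩) := by
      intro j i
      induction i with
      | zero =>
        intro hi hji
        obtain rfl : j = 0 := by omega
        exact ⟨le_rfl, fun h => absurd h (lt_irrefl _)⟩
      | succ n ih =>
        intro hi hji
        rcases Nat.lt_or_ge n j with h | h
        · obtain rfl : j = n + 1 := by omega
          exact ⟨le_rfl, fun h => absurd h (lt_irrefl _)⟩
        · have := lt_of_le_of_lt (ih (by omega) h).1 (P2 n hi)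
          exact ⟨this.le, fun _ => this⟩
    have hex : ∃ k, (g * σ) k ≠ σ k := by
      by_contra hcon
      push Not at hcon
      exact hne (Equiv.ext hcon)
    obtain ⟨k, hk, hmin⟩ := WellFounded.has_min (wellFounded_lt (α := Fin (2 * m)))
      {k | (g * σ) k ≠ σ k} hex
    have hfix : ∀ j, j < k → (g * σ) j = σ j := by
      intro j hj
      by_contra hcon
      exact hmin j hcon hj
    refine ⟨k, fun j hj => (hfix j hj).symm, ?_⟩
    have hfix' : ∀ x, σ⁻¹ x < k → g x = x := by
      intro x hx
      simpa using hfix _ hx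
    change g (σ k) ≠ σ k at hk
    change σ k < g (σ k)
    by_contra hlt
    have hlt : g (σ k) < σ k := lt_of_le_of_ne (not_lt.1 hlt) hk
    obtain ⟨v, hv⟩ : ∃ v, v = σ k := ⟨_, rfl⟩
    have hkv : σ⁻¹ v = k := by simp [hv]
    rw [← hv] at hk hlt
    obtain ⟨w, hw⟩ : ∃ w, w = g v := ⟨_, rfl⟩
    rw [← hw] at hk hlt
    rw [Fin.lt_def] at hlt
    have hvm := v.isLt
    have hu : σ⁻¹ ⟨2 * (w.val / 2), by omega⟩ < k := by
      have M := mono (w.val / 2) (v.val / 2) (by omega) (by omega)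
      rcases Nat.mod_two_eq_zero_or_one v.val with h0 | h1
      · have e : (⟨2 * (v.val / 2), by omega⟩ : Fin (2 * m)) = v := Fin.ext (by simp; omega)
        have := M.2 (by omega)
        rwa [e, hkv] at this
      · have e : (⟨2 * (v.val / 2) + 1, by omega⟩ : Fin (2 * m)) = v := Fin.ext (by simp; omega)
        have := lt_of_le_of_lt M.1 (P1 (v.val / 2) (by omega))
        rwa [e, hkv] at this
    have gu := hfix' _ hu
    have B := (wreathProduct_two_block hg v ⟨2 * (w.val / 2), by omega⟩).1 (by
      rw [gu, ← hw]; simp)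
    simp only at B
    have e : (⟨2 * (w.val / 2), by omega⟩ : Fin (2 * m)) = w := Fin.ext (by simp; omega)
    rw [e] at gu
    exact hk (g.injective (gu.trans hw))
end

section
/- Let l, m ≥ 1 and define c : {1,…,lm} → {1,…,m} by c(rl+s) = r+1 for 0 ≤ r < m and 1 ≤ s ≤ l (so c(x) = ⌈x/l⌉). For a permutation σ ∈ Equiv.Perm (Fin (lm)) let φ(σ) be the word (c(σ(1)), c(σ(2)), …, c(σ(lm))). Then φ restricts to a bijection from the set of permutations σ ∈ S_{lm} that are lexicographically smallest (in one-line notation, under the lexicographic order on words) in their left W(l,m)-orbit {g∘σ : g ∈ W(l,m)}, onto the set of words w of length lm over the alphabet {1,…,m} such that each letter i ∈ {1,…,m} occurs exactly l times in w (content {1^l, 2^l, …, m^l}) and, for every pair 1 ≤ i < j ≤ m, the first occurrence of i in w precedes the first occurrence of j. -/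
set_option synthInstance.maxHeartbeats 1000000
set_option maxHeartbeats 1000000

open Finset

namespace WreathAux

/-- The block index of an element. -/
def cc (l m : ℕ) (hl : 1 ≤ l) (x : Fin (l * m)) : Fin m :=
  ⟨x.val / l, Nat.div_lt_iff_lt_mul (by omega) |>.mpr (Nat.mul_comm l m ▸ x.isLt)⟩

/-- Coordinates (block, offset). -/
def ee (l m : ℕ) : Fin m × Fin l ≃ Fin (l * m) :=
  finProdFinEquiv.trans (finCongr (Nat.mul_comm m l))

lemma cc_ee (l m : ℕ) (hl : 1 ≤ l) (p : Fin m × Fin l) : cc l m hl (ee l m p) = p.1 := by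
  apply Fin.ext
  have h := p.2.isLt
  simp only [cc, ee, Equiv.trans_apply, finCongr_apply, Fin.val_cast, finProdFinEquiv_apply_val]
  rw [Nat.add_mul_div_left _ _ (by omega), Nat.div_eq_of_lt h, Nat.zero_add]

lemma mem_block (l m : ℕ) (hl : 1 ≤ l) (i : Fin m) (x : Fin (l * m)) :
    x ∈ wreathBlock l m i ↔ cc l m hl x = i := by
  simp only [wreathBlock, Finset.mem_filter, Finset.mem_univ, true_and, cc, Fin.ext_iff]
  rw [Nat.div_eq_iff (by omega), Nat.succ_mul]
  omega

lemma card_fiber (l m : ℕ) (hl : 1 ≤ l) (i : Fin m) :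
    (Finset.univ.filter (fun x => cc l m hl x = i)).card = l := by
  have : Finset.univ.filter (fun x => cc l m hl x = i)
      = (Finset.univ : Finset (Fin l)).image (fun r => ee l m (i, r)) := by
    ext x
    obtain ⟨p, rfl⟩ := (ee l m).surjective x
    obtain ⟨a, b⟩ := p
    simp only [Finset.mem_filter, Finset.mem_univ, true_and, cc_ee, Finset.mem_image]
    constructor
    · rintro rfl; exact ⟨b, rfl⟩
    · rintro ⟨r, hr⟩
      have := (ee l m).injective hr
      simp only [Prod.mk.injEq] at this
      exact this.1.symm
  rw [this, Finset.card_image_of_injective]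
  · simp
  · intro a b h
    have := (ee l m).injective h
    simpa using this

lemma mem_of_perm (l m : ℕ) (hl : 1 ≤ l) (g : Equiv.Perm (Fin (l * m))) (p : Equiv.Perm (Fin m))
    (h : ∀ x, cc l m hl (g x) = p (cc l m hl x)) : g ∈ wreathProduct l m := by
  intro i
  refine ⟨p i, ?_⟩
  ext y
  obtain ⟨x, rfl⟩ := g.surjective y
  simp only [Finset.mem_image, mem_block l m hl, h]
  constructor
  · rintro ⟨z, hz, hzx⟩
    rw [← g.injective hzx, hz]
  · intro hx
    exact ⟨x, p.injective hx, rfl⟩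

lemma exists_map (l m : ℕ) (hl : 1 ≤ l) (g : Equiv.Perm (Fin (l * m)))
    (hg : g ∈ wreathProduct l m) :
    ∃ p : Fin m → Fin m, Function.Injective p ∧ ∀ x, cc l m hl (g x) = p (cc l m hl x) := by
  choose p hp using (show ∀ i : Fin m, ∃ j : Fin m,
    (wreathBlock l m i).image g = wreathBlock l m j from hg)
  have key : ∀ x, cc l m hl (g x) = p (cc l m hl x) := by
    intro x
    rw [← mem_block, ← hp]
    exact Finset.mem_image_of_mem _ ((mem_block l m hl _ _).2 rfl)
  refine ⟨p, ?_, key⟩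
  apply Finite.injective_iff_surjective.mpr
  intro i
  refine ⟨cc l m hl (g.symm (ee l m (i, ⟨0, hl⟩))), ?_⟩
  rw [← key]
  simp [cc_ee]

lemma lex_irrefl_swap {n : ℕ} {a b : Fin n → Fin n}
    (h1 : Pi.Lex (· < ·) (· < ·) a b) (h2 : Pi.Lex (· < ·) (· < ·) b a) : False := by
  obtain ⟨i, hi, hi'⟩ := h1
  obtain ⟨j, hj, hj'⟩ := h2
  rcases lt_trichotomy i j with h | h | h
  · have := hj i h
    rw [this] at hi'; exact lt_irrefl _ hi'
  · subst h; exact lt_asymm hi' hj'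
  · have := hi j h
    rw [this] at hj'; exact lt_irrefl _ hj'

/-- The set of lexicographically minimal permutations. -/
def AA (l m : ℕ) : Set (Equiv.Perm (Fin (l * m))) :=
  { σ : Equiv.Perm (Fin (l * m)) | ∀ g ∈ wreathProduct l m, g * σ ≠ σ →
          Pi.Lex (· < ·) (· < ·) ⇑σ ⇑(g * σ) }

/-- The set of words. -/
def BB (l m : ℕ) : Set (Fin (l * m) → Fin m) :=
  { w : Fin (l * m) → Fin m |
          (∀ i : Fin m, (Finset.univ.filter (fun x => w x = i)).card = l) ∧
          ∀ i j : Fin m, i < j →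
            ∃ x : Fin (l * m), w x = i ∧ ∀ y : Fin (l * m), y ≤ x → w y ≠ j }

lemma cc_lt (l m : ℕ) (hl : 1 ≤ l) {x y : Fin (l * m)} (h : cc l m hl x < cc l m hl y) :
    x < y := by
  by_contra hc
  push Not at hc
  have : y.val / l ≤ x.val / l := Nat.div_le_div_right hc
  exact absurd h (not_lt.2 this)

lemma mapsTo (l m : ℕ) (hl : 1 ≤ l) (σ : Equiv.Perm (Fin (l * m))) (hσ : σ ∈ AA l m) :
    (fun x => cc l m hl (σ x)) ∈ BB l m := by
  refine ⟨fun i => ?_, fun i j hij => ?_⟩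
  · refine Eq.trans ?_ (card_fiber l m hl i)
    apply Finset.card_bij (fun x _ => σ x)
    · intro a ha; simpa using ha
    · intro a _ b _ h; exact σ.injective h
    · intro b hb
      exact ⟨σ.symm b, by simpa using hb, by simp⟩
  · by_contra hcon
    push Not at hcon
    let g : Equiv.Perm (Fin (l * m)) :=
      (ee l m).permCongr (Equiv.prodCongr (Equiv.swap i j) (Equiv.refl _))
    have hgc : ∀ x, cc l m hl (g x) = Equiv.swap i j (cc l m hl x) := by
      intro x
      obtain ⟨p, rfl⟩ := (ee l m).surjective x
      simp [g, Equiv.permCongr_apply, cc_ee]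
    have hgfix : ∀ x, cc l m hl x ≠ i → cc l m hl x ≠ j → g x = x := by
      intro x
      obtain ⟨p, rfl⟩ := (ee l m).surjective x
      obtain ⟨a, b⟩ := p
      intro h1 h2
      rw [cc_ee] at h1 h2
      simp [g, Equiv.permCongr_apply, Equiv.swap_apply_of_ne_of_ne h1 h2]
    have hgW := mem_of_perm l m hl g _ hgc
    have hne : g * σ ≠ σ := by
      intro h
      have h1 : g = 1 := by simpa using h
      have h2 := hgc (ee l m (i, ⟨0, hl⟩))
      rw [h1] at h2
      simp [cc_ee] at h2
      exact hij.ne h2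
    obtain ⟨k, hk, hk'⟩ := hσ g hgW hne
    change σ k < g (σ k) at hk'
    change ∀ t, t < k → σ t = g (σ t) at hk
    by_cases hki : cc l m hl (σ k) = i
    · obtain ⟨y, hyk, hy⟩ := hcon k hki
      have hyk' : y < k := lt_of_le_of_ne hyk (by
        rintro rfl; exact hij.ne (hki.symm.trans hy))
      have h := hgc (σ y)
      rw [← hk y hyk', hy, Equiv.swap_apply_right] at h
      exact hij.ne' h
    · by_cases hkj : cc l m hl (σ k) = j
      · have : g (σ k) < σ k := by
          apply cc_lt l m hl
          rw [hgc, hkj, Equiv.swap_apply_right]; exact hij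
        exact lt_asymm this hk'
      · rw [hgfix _ hki hkj] at hk'
        exact lt_irrefl _ hk'

lemma exists_min (l m : ℕ) (σ : Equiv.Perm (Fin (l * m))) :
    ∃ g ∈ wreathProduct l m, g * σ ∈ AA l m := by
  classical
  obtain ⟨g, hg, hmin⟩ := Finset.exists_min_image
    (Finset.univ.filter (fun g => g ∈ wreathProduct l m))
    (fun g => toLex (⇑(g * σ))) ⟨1, by simp [one_mem]⟩
  simp only [Finset.mem_filter, Finset.mem_univ, true_and] at hg hmin
  refine ⟨g, hg, fun h hh hne => ?_⟩
  have := hmin (h * g) (mul_mem hh hg)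
  have h2 := lt_of_le_of_ne this (by
    intro h3
    apply hne
    have h4 := toLex.injective h3
    rw [← mul_assoc]
    exact (DFunLike.coe_injective h4).symm)
  rw [← mul_assoc]
  exact h2

lemma main (l m : ℕ) (hl : 1 ≤ l) :
    Set.BijOn (fun (σ : Equiv.Perm (Fin (l * m))) x => cc l m hl (σ x)) (AA l m) (BB l m) := by
  refine ⟨fun σ hσ => mapsTo l m hl σ hσ, ?_, ?_⟩
  · intro σ hσ τ hτ hst
    have hst' : ∀ x, cc l m hl (σ x) = cc l m hl (τ x) := fun x => congrFun hst x
    by_contra hne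
    have hg : τ * σ⁻¹ ∈ wreathProduct l m := by
      apply mem_of_perm l m hl _ 1
      intro x
      simp [← hst']
    have hg' : σ * τ⁻¹ ∈ wreathProduct l m := by
      apply mem_of_perm l m hl _ 1
      intro x
      simp [hst']
    have h1 := hσ _ hg (by simpa using Ne.symm hne)
    have h2 := hτ _ hg' (by simpa using hne)
    simp only [inv_mul_cancel_right] at h1 h2
    exact lex_irrefl_swap h1 h2
  · rintro w hw
    have hcard : ∀ i, Nonempty ({x // w x = i} ≃ {x // cc l m hl x = i}) := by
      intro i
      refine ⟨Fintype.equivOfCardEq ?_⟩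
      rw [Fintype.card_subtype, Fintype.card_subtype, hw.1 i, card_fiber]
    let σ : Equiv.Perm (Fin (l * m)) := Equiv.ofFiberEquiv (fun i => (hcard i).some)
    have hσ : ∀ x, cc l m hl (σ x) = w x := fun x => Equiv.ofFiberEquiv_map _ x
    obtain ⟨g, hg, hmin⟩ := exists_min l m σ
    obtain ⟨p, hp, hgp⟩ := exists_map l m hl g hg
    have hB := mapsTo l m hl _ hmin
    have hval : ∀ x, cc l m hl ((g * σ) x) = p (w x) := by
      intro x
      rw [← hσ, ← hgp]; rfl
    have hmono : StrictMono p := by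
      intro i j hij
      by_contra hc
      have hlt : p j < p i := lt_of_le_of_ne (not_lt.1 hc) (fun h => hij.ne' (hp h))
      obtain ⟨x, hx, hx'⟩ := hw.2 i j hij
      obtain ⟨y, hy, hy'⟩ := hB.2 _ _ hlt
      simp only [hval] at hy hy'
      rcases le_total y x with h | h
      · exact hx' y h (hp hy)
      · exact hy' x h (by rw [hx])
    have hid : p = id := by
      apply (StrictMono.range_inj hmono strictMono_id).1
      rw [(Finite.injective_iff_surjective.mp hp).range_eq, Set.range_id]
    refine ⟨g * σ, hmin, ?_⟩
    funext x
    change cc l m hl ((g * σ) x) = w x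
    rw [hval, hid]; rfl

end WreathAux

/-- The map sending a permutation `σ ∈ S_{lm}` to the word
`(c(σ(1)), …, c(σ(lm)))`, where `c` sends an element to the index of its block
(0-indexed: `c(x) = ⌊x/l⌋`), restricts to a bijection from the set of
permutations that are lexicographically smallest in their left
`S_l ≀ S_m`-orbit onto the set of words of content `{1^l, …, m^l}` in which,
for `i < j`, the first occurrence of `i` precedes the first occurrence of `j`. -/
theorem lex_min_orbit_reps_equiv_words (l m : ℕ) (hl : 1 ≤ l) (hm : 1 ≤ m) :
    Set.BijOn
      (fun (σ : Equiv.Perm (Fin (l * m))) (x : Fin (l * m)) =>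
        (⟨(σ x).val / l, by
          have h := (σ x).isLt
          exact Nat.div_lt_iff_lt_mul (by omega) |>.mpr
            (Nat.mul_comm l m ▸ h)⟩ : Fin m))
      { σ : Equiv.Perm (Fin (l * m)) | ∀ g ∈ wreathProduct l m, g * σ ≠ σ →
          Pi.Lex (· < ·) (· < ·) ⇑σ ⇑(g * σ) }
      { w : Fin (l * m) → Fin m |
          (∀ i : Fin m, (Finset.univ.filter (fun x => w x = i)).card = l) ∧
          ∀ i j : Fin m, i < j →
            ∃ x : Fin (l * m), w x = i ∧ ∀ y : Fin (l * m), y ≤ x → w y ≠ j } := by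
  exact WreathAux.main l m hl
end
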